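/- There exist constants χ > 0 and C > 0, depending only on n, λ and Λ, such that for every g ∈ M_{λ,Λ} and every solution u of the Ginzburg–Landau equation −Δ_g u = ε⁻²(1−|u|²)u on B₁: the function ρ ↦ e^{χρ} ρ^{2−n} ∫_{B_ρ} e_ε(u) dvol_g is nondecreasing on (0,1), and for all 0 < σ ≤ ρ < 1, e^{χρ} ρ^{2−n} ∫_{B_ρ} e_ε(u) dvol_g − e^{χσ} σ^{2−n} ∫_{B_σ} e_ε(u) dvol_g ≥ (1/(1+Cρ)) [ ∫_σ^ρ e^{χs} s^{1−n} ( ∫_{B_s} (1−|u|²)²/(2ε²) dvol_g ) ds + ∫_{B_ρ∖B_σ} e^{χ|x|} |x|^{2−n} |∇_r u(x)|² √(det g(x)) dx ]. -/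

import Mathlib

open MeasureTheory Metric

noncomputable section

/-- `n`-dimensional Euclidean space. -/
abbrev Euc (n : ℕ) : Type := EuclideanSpace ℝ (Fin n)

/-- The real inner product of two complex numbers, viewing `ℂ ≅ ℝ²`. -/
def rdot (v w : ℂ) : ℝ := v.re * w.re + v.im * w.im

/-- The `i`-th partial derivative of a function on Euclidean space. -/
def pd {n : ℕ} (u : Euc n → ℂ) (i : Fin n) (x : Euc n) : ℂ :=
  fderiv ℝ u x (EuclideanSpace.single i 1)

/-- `√(det g)`. -/
def sqrtDet {n : ℕ} (g : Euc n → Matrix (Fin n) (Fin n) ℝ) (x : Euc n) : ℝ :=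
  Real.sqrt (g x).det

/-- `g^{ij} ∂_i u · ∂_j u`, the squared norm of the gradient of `u` with respect to `g`. -/
def gradSq {n : ℕ} (g : Euc n → Matrix (Fin n) (Fin n) ℝ) (u : Euc n → ℂ) (x : Euc n) : ℝ :=
  ∑ i, ∑ j, (g x)⁻¹ i j * rdot (pd u i x) (pd u j x)

/-- The Ginzburg–Landau energy density `e_ε(u)`. -/
def eDen {n : ℕ} (g : Euc n → Matrix (Fin n) (Fin n) ℝ) (ε : ℝ) (u : Euc n → ℂ)
    (x : Euc n) : ℝ :=
  gradSq g u x / 2 + (1 - ‖u x‖ ^ 2) ^ 2 / (4 * ε ^ 2)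

/-- The class `M_{λ,Λ}` of Lipschitz metrics on the unit ball: symmetric positive definite,
equal to the identity at `0`, Lipschitz components, and uniformly elliptic. -/
def MemM (n : ℕ) (lam Lam : ℝ) (g : Euc n → Matrix (Fin n) (Fin n) ℝ) : Prop :=
  g 0 = 1 ∧
  (∀ x ∈ ball (0 : Euc n) 1, (g x).IsSymm ∧ (g x).PosDef) ∧
  (∀ i j : Fin n,
    LipschitzOnWith (Real.toNNReal Lam) (fun x => g x i j) (ball (0 : Euc n) 1)) ∧
  (∀ x ∈ ball (0 : Euc n) 1, ∀ ξ : Fin n → ℝ,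
    lam * ∑ i, ξ i ^ 2 ≤ ∑ i, ∑ j, g x i j * ξ i * ξ j ∧
    ∑ i, ∑ j, g x i j * ξ i * ξ j ≤ lam⁻¹ * ∑ i, ξ i ^ 2)

/-- A weak solution `u ∈ W^{1,2}(B₁; ℂ)`, `|u| ≤ 1`, of the Ginzburg–Landau equation
`−Δ_g u = ε⁻²(1−|u|²)u` on the unit ball. -/
def IsGLSol (n : ℕ) (g : Euc n → Matrix (Fin n) (Fin n) ℝ) (ε : ℝ) (u : Euc n → ℂ) : Prop :=
  DifferentiableOn ℝ u (ball (0 : Euc n) 1) ∧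
  (∀ x ∈ ball (0 : Euc n) 1, ‖u x‖ ≤ 1) ∧
  IntegrableOn (fun x => eDen g ε u x * sqrtDet g x) (ball (0 : Euc n) 1) ∧
  ∀ ζ : Euc n → ℂ, ContDiff ℝ 1 ζ → tsupport ζ ⊆ ball (0 : Euc n) 1 →
    ∫ x in ball (0 : Euc n) 1,
      ((∑ i, ∑ j, (g x)⁻¹ i j * rdot (pd u i x) (pd ζ j x))
        - (1 - ‖u x‖ ^ 2) / ε ^ 2 * rdot (u x) (ζ x)) * sqrtDet g x = 0

/-- The radial derivative `∇_r u(x) = g^{ij}(x) (x_i/|x|) ∂_j u(x)`. -/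
def radD {n : ℕ} (g : Euc n → Matrix (Fin n) (Fin n) ℝ) (u : Euc n → ℂ) (x : Euc n) : ℂ :=
  ∑ i, ∑ j, (((g x)⁻¹ i j * (x i / ‖x‖) : ℝ) : ℂ) * pd u j x

/-- Symmetric matrices with ellipticity constant `lam`, as functions of two indices. -/
def ellipticSet (n : ℕ) (lam : ℝ) : Set (Fin n → Fin n → ℝ) :=
  {m | (∀ i j, m i j = m j i) ∧ ∀ ξ : Fin n → ℝ,
    lam * ∑ i, ξ i ^ 2 ≤ ∑ i, ∑ j, m i j * ξ i * ξ j ∧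
    ∑ i, ∑ j, m i j * ξ i * ξ j ≤ lam⁻¹ * ∑ i, ξ i ^ 2}

lemma convex_ellipticSet (n : ℕ) (lam : ℝ) : Convex ℝ (ellipticSet n lam) := by
  intro m hm k hk a b ha hb hab
  have key : ∀ ξ : Fin n → ℝ, ∑ i, ∑ j, (a • m + b • k) i j * ξ i * ξ j =
      a * (∑ i, ∑ j, m i j * ξ i * ξ j) + b * ∑ i, ∑ j, k i j * ξ i * ξ j := by
    intro ξ
    simp only [Finset.mul_sum, ← Finset.sum_add_distrib, Pi.add_apply, Pi.smul_apply, smul_eq_mul]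
    refine Finset.sum_congr rfl fun i _ => Finset.sum_congr rfl fun j _ => by ring
  refine ⟨fun i j => by simp [hm.1 i j, hk.1 i j], fun ξ => ?_⟩
  rw [key]
  obtain ⟨h1, h2⟩ := hm.2 ξ
  obtain ⟨h3, h4⟩ := hk.2 ξ
  have h5 := mul_le_mul_of_nonneg_left h1 ha
  have h6 := mul_le_mul_of_nonneg_left h2 ha
  have h7 := mul_le_mul_of_nonneg_left h3 hb
  have h8 := mul_le_mul_of_nonneg_left h4 hb
  obtain rfl : b = 1 - a := by linarith
  constructor <;> nlinarith

lemma isCompact_ellipticSet (n : ℕ) (lam : ℝ) (hlam : 0 < lam) :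
    IsCompact (ellipticSet n lam) := by
  refine Metric.isCompact_of_isClosed_isBounded ?_ ?_
  · have : ellipticSet n lam = (⋂ i, ⋂ j, {m | m i j = m j i}) ∩ ⋂ ξ : Fin n → ℝ,
        ({m | lam * ∑ i, ξ i ^ 2 ≤ ∑ i, ∑ j, m i j * ξ i * ξ j} ∩
          {m | ∑ i, ∑ j, m i j * ξ i * ξ j ≤ lam⁻¹ * ∑ i, ξ i ^ 2}) := by
      ext m; simp [ellipticSet]
    rw [this]
    refine IsClosed.inter (isClosed_iInter fun i => isClosed_iInter fun j =>
      isClosed_eq (by fun_prop) (by fun_prop)) (isClosed_iInter fun ξ =>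
      (isClosed_le (by fun_prop) (by fun_prop)).inter (isClosed_le (by fun_prop) (by fun_prop)))
  · refine (Metric.isBounded_iff_subset_closedBall 0).2 ⟨lam⁻¹ * 2, fun m hm => ?_⟩
    rw [mem_closedBall_zero_iff]
    refine (pi_norm_le_iff_of_nonneg (by positivity)).2 fun i =>
      (pi_norm_le_iff_of_nonneg (by positivity)).2 fun j => ?_
    rw [Real.norm_eq_abs, abs_le]
    have hd : ∀ k, 0 ≤ m k k ∧ m k k ≤ lam⁻¹ := by
      intro k
      have := hm.2 (Pi.single k 1)
      simp [Pi.single_apply] at this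
      exact ⟨by linarith, this.2⟩
    by_cases hij : i = j
    · subst hij
      have := hd i
      have h0 : 0 < lam⁻¹ := by positivity
      constructor <;> linarith
    have h1 := hm.2 (Pi.single i 1 + Pi.single j 1)
    have e1 : ∑ k, (Pi.single i 1 + Pi.single j 1 : Fin n → ℝ) k ^ 2 = 2 := by
      simp [Pi.single_apply, add_sq, Finset.sum_add_distrib, Ne.symm hij]
      norm_num
    have e2 : ∑ k, ∑ l, m k l * (Pi.single i 1 + Pi.single j 1 : Fin n → ℝ) k *
        (Pi.single i 1 + Pi.single j 1 : Fin n → ℝ) l = m i i + m j j + 2 * m i j := by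
      simp [Pi.single_apply, mul_add, Finset.sum_add_distrib, hm.1 j i]
      ring
    rw [e1, e2] at h1
    have := hd i
    have := hd j
    constructor <;> linarith

lemma isUnit_det_of_mem_ellipticSet {n : ℕ} {lam : ℝ} (hlam : 0 < lam) {m : Fin n → Fin n → ℝ}
    (hm : m ∈ ellipticSet n lam) : (Matrix.of m).det ≠ 0 := by
  intro h
  obtain ⟨v, hv, h⟩ := Matrix.exists_mulVec_eq_zero_iff.2 h
  have h1 := (hm.2 v).1
  have h2 : ∑ i, ∑ j, m i j * v i * v j = 0 := by
    refine Finset.sum_eq_zero fun i _ => ?_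
    have := congrFun h i
    simp only [Matrix.mulVec, dotProduct, Matrix.of_apply, Pi.zero_apply] at this
    calc ∑ j, m i j * v i * v j = v i * ∑ j, m i j * v j := by
          rw [Finset.mul_sum]; exact Finset.sum_congr rfl fun j _ => by ring
      _ = 0 := by rw [this, mul_zero]
  rw [h2] at h1
  have h3 : ∑ i, v i ^ 2 ≤ 0 := by
    by_contra! h4
    have := mul_pos hlam h4
    linarith
  apply hv
  ext i
  have := (Finset.sum_eq_zero_iff_of_nonneg (fun i _ => sq_nonneg (v i))).1
    (le_antisymm h3 (Finset.sum_nonneg fun i _ => sq_nonneg _)) i (Finset.mem_univ i)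
  simpa using this

lemma contDiff_det_of {n : ℕ} {E : Type*} [NormedAddCommGroup E] [NormedSpace ℝ E]
    {f : E → Fin n → Fin n → ℝ} (hf : ∀ i j, ContDiff ℝ 1 fun x => f x i j) :
    ContDiff ℝ 1 fun x => (Matrix.of (f x)).det := by
  simp only [Matrix.det_apply, Matrix.of_apply]
  refine ContDiff.sum fun σ _ => ?_
  refine ContDiff.const_smul _ ?_
  exact contDiff_prod fun i _ => hf _ _

lemma contDiffAt_inv_of {n : ℕ} {m : Fin n → Fin n → ℝ} (hm : (Matrix.of m).det ≠ 0)
    (i j : Fin n) :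
    ContDiffAt ℝ 1 (fun m : Fin n → Fin n → ℝ => (Matrix.of m)⁻¹ i j) m := by
  have hd : ContDiff ℝ 1 fun m : Fin n → Fin n → ℝ => (Matrix.of m).det :=
    contDiff_det_of fun i j => by fun_prop
  have ha : ContDiff ℝ 1 fun m : Fin n → Fin n → ℝ => (Matrix.of m).adjugate i j := by
    simp only [Matrix.adjugate_apply]
    refine contDiff_det_of (f := fun m => (Matrix.of m).updateRow j (Pi.single i 1)) fun k l => ?_
    by_cases hk : k = j
    · subst hk; simp only [Matrix.updateRow_self]; exact contDiff_const
    · simp only [Matrix.updateRow_ne hk, Matrix.of_apply]; fun_prop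
  have : (fun m : Fin n → Fin n → ℝ => (Matrix.of m)⁻¹ i j) =
      fun m => ((Matrix.of m).det)⁻¹ * (Matrix.of m).adjugate i j := by
    ext m; rw [Matrix.inv_def]; simp
  rw [this]
  exact (hd.contDiffAt.inv hm).mul ha.contDiffAt

/-- A function that is `C¹` near a compact convex set is bounded and Lipschitz there. -/
lemma exists_bound_of_contDiffAt {E : Type*} [NormedAddCommGroup E] [NormedSpace ℝ E]
    {K : Set E} (hK : IsCompact K) (hc : Convex ℝ K) {F : E → ℝ}
    (hF : ∀ m ∈ K, ContDiffAt ℝ 1 F m) :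
    ∃ L : ℝ, 0 ≤ L ∧ (∀ m ∈ K, |F m| ≤ L) ∧ ∀ m ∈ K, ∀ k ∈ K, |F m - F k| ≤ L * ‖m - k‖ := by
  have h1 : ContinuousOn (fderiv ℝ F) K := fun m hm =>
    ((hF m hm).continuousAt_fderiv (by simp)).continuousWithinAt
  have h2 : ContinuousOn F K := fun m hm => (hF m hm).continuousAt.continuousWithinAt
  obtain ⟨C1, hC1⟩ := hK.exists_bound_of_continuousOn h1
  obtain ⟨C2, hC2⟩ := hK.exists_bound_of_continuousOn h2
  refine ⟨max (max C1 C2) 0, le_max_right _ _, fun m hm => (hC2 m hm).trans ?_, fun m hm k hk => ?_⟩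
  · simp
  · have := hc.norm_image_sub_le_of_norm_fderiv_le (f := F) (C := max (max C1 C2) 0)
      (fun x hx => (hF x hx).differentiableAt (by simp)) (fun x hx => (hC1 x hx).trans (by simp)) hk hm
    simpa using this

/-- The quantitative bounds on a metric used below. -/
structure GoodMetric (n : ℕ) (g : Euc n → Matrix (Fin n) (Fin n) ℝ) (lam L β : ℝ) : Prop where
  symm : ∀ x ∈ ball (0 : Euc n) 1, ∀ i j, (g x)⁻¹ i j = (g x)⁻¹ j i
  ellip : ∀ x ∈ ball (0 : Euc n) 1, ∀ ξ : Fin n → ℝ,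
    lam * ∑ i, ξ i ^ 2 ≤ ∑ i, ∑ j, (g x)⁻¹ i j * (ξ i * ξ j)
  inv_zero : ∀ i j, (g 0)⁻¹ i j = if i = j then 1 else 0
  inv_le : ∀ x ∈ ball (0 : Euc n) 1, ∀ i j, |(g x)⁻¹ i j| ≤ L
  inv_lip : ∀ x ∈ ball (0 : Euc n) 1, ∀ y ∈ ball (0 : Euc n) 1, ∀ i j,
    |(g x)⁻¹ i j - (g y)⁻¹ i j| ≤ L * ‖x - y‖
  le_det : ∀ x ∈ ball (0 : Euc n) 1, β ≤ sqrtDet g x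
  det_le : ∀ x ∈ ball (0 : Euc n) 1, sqrtDet g x ≤ L
  det_lip : ∀ x ∈ ball (0 : Euc n) 1, ∀ y ∈ ball (0 : Euc n) 1,
    |sqrtDet g x - sqrtDet g y| ≤ L * ‖x - y‖

lemma le_inv_quadForm {n : ℕ} {lam : ℝ} (hlam : 0 < lam) {m : Fin n → Fin n → ℝ}
    (hm : m ∈ ellipticSet n lam) (ξ : Fin n → ℝ) :
    lam * ∑ i, ξ i ^ 2 ≤ ∑ i, ∑ j, (Matrix.of m)⁻¹ i j * (ξ i * ξ j) := by
  have hu : IsUnit (Matrix.of m).det := (isUnit_det_of_mem_ellipticSet hlam hm).isUnit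
  set N := (Matrix.of m)⁻¹
  set η : Fin n → ℝ := N.mulVec ξ
  have hη : (Matrix.of m).mulVec η = ξ := by
    simp [η, N, Matrix.mulVec_mulVec, Matrix.mul_nonsing_inv _ hu]
  have hη' : ∀ i, ∑ j, m i j * η j = ξ i := fun i => congrFun hη i
  have h1 := (hm.2 (fun i => η i - lam * ξ i)).1
  have h2 := (hm.2 ξ).2
  have e1 : ∑ i, ∑ j, N i j * (ξ i * ξ j) = ∑ i, ξ i * η i := by
    refine Finset.sum_congr rfl fun i _ => ?_
    simp only [η, Matrix.mulVec, dotProduct, Finset.mul_sum]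
    exact Finset.sum_congr rfl fun j _ => by ring
  have e2 : ∑ i, ∑ j, m i j * (η i - lam * ξ i) * (η j - lam * ξ j) =
      (∑ i, ξ i * η i) - 2 * lam * (∑ i, ξ i ^ 2) +
        lam ^ 2 * ∑ i, ∑ j, m i j * ξ i * ξ j := by
    have a1 : ∑ i, ∑ j, m i j * η i * η j = ∑ i, ξ i * η i := by
      refine Finset.sum_congr rfl fun i _ => ?_
      rw [← hη' i, Finset.sum_mul]
      exact Finset.sum_congr rfl fun j _ => by ring
    have a2 : ∑ i, ∑ j, m i j * ξ i * η j = ∑ i, ξ i ^ 2 := by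
      refine Finset.sum_congr rfl fun i _ => ?_
      calc _ = ξ i * ∑ j, m i j * η j := by
            rw [Finset.mul_sum]; exact Finset.sum_congr rfl fun j _ => by ring
        _ = _ := by rw [hη']; ring
    have a3 : ∑ i, ∑ j, m i j * η i * ξ j = ∑ i, ξ i ^ 2 := by
      rw [Finset.sum_comm, ← a2]
      refine Finset.sum_congr rfl fun i _ => Finset.sum_congr rfl fun j _ => ?_
      rw [hm.1 j i]; ring
    calc _ = (∑ i, ∑ j, m i j * η i * η j) - lam * (∑ i, ∑ j, m i j * ξ i * η j)
          - lam * (∑ i, ∑ j, m i j * η i * ξ j) + lam ^ 2 * ∑ i, ∑ j, m i j * ξ i * ξ j := by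
            simp only [Finset.mul_sum, ← Finset.sum_add_distrib, ← Finset.sum_sub_distrib]
            refine Finset.sum_congr rfl fun i _ => Finset.sum_congr rfl fun j _ => by ring
      _ = _ := by rw [a1, a2, a3]; ring
  rw [e2] at h1
  rw [e1]
  have h3 : 0 ≤ lam * ∑ i, (η i - lam * ξ i) ^ 2 :=
    mul_nonneg hlam.le (Finset.sum_nonneg fun i _ => sq_nonneg _)
  have h4 := mul_le_mul_of_nonneg_left h2 (sq_nonneg lam)
  have h5 : lam ^ 2 * (lam⁻¹ * ∑ i, ξ i ^ 2) = lam * ∑ i, ξ i ^ 2 := by field_simp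
  linarith

lemma exists_goodMetric (n : ℕ) (lam Lam : ℝ) (hlam : 0 < lam) :
    ∃ L β : ℝ, 0 < L ∧ 0 < β ∧
      ∀ g, MemM n lam Lam g → GoodMetric n g lam L β := by
  have hK := isCompact_ellipticSet n lam hlam
  have hc := convex_ellipticSet n lam
  have hd : ContDiff ℝ 1 fun m : Fin n → Fin n → ℝ => (Matrix.of m).det :=
    contDiff_det_of fun i j => by fun_prop
  have hI := fun i j => exists_bound_of_contDiffAt hK hc
    (fun m hm => contDiffAt_inv_of (isUnit_det_of_mem_ellipticSet hlam hm) i j)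
  choose LI hLI0 hLI1 hLI2 using hI
  obtain ⟨LD, hLD0, hLD1, hLD2⟩ := exists_bound_of_contDiffAt hK hc
    (fun m hm => hd.contDiffAt.sqrt (isUnit_det_of_mem_ellipticSet hlam hm))
  obtain ⟨LJ, hLJ0, hLJ1, -⟩ := exists_bound_of_contDiffAt hK hc
    (fun m hm => (hd.contDiffAt (x := m)).inv (isUnit_det_of_mem_ellipticSet hlam hm))
  set S : ℝ := LD + ∑ i, ∑ j, LI i j with hS
  have hLIS : ∀ i j, LI i j ≤ S := fun i j => by
    have h1 : LI i j ≤ ∑ j, LI i j :=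
      Finset.single_le_sum (f := fun j => LI i j) (fun j _ => hLI0 i j) (Finset.mem_univ j)
    have h2 : ∑ j, LI i j ≤ ∑ i, ∑ j, LI i j :=
      Finset.single_le_sum (f := fun i => ∑ j, LI i j)
        (fun i _ => Finset.sum_nonneg fun j _ => hLI0 i j) (Finset.mem_univ i)
    linarith
  have hS0 : 0 ≤ S := by
    have : 0 ≤ ∑ i, ∑ j, LI i j := Finset.sum_nonneg fun i _ => Finset.sum_nonneg fun j _ => hLI0 i j
    linarith
  have hLDS : LD ≤ S := by
    have : 0 ≤ ∑ i, ∑ j, LI i j := Finset.sum_nonneg fun i _ => Finset.sum_nonneg fun j _ => hLI0 i j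
    linarith
  set ℓ : ℝ := (Real.toNNReal Lam : ℝ)
  have hℓ : 0 ≤ ℓ := NNReal.coe_nonneg _
  refine ⟨S * (1 + ℓ) + 1, (Real.sqrt (LJ + 1))⁻¹, by positivity, by positivity, fun g hg => ?_⟩
  obtain ⟨hg0, hg1, hg2, hg3⟩ := hg
  have hmem : ∀ x ∈ ball (0 : Euc n) 1, (fun i j => g x i j) ∈ ellipticSet n lam := fun x hx =>
    ⟨fun i j => ((hg1 x hx).1.apply i j).symm, fun ξ => hg3 x hx ξ⟩
  have hlip : ∀ x ∈ ball (0 : Euc n) 1, ∀ y ∈ ball (0 : Euc n) 1,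
      ‖(fun i j => g x i j) - fun i j => g y i j‖ ≤ ℓ * ‖x - y‖ := by
    intro x hx y hy
    refine (pi_norm_le_iff_of_nonneg (by positivity)).2 fun i =>
      (pi_norm_le_iff_of_nonneg (by positivity)).2 fun j => ?_
    have := (hg2 i j).dist_le_mul x hx y hy
    rwa [dist_eq_norm, dist_eq_norm] at this
  have hSS : S ≤ S * (1 + ℓ) + 1 := by nlinarith
  have hlip2 : ∀ A : ℝ, 0 ≤ A → A ≤ S → ∀ x ∈ ball (0 : Euc n) 1, ∀ y ∈ ball (0 : Euc n) 1,
      A * ‖(fun i j => g x i j) - fun i j => g y i j‖ ≤ (S * (1 + ℓ) + 1) * ‖x - y‖ := by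
    intro A hA hAS x hx y hy
    calc A * ‖(fun i j => g x i j) - fun i j => g y i j‖ ≤ S * (ℓ * ‖x - y‖) :=
          mul_le_mul hAS (hlip x hx y hy) (norm_nonneg _) hS0
      _ ≤ _ := by nlinarith [norm_nonneg (x - y), mul_nonneg hS0 (norm_nonneg (x - y))]
  refine ⟨fun x hx i j => ?_, fun x hx ξ => ?_, fun i j => ?_, fun x hx i j => ?_,
    fun x hx y hy i j => ?_, fun x hx => ?_, fun x hx => ?_, fun x hx y hy => ?_⟩
  · exact ((hg1 x hx).1.inv.apply i j).symm
  · exact le_inv_quadForm hlam (hmem x hx) ξ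
  · rw [hg0, inv_one, Matrix.one_apply]
  · exact ((hLI1 i j _ (hmem x hx)).trans (hLIS i j)).trans hSS
  · exact (hLI2 i j _ (hmem x hx) _ (hmem y hy)).trans
      (hlip2 _ (hLI0 i j) (hLIS i j) x hx y hy)
  · have hp : 0 < (g x).det := (hg1 x hx).2.det_pos
    have h1 : |((g x).det)⁻¹| ≤ LJ := hLJ1 _ (hmem x hx)
    rw [abs_of_pos (inv_pos.2 hp)] at h1
    unfold sqrtDet
    rw [← Real.sqrt_inv]
    apply Real.sqrt_le_sqrt
    rw [inv_le_comm₀ (by positivity) hp]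
    linarith
  · exact ((le_abs_self _).trans (hLD1 _ (hmem x hx))).trans (hLDS.trans hSS)
  · exact (hLD2 _ (hmem x hx) _ (hmem y hy)).trans
      (hlip2 _ hLD0 hLDS x hx y hy)

section

open ContinuousLinearMap Filter Topology Convolution

lemma rdot_eq_inner (v w : ℂ) : rdot v w = inner ℝ v w := by
  simp [rdot, Complex.inner]
  ring

lemma continuous_integral_inner_translate {n : ℕ} {A h : Euc n → ℂ} (hA : MemLp A 2 volume)
    (hh : MemLp h 2 volume) : Continuous fun z : Euc n => ∫ x, inner ℝ (A x) (h (x + z)) := by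
  have : Fact ((2 : ENNReal) ≠ ⊤) := ⟨by simp⟩
  have key : ∀ z : Euc n, ∫ x, inner ℝ (A x) (h (x + z)) =
      inner ℝ (hA.toLp A) ((DomAddAct.mk z) +ᵥ hh.toLp h) := by
    intro z
    rw [L2.inner_def]
    refine integral_congr_ae ?_
    have h1 := hA.coeFn_toLp
    have h2 : ((DomAddAct.mk z) +ᵥ hh.toLp h : Lp ℂ 2 (volume : Measure (Euc n))) =ᵐ[volume]
        fun x => h (x + z) := by
      have h3 : (DomAddAct.mk z) +ᵥ hh.toLp h = (hh.comp_measurePreserving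
          (measurePreserving_vadd z volume)).toLp (fun x => h (z +ᵥ x)) := rfl
      rw [h3]
      refine (MemLp.coeFn_toLp _).trans (Eventually.of_forall fun x => ?_)
      simp [add_comm]
    filter_upwards [h1, h2] with x h1 h2
    rw [h1, h2]
  simp_rw [key]
  have : Continuous fun z : Euc n => (DomAddAct.mk z) +ᵥ hh.toLp h :=
    (DomAddAct.continuous_mk).vadd continuous_const
  exact continuous_const.inner this

lemma integral_inner_convolution {n : ℕ} {A h : Euc n → ℂ} (hA : MemLp A 2 volume)
    (hh : MemLp h 2 volume) {ψ : Euc n → ℝ} (hψ : Continuous ψ) (hψc : HasCompactSupport ψ) :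
    Integrable (fun x => inner ℝ (A x) ((ψ ⋆[lsmul ℝ ℝ] h) x)) ∧
    ∫ x, inner ℝ (A x) ((ψ ⋆[lsmul ℝ ℝ] h) x) =
      (ψ ⋆[lsmul ℝ ℝ] fun z => ∫ x, inner ℝ (A x) (h (x + z))) 0 := by
  have hψi : Integrable ψ := hψ.integrable_of_hasCompactSupport hψc
  have hψm := hψi.1
  have hm : AEStronglyMeasurable (fun p : Euc n × Euc n => ψ p.2 • h (p.1 - p.2))
      (volume.prod volume) :=
    hψm.convolution_integrand (lsmul ℝ ℝ) hh.1
  have hInteg : Integrable (fun p : Euc n × Euc n => inner ℝ (A p.1) (ψ p.2 • h (p.1 - p.2)))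
      (volume.prod volume) := by
    have i1 : Integrable (fun p : Euc n × Euc n => ‖A p.1‖ ^ 2 * |ψ p.2|) (volume.prod volume) :=
      hA.integrable_norm_pow (by simp) |>.mul_prod hψi.abs
    have i2 : Integrable (fun p : Euc n × Euc n => |ψ p.2| * ‖h (p.1 - p.2)‖ ^ 2)
        (volume.prod volume) :=
      Integrable.convolution_integrand (lsmul ℝ ℝ) hψi.abs (hh.integrable_norm_pow (by simp))
    refine (i1.add i2).mono (hA.1.comp_fst.inner hm) (Eventually.of_forall fun p => ?_)
    have : ‖inner ℝ (A p.1) (ψ p.2 • h (p.1 - p.2))‖ ≤ ‖A p.1‖ * (|ψ p.2| * ‖h (p.1 - p.2)‖) := by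
      refine (norm_inner_le_norm _ _).trans ?_
      rw [norm_smul, Real.norm_eq_abs]
    refine this.trans (le_trans ?_ (le_abs_self _))
    simp only [Pi.add_apply]
    nlinarith [mul_nonneg (abs_nonneg (ψ p.2)) (sq_nonneg (‖A p.1‖ - ‖h (p.1 - p.2)‖)),
      mul_nonneg (abs_nonneg (ψ p.2)) (sq_nonneg (‖A p.1‖)),
      mul_nonneg (abs_nonneg (ψ p.2)) (sq_nonneg (‖h (p.1 - p.2)‖))]
  have hex : ∀ x, Integrable (fun z => ψ z • h (x - z)) := fun x =>
    hψc.convolutionExists_left (lsmul ℝ ℝ) hψ (hh.locallyIntegrable (by norm_num)) x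
  have e1 : ∀ x, inner ℝ (A x) ((ψ ⋆[lsmul ℝ ℝ] h) x) =
      ∫ z, inner ℝ (A x) (ψ z • h (x - z)) := fun x => (integral_inner (hex x) (A x)).symm
  simp_rw [e1]
  refine ⟨hInteg.integral_prod_left, ?_⟩
  rw [integral_integral_swap hInteg, convolution_def]
  refine integral_congr_ae (Eventually.of_forall fun z => ?_)
  simp only [lsmul_apply, zero_sub, smul_eq_mul, inner_smul_right, integral_const_mul]
  rfl

lemma pd_convolution {n : ℕ} {ψ : Euc n → ℝ} (hψ : ContDiff ℝ 1 ψ) (hψc : HasCompactSupport ψ)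
    {ζ : Euc n → ℂ} (hζ : Differentiable ℝ ζ) {j : Fin n}
    (hζ' : LocallyIntegrable (fun x => pd ζ j x)) (x : Euc n) :
    pd (ψ ⋆[lsmul ℝ ℝ] ζ) j x = (ψ ⋆[lsmul ℝ ℝ] fun x => pd ζ j x) x := by
  have hζl : LocallyIntegrable ζ := hζ.continuous.locallyIntegrable
  have h1 := hψc.hasFDerivAt_convolution_left (lsmul ℝ ℝ) hψ hζl x
  have hψ'c : HasCompactSupport (fderiv ℝ ψ) := hψc.fderiv ℝ
  have hψ'cont : Continuous (fderiv ℝ ψ) := hψ.continuous_fderiv (by simp)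
  have i0 := hψ'c.convolutionExists_left ((lsmul ℝ ℝ : ℝ →L[ℝ] ℂ →L[ℝ] ℂ).precompL (Euc n))
    hψ'cont hζl x
  have i1 : Integrable fun t => fderiv ℝ ψ t (EuclideanSpace.single j 1) • ζ (x - t) :=
    (i0.apply_continuousLinearMap (EuclideanSpace.single j 1))
  have i2 : Integrable fun t => ψ t • pd ζ j (x - t) :=
    hψc.convolutionExists_left (lsmul ℝ ℝ) hψ.continuous hζ' x
  have i3 : Integrable fun t => ψ t • ζ (x - t) :=
    hψc.convolutionExists_left (lsmul ℝ ℝ) hψ.continuous hζl x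
  have hd : ∀ t, HasFDerivAt (fun t => ζ (x - t)) (-(fderiv ℝ ζ (x - t))) t := by
    intro t
    have := (hζ (x - t)).hasFDerivAt.comp t ((hasFDerivAt_id t).const_sub x)
    refine this.congr_fderiv ?_
    ext; simp
  have hpd : ∀ t, fderiv ℝ (fun t => ζ (x - t)) t (EuclideanSpace.single j 1) = - pd ζ j (x - t) :=
    fun t => by rw [(hd t).fderiv]; rfl
  have := integral_bilinear_fderiv_right_eq_neg_left_of_integrable (μ := (volume : Measure (Euc n)))
    (B := (lsmul ℝ ℝ : ℝ →L[ℝ] ℂ →L[ℝ] ℂ)) (f := ψ) (g := fun t => ζ (x - t))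
    (v := EuclideanSpace.single j 1)
    (by simpa using i1) (by simpa [hpd] using i2.neg) (by simpa using i3)
    (fun t _ => (hψ.differentiable (by simp)) t) (fun t _ => (hd t).differentiableAt)
  unfold pd
  rw [h1.fderiv, convolution_def, ContinuousLinearMap.integral_apply i0, convolution_def]
  simp only [hpd, lsmul_apply, smul_neg, integral_neg, neg_inj] at this
  simpa [precompL_apply, pd] using this.symm

lemma integrable_inner_of_memLp {n : ℕ} {A h : Euc n → ℂ} (hA : MemLp A 2 volume)
    (hh : MemLp h 2 volume) : Integrable fun x => inner ℝ (A x) (h x) := by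
  refine ((hA.integrable_norm_pow (by simp)).add (hh.integrable_norm_pow (by simp))).mono
    (hA.1.inner hh.1) (Eventually.of_forall fun x => ?_)
  refine (norm_inner_le_norm _ _).trans (le_trans ?_ (le_abs_self _))
  simp only [Pi.add_apply]
  nlinarith [sq_nonneg (‖A x‖ - ‖h x‖), sq_nonneg ‖A x‖, sq_nonneg ‖h x‖]

/-- A weak equation with `L²` coefficients may be tested with compactly supported everywhere
differentiable functions whose gradient is square integrable. -/
lemma weak_eq_of_differentiable {n : ℕ} {A : Fin n → Euc n → ℂ} {f : Euc n → ℂ}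
    (hA : ∀ j, MemLp (A j) 2 volume) (hf : MemLp f 2 volume)
    (hweak : ∀ ζ : Euc n → ℂ, ContDiff ℝ 1 ζ → tsupport ζ ⊆ ball (0 : Euc n) 1 →
      ∫ x, ((∑ j, inner ℝ (A j x) (pd ζ j x)) - inner ℝ (f x) (ζ x)) = 0)
    {ζ : Euc n → ℂ} (hζ : Differentiable ℝ ζ) {R : ℝ} (hR : R < 1)
    (hsupp : ∀ x, R < ‖x‖ → ζ x = 0) (hζ' : ∀ j, MemLp (fun x => pd ζ j x) 2 volume) :
    ∫ x, ((∑ j, inner ℝ (A j x) (pd ζ j x)) - inner ℝ (f x) (ζ x)) = 0 := by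
  have hts : tsupport ζ ⊆ closedBall 0 R := closure_minimal (fun x hx => by
    rw [mem_closedBall_zero_iff]; by_contra! h; exact hx (hsupp x h)) isClosed_closedBall
  have hc : HasCompactSupport ζ := HasCompactSupport.of_support_subset_isCompact
    (isCompact_closedBall (0 : Euc n) R) ((subset_tsupport ζ).trans hts)
  have hζ2 : MemLp ζ 2 volume := hζ.continuous.memLp_of_hasCompactSupport hc
  set G : Euc n → ℝ := fun z => (∑ j, ∫ x, inner ℝ (A j x) (pd ζ j (x + z))) -
    ∫ x, inner ℝ (f x) (ζ (x + z)) with hG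
  have hGc : Continuous G :=
    (continuous_finsetSum _ fun j _ => continuous_integral_inner_translate (hA j) (hζ' j)).sub
      (continuous_integral_inner_translate hf hζ2)
  have hG0 : G 0 = ∫ x, ((∑ j, inner ℝ (A j x) (pd ζ j x)) - inner ℝ (f x) (ζ x)) := by
    rw [integral_sub (integrable_finsetSum _ fun j _ => integrable_inner_of_memLp (hA j) (hζ' j))
      (integrable_inner_of_memLp hf hζ2), integral_finsetSum _ fun j _ => integrable_inner_of_memLp (hA j) (hζ' j)]
    simp [hG]
  rw [← hG0]
  set φ : ℕ → ContDiffBump (0 : Euc n) := fun k =>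
    { rIn := (1 - R) / 2 / (k + 1) / 2, rOut := (1 - R) / 2 / (k + 1)
      rIn_pos := by have : 0 < 1 - R := by linarith
                    positivity
      rIn_lt_rOut := by have : 0 < 1 - R := by linarith
                        exact half_lt_self (by positivity) } with hφ
  have hφt : Tendsto (fun k => (φ k).rOut) atTop (𝓝 0) := by
    have : Tendsto (fun k : ℕ => (1 - R) / 2 * (1 / ((k : ℝ) + 1))) atTop (𝓝 ((1 - R) / 2 * 0)) :=
      tendsto_one_div_add_atTop_nhds_zero_nat.const_mul _
    rw [mul_zero] at this
    refine this.congr fun k => ?_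
    simp [hφ]; ring
  have hlim := ContDiffBump.convolution_tendsto_right_of_continuous (μ := volume) hφt hGc 0
  refine tendsto_nhds_unique hlim ?_
  refine tendsto_const_nhds.congr fun k => ?_
  set ψ := (φ k).normed volume with hψ
  have hψc : HasCompactSupport ψ := (φ k).hasCompactSupport_normed
  have hψd : ContDiff ℝ 1 ψ := (φ k).contDiff_normed
  have hk : (φ k).rOut ≤ (1 - R) / 2 := by
    have : 0 < 1 - R := by linarith
    exact div_le_self (by positivity) (by linarith [(k.cast_nonneg : (0 : ℝ) ≤ k)])
  have hsub : tsupport (ψ ⋆[lsmul ℝ ℝ] ζ) ⊆ ball (0 : Euc n) 1 := by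
    refine (closure_minimal (?_ : Function.support (ψ ⋆[lsmul ℝ ℝ] ζ) ⊆
      closedBall 0 (R + (1 - R) / 2)) isClosed_closedBall).trans
      (closedBall_subset_ball (by linarith))
    refine (support_convolution_subset (lsmul ℝ ℝ)).trans ?_
    rintro _ ⟨a, ha, b, hb, rfl⟩
    rw [hψ, (φ k).support_normed_eq] at ha
    have hb' := hts (subset_tsupport _ hb)
    rw [mem_ball_zero_iff] at ha
    rw [mem_closedBall_zero_iff] at hb' ⊢
    exact (norm_add_le a b).trans (by linarith)
  have hcd : ContDiff ℝ 1 (ψ ⋆[lsmul ℝ ℝ] ζ) :=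
    hψc.contDiff_convolution_left (n := 1) (lsmul ℝ ℝ) hψd (hζ2.locallyIntegrable (by norm_num))
  have h0 := hweak _ hcd hsub
  have e1 : ∀ x j, pd (ψ ⋆[lsmul ℝ ℝ] ζ) j x = (ψ ⋆[lsmul ℝ ℝ] fun x => pd ζ j x) x :=
    fun x j => pd_convolution hψd hψc hζ ((hζ' j).locallyIntegrable (by norm_num)) x
  simp_rw [e1] at h0
  rw [← h0]
  have hp := fun j => integral_inner_convolution (hA j) (hζ' j) hψd.continuous hψc
  have hq := integral_inner_convolution hf hζ2 hψd.continuous hψc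
  rw [integral_sub (integrable_finsetSum _ fun j _ => (hp j).1) hq.1,
    integral_finsetSum _ fun j _ => (hp j).1, hq.2]
  simp_rw [(hp _).2]
  rw [convolution_def, hG]
  simp only [lsmul_apply, smul_eq_mul, convolution_def]
  have hi : ∀ F : Euc n → ℝ, Continuous F → Integrable fun t => ψ t * F (0 - t) := fun F hF =>
    Continuous.integrable_of_hasCompactSupport (by have := hψd.continuous; fun_prop) hψc.mul_right
  have c1 := fun j => continuous_integral_inner_translate (hA j) (hζ' j)
  have c2 := continuous_integral_inner_translate hf hζ2
  rw [← integral_finsetSum _ fun j _ => hi _ (c1 j), ← integral_sub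
    (integrable_finsetSum _ fun j _ => hi _ (c1 j)) (hi _ c2)]
  refine integral_congr_ae (Eventually.of_forall fun t => ?_)
  simp only [mul_sub, Finset.mul_sum]

/-- A bounded continuous nonnegative function on the line vanishing outside `(σ, ρ)`. -/
structure IsProfile (h : ℝ → ℝ) (σ ρ H : ℝ) : Prop where
  cont : Continuous h
  nonneg : ∀ s, 0 ≤ h s
  le : ∀ s, h s ≤ H
  zero_left : ∀ s, s ≤ σ → h s = 0
  zero_right : ∀ s, ρ ≤ s → h s = 0
  σ_pos : 0 < σ
  σ_lt : σ < ρ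
  ρ_lt : ρ < 1
  H_pos : 0 < H

/-- The decreasing cutoff function with derivative `-h` vanishing at `1`. -/
def cutoff (h : ℝ → ℝ) (r : ℝ) : ℝ := ∫ s in r..1, h s

/-- The radial deformation `x ↦ (1 + t η(|x|)) x`. -/
def radialMap {n : ℕ} (h : ℝ → ℝ) (t : ℝ) (x : Euc n) : Euc n := (1 + t * cutoff h ‖x‖) • x

/-- The Jacobian determinant of `radialMap`. -/
def radialJac {n : ℕ} (h : ℝ → ℝ) (t : ℝ) (x : Euc n) : ℝ :=
  (1 + t * cutoff h ‖x‖) ^ (n - 1) * (1 + t * cutoff h ‖x‖ - t * (h ‖x‖ * ‖x‖))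

namespace IsProfile

variable {h : ℝ → ℝ} {σ ρ H : ℝ} (hh : IsProfile h σ ρ H)
include hh

lemma hasDerivAt_cutoff (r : ℝ) : HasDerivAt (cutoff h) (-h r) r :=
  intervalIntegral.integral_hasDerivAt_left (hh.cont.intervalIntegrable _ _)
    (hh.cont.stronglyMeasurableAtFilter _ _) hh.cont.continuousAt

lemma continuous_cutoff : Continuous (cutoff h) :=
  continuous_iff_continuousAt.2 fun r => (hh.hasDerivAt_cutoff r).continuousAt

lemma cutoff_sub (r s : ℝ) : cutoff h r - cutoff h s = ∫ τ in r..s, h τ := by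
  unfold cutoff
  rw [intervalIntegral.integral_interval_sub_interval_comm' (hh.cont.intervalIntegrable _ _)
    (hh.cont.intervalIntegrable _ _) (hh.cont.intervalIntegrable _ _)]
  simp [intervalIntegral.integral_symm s r]

lemma cutoff_sub_nonneg {r s : ℝ} (hrs : r ≤ s) : cutoff h s ≤ cutoff h r := by
  have := hh.cutoff_sub r s
  have h2 : 0 ≤ ∫ τ in r..s, h τ := intervalIntegral.integral_nonneg hrs fun τ _ => hh.nonneg τ
  linarith

lemma cutoff_sub_le {r s : ℝ} (hrs : r ≤ s) : cutoff h r - cutoff h s ≤ H * (s - r) := by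
  rw [hh.cutoff_sub]
  calc ∫ τ in r..s, h τ ≤ ∫ τ in r..s, H :=
        intervalIntegral.integral_mono_on hrs (hh.cont.intervalIntegrable _ _) (by simp)
          fun τ _ => hh.le τ
    _ = _ := by simp; ring

lemma cutoff_eq_zero {r : ℝ} (hr : ρ ≤ r) : cutoff h r = 0 := by
  unfold cutoff
  rw [intervalIntegral.integral_congr (g := fun _ => 0)]
  · simp
  · intro s hs
    refine hh.zero_right s ?_
    rcases hs with ⟨h1, -⟩
    have := hh.ρ_lt
    exact (le_min hr this.le).trans h1

lemma cutoff_eq_of_le {r : ℝ} (hr : r ≤ σ) : cutoff h r = cutoff h σ := by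
  rw [← sub_eq_zero, hh.cutoff_sub, intervalIntegral.integral_congr (g := fun _ => 0)]
  · simp
  · intro s hs
    rw [Set.uIcc_of_le hr] at hs
    exact hh.zero_left s hs.2

lemma cutoff_nonneg (r : ℝ) : 0 ≤ cutoff h r := by
  rcases le_total r ρ with h1 | h1
  · rw [← hh.cutoff_eq_zero le_rfl]; exact hh.cutoff_sub_nonneg h1
  · rw [hh.cutoff_eq_zero h1]

lemma cutoff_le {r : ℝ} (hr : 0 ≤ r) : cutoff h r ≤ H := by
  rcases le_total r 1 with h1 | h1
  · have := hh.cutoff_sub_le h1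
    rw [hh.cutoff_eq_zero hh.ρ_lt.le] at this
    nlinarith [hh.H_pos]
  · rw [hh.cutoff_eq_zero (hh.ρ_lt.le.trans h1)]; exact hh.H_pos.le

lemma hasFDerivAt_cutoff_norm {n : ℕ} (x : Euc n) :
    HasFDerivAt (fun x : Euc n => cutoff h ‖x‖) (-(h ‖x‖ / ‖x‖) • innerSL ℝ x) x := by
  by_cases hx : x = 0
  · subst hx
    have h0 : h ‖(0 : Euc n)‖ = 0 := hh.zero_left _ (by simp [hh.σ_pos.le])
    rw [h0]
    have : (fun x : Euc n => cutoff h ‖x‖) =ᶠ[𝓝 0] fun _ => cutoff h σ := by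
      filter_upwards [ball_mem_nhds (0 : Euc n) hh.σ_pos] with x hx
      exact hh.cutoff_eq_of_le (mem_ball_zero_iff.1 hx).le
    simpa using (hasFDerivAt_const (cutoff h σ) (0 : Euc n)).congr_of_eventuallyEq this
  · have h1 : HasFDerivAt (fun x : Euc n => ‖x‖) (‖x‖⁻¹ • innerSL ℝ x) x := by
      have h2 := (hasStrictFDerivAt_norm_sq x).hasFDerivAt.sqrt (by simpa using hx)
      simp only [Real.sqrt_sq (norm_nonneg _)] at h2
      refine h2.congr_fderiv ?_
      ext v
      simp
      field_simp
    refine ((hh.hasDerivAt_cutoff ‖x‖).comp_hasFDerivAt x h1).congr_fderiv ?_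
    ext v
    simp [div_eq_mul_inv]
    ring

lemma hasFDerivAt_radialMap {n : ℕ} (t : ℝ) (x : Euc n) :
    HasFDerivAt (radialMap h t)
      ((1 + t * cutoff h ‖x‖) • ContinuousLinearMap.id ℝ (Euc n) +
        (-(t * (h ‖x‖ / ‖x‖)) • innerSL ℝ x).smulRight x) x := by
  have h1 : HasFDerivAt (fun x : Euc n => 1 + t * cutoff h ‖x‖)
      (t • (-(h ‖x‖ / ‖x‖) • innerSL ℝ x)) x :=
    ((hh.hasFDerivAt_cutoff_norm x).const_mul t).const_add 1
  refine (h1.smul (hasFDerivAt_id x)).congr_fderiv ?_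
  ext v
  simp
  exact Or.inl (by ring)

lemma det_fderiv_radialMap {n : ℕ} (hn : 1 ≤ n) {t : ℝ} (ht : 0 ≤ t) (x : Euc n) :
    ((1 + t * cutoff h ‖x‖) • ContinuousLinearMap.id ℝ (Euc n) +
        (-(t * (h ‖x‖ / ‖x‖)) • innerSL ℝ x).smulRight x).det = radialJac h t x := by
  have hc : 0 < 1 + t * cutoff h ‖x‖ := by
    have := mul_nonneg ht (hh.cutoff_nonneg ‖x‖)
    linarith
  set c := 1 + t * cutoff h ‖x‖ with hcdef
  set k := -(t * (h ‖x‖ / ‖x‖)) with hk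
  have : ((c • ContinuousLinearMap.id ℝ (Euc n) + (k • innerSL ℝ x).smulRight x :
      Euc n →L[ℝ] Euc n) : Euc n →ₗ[ℝ] Euc n) =
      c • LinearMap.transvection ((c⁻¹ * k) • (innerSL ℝ x : Euc n →ₗ[ℝ] ℝ)) x := by
    ext v
    simp [LinearMap.transvection.apply, smul_smul]
    field_simp
    simp
  rw [ContinuousLinearMap.det, this, LinearMap.det_smul, LinearMap.transvection.det]
  obtain ⟨m, rfl⟩ : ∃ m, n = m + 1 := ⟨n - 1, by omega⟩
  have hx : k * ‖x‖ ^ 2 = - (t * (h ‖x‖ * ‖x‖)) := by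
    by_cases h0 : ‖x‖ = 0
    · simp [h0]
    · rw [hk]; field_simp
  simp only [finrank_euclideanSpace, Fintype.card_fin, radialJac, Nat.add_sub_cancel, ← hcdef]
  simp only [LinearMap.smul_apply, ContinuousLinearMap.coe_coe, innerSL_apply_apply,
    real_inner_self_eq_norm_sq, smul_eq_mul]
  rw [mul_assoc, hx, pow_succ]
  field_simp
  ring

lemma norm_radialMap {n : ℕ} {t : ℝ} (ht : 0 ≤ t) (x : Euc n) :
    ‖radialMap h t x‖ = (1 + t * cutoff h ‖x‖) * ‖x‖ := by
  have := mul_nonneg ht (hh.cutoff_nonneg ‖x‖)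
  rw [radialMap, norm_smul, Real.norm_eq_abs, abs_of_nonneg (by linarith)]

lemma norm_radialMap_sub {n : ℕ} {t : ℝ} (ht : 0 ≤ t) (x : Euc n) :
    ‖radialMap h t x - x‖ = t * cutoff h ‖x‖ * ‖x‖ := by
  have := mul_nonneg ht (hh.cutoff_nonneg ‖x‖)
  have e : radialMap h t x - x = (t * cutoff h ‖x‖) • x := by
    rw [radialMap, add_smul, one_smul, add_sub_cancel_left]
  rw [e, norm_smul, Real.norm_eq_abs, abs_of_nonneg this]

lemma radial_strictMono {t : ℝ} (ht : 0 ≤ t) (htH : t * H < 1) {r s : ℝ} (hr : 0 ≤ r)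
    (hrs : r < s) (hs : s ≤ 1) :
    (1 + t * cutoff h r) * r < (1 + t * cutoff h s) * s := by
  have h1 := mul_le_mul_of_nonneg_left (hh.cutoff_sub_le hrs.le) (mul_nonneg ht (hr.trans hrs.le))
  have h3 := mul_nonneg ht (hh.cutoff_nonneg r)
  have h5 : t * H * (s - r) * s ≤ t * H * (s - r) * 1 :=
    mul_le_mul_of_nonneg_left hs (mul_nonneg (mul_nonneg ht hh.H_pos.le) (by linarith))
  have h6 : t * H * (s - r) < s - r := by nlinarith
  have h7 := mul_nonneg h3 (sub_nonneg.2 hrs.le)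
  nlinarith

lemma radialMap_eq_self {n : ℕ} {t : ℝ} {x : Euc n} (hx : ρ ≤ ‖x‖) : radialMap h t x = x := by
  simp [radialMap, hh.cutoff_eq_zero hx]

lemma norm_radialMap_le {n : ℕ} {t : ℝ} (ht : 0 ≤ t) (htH : t * H < 1) {x : Euc n}
    (hx : ‖x‖ ≤ ρ) : ‖radialMap h t x‖ ≤ ρ := by
  rcases hx.eq_or_lt with h1 | h1
  · rw [hh.radialMap_eq_self h1.ge, h1]
  · rw [hh.norm_radialMap ht]
    refine (hh.radial_strictMono ht htH (norm_nonneg x) h1 hh.ρ_lt.le).le.trans ?_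
    simp [hh.cutoff_eq_zero le_rfl]

lemma radialMap_mem_ball {n : ℕ} {t : ℝ} (ht : 0 ≤ t) (htH : t * H < 1) {x : Euc n}
    (hx : x ∈ ball (0 : Euc n) 1) : radialMap h t x ∈ ball (0 : Euc n) 1 := by
  rw [mem_ball_zero_iff] at hx ⊢
  rcases le_total ‖x‖ ρ with h1 | h1
  · exact (hh.norm_radialMap_le ht htH h1).trans_lt hh.ρ_lt
  · rwa [hh.radialMap_eq_self h1]

lemma injOn_radialMap {n : ℕ} {t : ℝ} (ht : 0 ≤ t) (htH : t * H < 1) :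
    Set.InjOn (radialMap h t) (ball (0 : Euc n) 1) := by
  intro x hx y hy hxy
  rw [mem_ball_zero_iff] at hx hy
  have hn : ‖radialMap h t x‖ = ‖radialMap h t y‖ := by rw [hxy]
  rw [hh.norm_radialMap ht, hh.norm_radialMap ht] at hn
  have he : ‖x‖ = ‖y‖ := by
    rcases lt_trichotomy ‖x‖ ‖y‖ with h1 | h1 | h1
    · exact absurd hn (hh.radial_strictMono ht htH (norm_nonneg x) h1 hy.le).ne
    · exact h1
    · exact absurd hn.symm (hh.radial_strictMono ht htH (norm_nonneg y) h1 hx.le).ne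
  have hc : 1 + t * cutoff h ‖y‖ ≠ 0 := by
    have := mul_nonneg ht (hh.cutoff_nonneg ‖y‖)
    linarith
  simp only [radialMap, he] at hxy
  exact smul_right_injective _ hc hxy

lemma image_radialMap {n : ℕ} {t : ℝ} (ht : 0 ≤ t) (htH : t * H < 1) :
    radialMap h t '' ball (0 : Euc n) 1 = ball (0 : Euc n) 1 := by
  refine Set.Subset.antisymm (Set.image_subset_iff.2 fun x hx => hh.radialMap_mem_ball ht htH hx) ?_
  intro y hy
  rw [mem_ball_zero_iff] at hy
  by_cases hy0 : y = 0
  · exact ⟨0, by simp, by simp [radialMap, hy0]⟩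
  have hyp : 0 < ‖y‖ := norm_pos_iff.2 hy0
  have hc := hh.continuous_cutoff
  have hcont : Continuous fun r : ℝ => (1 + t * cutoff h r) * r := by fun_prop
  have himg := intermediate_value_Icc zero_le_one hcont.continuousOn
  have hmem : ‖y‖ ∈ Set.Icc ((1 + t * cutoff h 0) * 0) ((1 + t * cutoff h 1) * 1) := by
    simp [hh.cutoff_eq_zero hh.ρ_lt.le, hy.le]
  obtain ⟨r, ⟨hr0, hr1⟩, hr⟩ := himg hmem
  simp only at hr
  have hr1' : r < 1 := by
    refine lt_of_le_of_ne hr1 fun h1 => ?_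
    rw [h1, hh.cutoff_eq_zero hh.ρ_lt.le] at hr
    simp at hr; linarith
  have hnorm : ‖(r / ‖y‖) • y‖ = r := by
    rw [norm_smul, Real.norm_eq_abs, abs_of_nonneg (by positivity)]
    field_simp
  refine ⟨(r / ‖y‖) • y, by rwa [mem_ball_zero_iff, hnorm], ?_⟩
  rw [radialMap, hnorm, smul_smul, mul_div_assoc', hr, div_self hyp.ne', one_smul]

lemma half_le_radialJac {n : ℕ} {t : ℝ} (ht : 0 ≤ t) (htH : t * H ≤ 1 / 2) {x : Euc n}
    (hx : x ∈ ball (0 : Euc n) 1) : 1 / 2 ≤ radialJac h t x := by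
  rw [mem_ball_zero_iff] at hx
  have h1 := mul_nonneg ht (hh.cutoff_nonneg ‖x‖)
  have h2 : h ‖x‖ * ‖x‖ ≤ H * 1 :=
    mul_le_mul (hh.le _) hx.le (norm_nonneg _) hh.H_pos.le
  have h3 := mul_le_mul_of_nonneg_left h2 ht
  have h4 : (1 : ℝ) ≤ (1 + t * cutoff h ‖x‖) ^ (n - 1) := one_le_pow₀ (by linarith)
  unfold radialJac
  nlinarith

lemma integrableOn_comp_radialMap {n : ℕ} (hn : 1 ≤ n) {t : ℝ} (ht : 0 ≤ t) (htH : t * H ≤ 1 / 2)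
    {F : Euc n → ℝ} (hF : IntegrableOn F (ball (0 : Euc n) 1)) :
    IntegrableOn (fun x => F (radialMap h t x) * radialJac h t x) (ball (0 : Euc n) 1) := by
  have h1 := (integrableOn_image_iff_integrableOn_abs_det_fderiv_smul
    (volume : Measure (Euc n)) measurableSet_ball
    (fun x _ => (hh.hasFDerivAt_radialMap t x).hasFDerivWithinAt)
    (hh.injOn_radialMap (n := n) ht (by linarith)) F).1
    (by rwa [hh.image_radialMap ht (by linarith)])
  refine h1.congr_fun (fun x hx => ?_) measurableSet_ball
  have := hh.half_le_radialJac ht htH hx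
  simp only [hh.det_fderiv_radialMap hn ht]
  rw [abs_of_pos (by linarith), smul_eq_mul, mul_comm]

lemma integral_comp_radialMap {n : ℕ} (hn : 1 ≤ n) {t : ℝ} (ht : 0 ≤ t) (htH : t * H ≤ 1 / 2)
    (F : Euc n → ℝ) :
    ∫ x in ball (0 : Euc n) 1, F (radialMap h t x) * radialJac h t x =
      ∫ x in ball (0 : Euc n) 1, F x := by
  have h1 := integral_image_eq_integral_abs_det_fderiv_smul
    (volume : Measure (Euc n)) measurableSet_ball
    (fun x _ => (hh.hasFDerivAt_radialMap t x).hasFDerivWithinAt)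
    (hh.injOn_radialMap (n := n) ht (by linarith)) F
  rw [hh.image_radialMap ht (by linarith)] at h1
  rw [h1]
  refine setIntegral_congr_fun measurableSet_ball fun x hx => ?_
  have := hh.half_le_radialJac ht htH hx
  simp only [hh.det_fderiv_radialMap hn ht]
  rw [abs_of_pos (by linarith), smul_eq_mul, mul_comm]

lemma lintegral_comp_radialMap_le {n : ℕ} (hn : 1 ≤ n) {t : ℝ} (ht : 0 ≤ t) (htH : t * H ≤ 1 / 2)
    (F : Euc n → ENNReal) :
    ∫⁻ x in ball (0 : Euc n) 1, F (radialMap h t x) ≤ 2 * ∫⁻ x in ball (0 : Euc n) 1, F x := by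
  have h1 := lintegral_image_eq_lintegral_abs_det_fderiv_mul
    (volume : Measure (Euc n)) measurableSet_ball
    (fun x _ => (hh.hasFDerivAt_radialMap t x).hasFDerivWithinAt)
    (hh.injOn_radialMap (n := n) ht (by linarith)) F
  rw [hh.image_radialMap ht (by linarith)] at h1
  rw [h1, ← lintegral_const_mul' _ _ (by simp)]
  refine setLIntegral_mono' measurableSet_ball fun x hx => ?_
  have := hh.half_le_radialJac ht htH hx
  simp only [hh.det_fderiv_radialMap hn ht]
  rw [abs_of_pos (by linarith), ← mul_assoc]
  refine le_mul_of_one_le_left (by simp) ?_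
  have h2 : (1 : ENNReal) = ENNReal.ofReal (2 * (1 / 2)) := by norm_num
  rw [h2, ENNReal.ofReal_mul (by norm_num)]
  simp only [ENNReal.ofReal_ofNat]
  gcongr

end IsProfile

lemma sq_lintegral_le_mul {α : Type*} [MeasurableSpace α] (μ : Measure α) {F : α → ENNReal}
    (hF : AEMeasurable F μ) : (∫⁻ s, F s ∂μ) ^ 2 ≤ μ Set.univ * ∫⁻ s, F s ^ 2 ∂μ := by
  have h1 := ENNReal.lintegral_mul_le_Lp_mul_Lq μ Real.HolderConjugate.two_two
    (aemeasurable_const (b := (1 : ENNReal))) hF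
  have h2 := pow_le_pow_left' h1 2
  simp only [Pi.mul_apply, one_mul, lintegral_const, mul_pow, ENNReal.rpow_ofNat] at h2
  rwa [← ENNReal.rpow_natCast, ← ENNReal.rpow_natCast (_ ^ (1 / (2 : ℝ)) : ENNReal),
    ← ENNReal.rpow_natCast (_ ^ (1 / (2 : ℝ)) : ENNReal),
    ← ENNReal.rpow_mul, ← ENNReal.rpow_mul, show 1 / (2 : ℝ) * (2 : ℕ) = 1 by norm_num,
    ENNReal.rpow_one, ENNReal.rpow_one, ENNReal.rpow_natCast, one_pow, one_mul] at h2

lemma enorm_sub_le_lintegral_deriv {f f' : ℝ → ℂ} {t : ℝ} (ht : 0 ≤ t)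
    (hf : ∀ s ∈ Set.Icc 0 t, HasDerivAt f (f' s) s) (hm : Measurable f') :
    ‖f t - f 0‖ₑ ≤ ∫⁻ s in Set.Ioc 0 t, ‖f' s‖ₑ := by
  by_cases htop : ∫⁻ s in Set.Ioc 0 t, ‖f' s‖ₑ = ⊤
  · rw [htop]; exact le_top
  have hi : IntervalIntegrable f' volume 0 t :=
    (intervalIntegrable_iff_integrableOn_Ioc_of_le ht).2
      ⟨hm.aestronglyMeasurable, lt_top_iff_ne_top.2 htop⟩
  rw [← intervalIntegral.integral_eq_sub_of_hasDerivAt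
    (fun s hs => hf s (by rwa [Set.uIcc_of_le ht] at hs)) hi, intervalIntegral.integral_of_le ht]
  exact enorm_integral_le_lintegral_enorm _

namespace IsProfile

variable {h : ℝ → ℝ} {σ ρ H : ℝ} (hh : IsProfile h σ ρ H)
include hh

lemma continuous_radialMap_uncurry {n : ℕ} :
    Continuous fun p : Euc n × ℝ => radialMap h p.2 p.1 := by
  have := hh.continuous_cutoff
  unfold radialMap
  fun_prop

lemma enorm_sub_sq_le {n : ℕ} {u : Euc n → ℂ} (hu : DifferentiableOn ℝ u (ball 0 1)) {t : ℝ}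
    (ht : 0 ≤ t) (htH : t * H ≤ 1 / 2) {x : Euc n} (hx : x ∈ ball (0 : Euc n) 1) :
    ‖u (radialMap h t x) - u x‖ₑ ^ 2 ≤ ENNReal.ofReal t *
      ∫⁻ s in Set.Ioc 0 t, ENNReal.ofReal (H ^ 2) * ‖fderiv ℝ u (radialMap h s x)‖ₑ ^ 2 := by
  have hcont : Continuous fun s : ℝ => radialMap h s x := by
    unfold radialMap; fun_prop
  have hmem : ∀ s ∈ Set.Icc 0 t, radialMap h s x ∈ ball (0 : Euc n) 1 := fun s hs =>
    hh.radialMap_mem_ball hs.1 (by nlinarith [mul_le_mul_of_nonneg_right hs.2 hh.H_pos.le]) hx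
  set f' : ℝ → ℂ := fun s => fderiv ℝ u (radialMap h s x) (cutoff h ‖x‖ • x) with hf'
  have hm : Measurable f' := by
    exact (measurable_fderiv_apply_const ℝ u _).comp hcont.measurable
  have hγ : ∀ s, HasDerivAt (fun s : ℝ => radialMap h s x) (cutoff h ‖x‖ • x) s := by
    intro s
    have : HasDerivAt (fun s : ℝ => 1 + s * cutoff h ‖x‖) (cutoff h ‖x‖) s := by
      simpa using ((hasDerivAt_id s).mul_const (cutoff h ‖x‖)).const_add 1
    exact this.smul_const x
  have hd : ∀ s ∈ Set.Icc 0 t, HasDerivAt (fun s => u (radialMap h s x)) (f' s) s := fun s hs =>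
    ((hu.differentiableAt (isOpen_ball.mem_nhds (hmem s hs))).hasFDerivAt).comp_hasDerivAt s (hγ s)
  have h1 := enorm_sub_le_lintegral_deriv ht hd hm
  have h0 : radialMap h 0 x = x := by simp [radialMap]
  simp only [h0] at h1
  refine (pow_le_pow_left' h1 2).trans ((sq_lintegral_le_mul _ (by fun_prop)).trans ?_)
  simp only [Measure.restrict_apply MeasurableSet.univ, Set.univ_inter, Real.volume_Ioc, sub_zero]
  gcongr with s
  have h2 : ‖cutoff h ‖x‖ • x‖ ≤ H := by
    rw [norm_smul, Real.norm_eq_abs, abs_of_nonneg (hh.cutoff_nonneg _)]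
    rw [mem_ball_zero_iff] at hx
    calc cutoff h ‖x‖ * ‖x‖ ≤ H * 1 := mul_le_mul (hh.cutoff_le (norm_nonneg x)) hx.le
          (norm_nonneg x) hh.H_pos.le
      _ = H := mul_one H
  have h3 : ‖f' s‖ ≤ H * ‖fderiv ℝ u (radialMap h s x)‖ := by
    refine (le_opNorm _ _).trans ?_
    rw [mul_comm]
    gcongr
  rw [ENNReal.ofReal_pow hh.H_pos.le, ← mul_pow]
  gcongr
  rw [← ofReal_norm, ← ofReal_norm, ← ENNReal.ofReal_mul hh.H_pos.le]
  exact ENNReal.ofReal_le_ofReal h3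

lemma lintegral_enorm_sub_sq_le {n : ℕ} (hn : 1 ≤ n) {u : Euc n → ℂ}
    (hu : DifferentiableOn ℝ u (ball 0 1)) {t : ℝ} (ht : 0 ≤ t) (htH : t * H ≤ 1 / 2) :
    ∫⁻ x in ball (0 : Euc n) 1, ‖u (radialMap h t x) - u x‖ₑ ^ 2 ≤
      ENNReal.ofReal (2 * H ^ 2 * t ^ 2) * ∫⁻ x in ball (0 : Euc n) 1, ‖fderiv ℝ u x‖ₑ ^ 2 := by
  set M := ∫⁻ x in ball (0 : Euc n) 1, ‖fderiv ℝ u x‖ₑ ^ 2 with hM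
  have hmeas : Measurable fun p : Euc n × ℝ =>
      ENNReal.ofReal (H ^ 2) * ‖fderiv ℝ u (radialMap h p.2 p.1)‖ₑ ^ 2 :=
    ((((measurable_fderiv ℝ u).comp hh.continuous_radialMap_uncurry.measurable).enorm).pow_const
      2).const_mul _
  calc _ ≤ ∫⁻ x in ball (0 : Euc n) 1, ENNReal.ofReal t *
        ∫⁻ s in Set.Ioc 0 t, ENNReal.ofReal (H ^ 2) * ‖fderiv ℝ u (radialMap h s x)‖ₑ ^ 2 :=
        setLIntegral_mono' measurableSet_ball fun x hx => hh.enorm_sub_sq_le hu ht htH hx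
    _ = ENNReal.ofReal t * ∫⁻ s in Set.Ioc 0 t, ∫⁻ x in ball (0 : Euc n) 1,
        ENNReal.ofReal (H ^ 2) * ‖fderiv ℝ u (radialMap h s x)‖ₑ ^ 2 := by
        rw [lintegral_const_mul' _ _ (by simp), lintegral_lintegral_swap]
        exact hmeas.aemeasurable
    _ ≤ ENNReal.ofReal t * ∫⁻ s in Set.Ioc 0 t, ENNReal.ofReal (H ^ 2) * (2 * M) := by
        gcongr ENNReal.ofReal t * ?_
        refine setLIntegral_mono' measurableSet_Ioc fun s hs => ?_
        rw [lintegral_const_mul' _ _ (by simp)]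
        gcongr
        exact hh.lintegral_comp_radialMap_le hn hs.1.le
          (by nlinarith [mul_le_mul_of_nonneg_right hs.2 hh.H_pos.le])
          (fun y => ‖fderiv ℝ u y‖ₑ ^ 2)
    _ = _ := by
        rw [lintegral_const]
        simp only [Measure.restrict_apply MeasurableSet.univ, Set.univ_inter, Real.volume_Ioc,
          sub_zero]
        rw [ENNReal.ofReal_mul (by positivity), ENNReal.ofReal_mul (by norm_num), ENNReal.ofReal_pow ht,
          ENNReal.ofReal_ofNat]
        ring

end IsProfile

end

/-- The quadratic form `∑ G_ij P_i · P_j` on `ℂⁿ`. -/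
def quad {n : ℕ} (G : Matrix (Fin n) (Fin n) ℝ) (P : Fin n → ℂ) : ℝ :=
  ∑ i, ∑ j, G i j * rdot (P i) (P j)

/-- The contraction `∑ G_ij y_i P_j`. -/
def contr {n : ℕ} (G : Matrix (Fin n) (Fin n) ℝ) (y : Fin n → ℝ) (P : Fin n → ℂ) : ℂ :=
  ∑ i, ∑ j, ((G i j * y i : ℝ) : ℂ) * P j

lemma abs_rdot_le (v w : ℂ) : |rdot v w| ≤ ‖v‖ * ‖w‖ := by
  rw [rdot_eq_inner]; exact abs_real_inner_le_norm v w

lemma rdot_self (v : ℂ) : rdot v v = ‖v‖ ^ 2 := by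
  rw [rdot_eq_inner, real_inner_self_eq_norm_sq]

lemma abs_quad_le {n : ℕ} {G : Matrix (Fin n) (Fin n) ℝ} {M : ℝ} (hG : ∀ i j, |G i j| ≤ M)
    (P : Fin n → ℂ) : |quad G P| ≤ M * (∑ i, ‖P i‖) ^ 2 := by
  have : M * (∑ i, ‖P i‖) ^ 2 = ∑ i, ∑ j, M * (‖P i‖ * ‖P j‖) := by
    rw [sq, Finset.sum_mul_sum, Finset.mul_sum]
    simp_rw [Finset.mul_sum]
  rw [this]
  refine (Finset.abs_sum_le_sum_abs _ _).trans (Finset.sum_le_sum fun i _ =>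
    (Finset.abs_sum_le_sum_abs _ _).trans (Finset.sum_le_sum fun j _ => ?_))
  rw [abs_mul]
  exact mul_le_mul (hG i j) (abs_rdot_le _ _) (abs_nonneg _) ((abs_nonneg _).trans (hG i j))

lemma norm_contr_le {n : ℕ} {G : Matrix (Fin n) (Fin n) ℝ} {M : ℝ} (hG : ∀ i j, |G i j| ≤ M)
    {y : Fin n → ℝ} (hy : ∀ i, |y i| ≤ 1) (P : Fin n → ℂ) :
    ‖contr G y P‖ ≤ n * M * ∑ i, ‖P i‖ := by
  have : n * M * ∑ i, ‖P i‖ = ∑ i : Fin n, ∑ j, M * ‖P j‖ := by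
    simp [Finset.mul_sum, mul_assoc]
  rw [this]
  refine (norm_sum_le _ _).trans (Finset.sum_le_sum fun i _ =>
    (norm_sum_le _ _).trans (Finset.sum_le_sum fun j _ => ?_))
  rw [norm_mul, Complex.norm_real, Real.norm_eq_abs, abs_mul]
  refine mul_le_mul_of_nonneg_right ?_ (norm_nonneg _)
  calc |G i j| * |y i| ≤ M * 1 := mul_le_mul (hG i j) (hy i) (abs_nonneg _)
        ((abs_nonneg _).trans (hG i j))
    _ = M := mul_one M

lemma contr_sub {n : ℕ} (G G' : Matrix (Fin n) (Fin n) ℝ) (y : Fin n → ℝ) (P : Fin n → ℂ) :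
    contr G y P - contr G' y P = contr (G - G') y P := by
  simp only [contr, ← Finset.sum_sub_distrib, Matrix.sub_apply]
  refine Finset.sum_congr rfl fun i _ => Finset.sum_congr rfl fun j _ => ?_
  push_cast; ring

lemma quad_sub {n : ℕ} (G G' : Matrix (Fin n) (Fin n) ℝ) (P : Fin n → ℂ) :
    quad G P - quad G' P = quad (G - G') P := by
  simp only [quad, ← Finset.sum_sub_distrib, Matrix.sub_apply]
  refine Finset.sum_congr rfl fun i _ => Finset.sum_congr rfl fun j _ => by ring

lemma contr_one {n : ℕ} (y : Fin n → ℝ) (P : Fin n → ℂ) :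
    contr 1 y P = ∑ i, (y i : ℂ) * P i := by
  simp [contr, Matrix.one_apply, apply_ite Complex.ofReal]

/-- Expansion of the quadratic form at a rank-one perturbation. -/
lemma quad_perturb {n : ℕ} {G : Matrix (Fin n) (Fin n) ℝ} (hG : ∀ i j, G i j = G j i)
    (y : Fin n → ℝ) (P : Fin n → ℂ) (Y : ℂ) (c τ : ℝ) :
    quad G (fun i => (c : ℂ) * P i - ((τ * y i : ℝ) : ℂ) * Y) =
      c ^ 2 * quad G P - 2 * (c * τ) * rdot (contr G y P) Y +
        τ ^ 2 * ((∑ i, ∑ j, G i j * (y i * y j)) * ‖Y‖ ^ 2) := by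
  have h1 : rdot (contr G y P) Y = ∑ i, ∑ j, G i j * (y i * rdot (P j) Y) := by
    simp only [contr, rdot, Complex.re_sum, Complex.im_sum, Complex.re_ofReal_mul,
      Complex.im_ofReal_mul, Finset.sum_mul, ← Finset.sum_add_distrib]
    refine Finset.sum_congr rfl fun i _ => Finset.sum_congr rfl fun j _ => by ring
  have h2 : rdot (contr G y P) Y = ∑ i, ∑ j, G i j * (y j * rdot (P i) Y) := by
    rw [h1, Finset.sum_comm]
    refine Finset.sum_congr rfl fun i _ => Finset.sum_congr rfl fun j _ => by rw [hG j i]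
  have h3 : 2 * (c * τ) * rdot (contr G y P) Y =
      c * τ * rdot (contr G y P) Y + c * τ * rdot (contr G y P) Y := by ring
  rw [h3]
  nth_rewrite 1 [h1]
  rw [h2, ← rdot_self]
  simp only [quad, Finset.mul_sum, Finset.sum_mul, ← Finset.sum_add_distrib,
    ← Finset.sum_sub_distrib]
  refine Finset.sum_congr rfl fun i _ => Finset.sum_congr rfl fun j _ => ?_
  simp only [rdot, Complex.sub_re, Complex.sub_im, Complex.re_ofReal_mul, Complex.im_ofReal_mul]
  ring

/-- Energy density, as a function of the point, the gradient and the potential. -/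
def eForm {n : ℕ} (g : Euc n → Matrix (Fin n) (Fin n) ℝ) (x : Euc n) (P : Fin n → ℂ) (W : ℝ) : ℝ :=
  (quad (g x)⁻¹ P / 2 + W) * sqrtDet g x

/-- The size `(∑ |P_i|)² + W` of a gradient and a potential. -/
def sizeForm {n : ℕ} (P : Fin n → ℂ) (W : ℝ) : ℝ := (∑ i, ‖P i‖) ^ 2 + W

/-- The unit radial direction. -/
def dir {n : ℕ} (x : Euc n) (i : Fin n) : ℝ := x i / ‖x‖

lemma abs_dir_le {n : ℕ} (x : Euc n) (i : Fin n) : |dir x i| ≤ 1 := by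
  rw [dir, abs_div, abs_norm]
  exact div_le_one_of_le₀ (PiLp.norm_apply_le x i) (norm_nonneg _)

/-- The first variation of energy density under the radial deformation with profile `h`. -/
def varForm {n : ℕ} (g : Euc n → Matrix (Fin n) (Fin n) ℝ) (C : ℝ) (h : ℝ → ℝ) (x : Euc n)
    (P : Fin n → ℂ) (W : ℝ) : ℝ :=
  -cutoff h ‖x‖ * (((n : ℝ) - 2) * eForm g x P W + 2 * (W * sqrtDet g x)) +
    C * (cutoff h ‖x‖ * ‖x‖) * eForm g x P W +
    h ‖x‖ * ‖x‖ * ((1 + C * ‖x‖) * eForm g x P W -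
      sqrtDet g x * ‖contr (g x)⁻¹ (dir x) P‖ ^ 2)

lemma sizeForm_nonneg {n : ℕ} (P : Fin n → ℂ) {W : ℝ} (hW : 0 ≤ W) : 0 ≤ sizeForm P W := by
  unfold sizeForm; positivity

namespace GoodMetric

variable {n : ℕ} {g : Euc n → Matrix (Fin n) (Fin n) ℝ} {lam L β : ℝ}
  (hg : GoodMetric n g lam L β)
include hg

lemma sum_norm_sq_le_quad {x : Euc n} (hx : x ∈ ball (0 : Euc n) 1) (P : Fin n → ℂ) :
    lam * ∑ i, ‖P i‖ ^ 2 ≤ quad (g x)⁻¹ P := by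
  have h1 := hg.ellip x hx fun i => (P i).re
  have h2 := hg.ellip x hx fun i => (P i).im
  have h3 := add_le_add h1 h2
  rw [← mul_add, ← Finset.sum_add_distrib] at h3
  simp only [← Finset.sum_add_distrib] at h3
  refine le_of_eq_of_le ?_ (h3.trans_eq ?_)
  · congr 1
    refine Finset.sum_congr rfl fun i _ => ?_
    rw [← rdot_self, rdot]; ring
  · refine Finset.sum_congr rfl fun i _ => Finset.sum_congr rfl fun j _ => ?_
    rw [rdot]; ring

lemma sizeForm_le (hlam : 0 < lam) (hβ : 0 < β) {x : Euc n} (hx : x ∈ ball (0 : Euc n) 1)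
    (P : Fin n → ℂ) {W : ℝ} (hW : 0 ≤ W) :
    sizeForm P W ≤ (2 * n / (lam * β) + 1 / β) * eForm g x P W := by
  have h1 := hg.sum_norm_sq_le_quad hx P
  have h2 := hg.le_det x hx
  have h0 : 0 ≤ ∑ i, ‖P i‖ ^ 2 := Finset.sum_nonneg fun i _ => by positivity
  have h3 : (∑ i, ‖P i‖) ^ 2 ≤ n * ∑ i, ‖P i‖ ^ 2 := by
    simpa using sq_sum_le_card_mul_sum_sq (s := Finset.univ) (f := fun i => ‖P i‖)
  have hq : 0 ≤ quad (g x)⁻¹ P := (by positivity : 0 ≤ lam * ∑ i, ‖P i‖ ^ 2).trans h1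
  have h4 : quad (g x)⁻¹ P * β ≤ 2 * eForm g x P W := by
    unfold eForm
    nlinarith [mul_le_mul_of_nonneg_left h2 hq, mul_nonneg hW (hβ.le.trans h2)]
  have h5 : W * β ≤ eForm g x P W := by
    unfold eForm
    nlinarith [mul_le_mul_of_nonneg_left h2 hW, mul_nonneg hq (hβ.le.trans h2)]
  have h6 : ∑ i, ‖P i‖ ^ 2 ≤ 2 / (lam * β) * eForm g x P W := by
    rw [div_mul_eq_mul_div, le_div_iff₀ (by positivity)]
    nlinarith
  have h7 : W ≤ 1 / β * eForm g x P W := by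
    rw [div_mul_eq_mul_div, le_div_iff₀ (by positivity), one_mul]
    exact h5
  have h8 := mul_le_mul_of_nonneg_left h6 (Nat.cast_nonneg (α := ℝ) n)
  unfold sizeForm
  calc _ ≤ n * (2 / (lam * β) * eForm g x P W) + 1 / β * eForm g x P W := by linarith
    _ = _ := by ring

lemma abs_eForm_le (hL : 0 < L) {x : Euc n} (hx : x ∈ ball (0 : Euc n) 1)
    (P : Fin n → ℂ) {W : ℝ} (hW : 0 ≤ W) : |eForm g x P W| ≤ (L ^ 2 + L) * sizeForm P W := by
  have h1 := abs_quad_le (hg.inv_le x hx) P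
  have h2 := hg.det_le x hx
  have h3 : 0 ≤ sqrtDet g x := Real.sqrt_nonneg _
  have hp := sq_nonneg (∑ i, ‖P i‖)
  have h4 : |quad (g x)⁻¹ P / 2 + W| ≤ L * (∑ i, ‖P i‖) ^ 2 + W := by
    refine (abs_add_le _ _).trans ?_
    rw [abs_div, abs_of_nonneg hW, abs_two]
    nlinarith [abs_nonneg (quad (g x)⁻¹ P)]
  rw [eForm, abs_mul, abs_of_nonneg h3, sizeForm]
  have h5 := mul_le_mul h4 h2 h3 ((abs_nonneg _).trans h4)
  nlinarith [mul_nonneg hL.le hp, mul_nonneg hL.le hW, mul_nonneg (sq_nonneg L) hW]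

lemma abs_eForm_sub_le (hL : 0 < L) {x y : Euc n} (hx : x ∈ ball (0 : Euc n) 1)
    (hy : y ∈ ball (0 : Euc n) 1)
    (P : Fin n → ℂ) {W : ℝ} (hW : 0 ≤ W) :
    |eForm g x P W - eForm g y P W| ≤ (L ^ 2 + L) * ‖x - y‖ * sizeForm P W := by
  have h1 := abs_quad_le (hg.inv_le x hx) P
  have h1' := abs_quad_le (G := (g x)⁻¹ - (g y)⁻¹) (fun i j => hg.inv_lip x hx y hy i j) P
  rw [← quad_sub] at h1'
  have h2 := hg.det_le y hy
  have h3 : 0 ≤ sqrtDet g y := Real.sqrt_nonneg _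
  have h4 := hg.det_lip x hx y hy
  have hp := sq_nonneg (∑ i, ‖P i‖)
  set d := ‖x - y‖
  have hd : 0 ≤ d := norm_nonneg _
  have e : eForm g x P W - eForm g y P W = quad (g x)⁻¹ P / 2 * (sqrtDet g x - sqrtDet g y) +
      (quad (g x)⁻¹ P - quad (g y)⁻¹ P) / 2 * sqrtDet g y + W * (sqrtDet g x - sqrtDet g y) := by
    unfold eForm; ring
  rw [e, sizeForm]
  refine (abs_add_three _ _ _).trans ?_
  rw [abs_mul, abs_mul, abs_mul, abs_div, abs_div, abs_two, abs_of_nonneg hW, abs_of_nonneg h3]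
  have h5 := mul_le_mul h1 h4 (abs_nonneg _) (by positivity)
  have h6 := mul_le_mul h1' h2 h3 (by positivity)
  have h7 := mul_le_mul_of_nonneg_left h4 hW
  have h8 : 0 ≤ L ^ 2 * d * W := by positivity
  have h9 : 0 ≤ L * d * (∑ i, ‖P i‖) ^ 2 := by positivity
  nlinarith

end GoodMetric

lemma exists_abs_one_add_pow_sub_le (m : ℕ) : ∃ K : ℝ, 0 ≤ K ∧ ∀ a : ℝ, 0 ≤ a → a ≤ 1 →
    |(1 + a) ^ m - 1 - m * a| ≤ K * a ^ 2 := by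
  induction m with
  | zero => exact ⟨0, le_rfl, fun a _ _ => by simp⟩
  | succ m ih =>
    obtain ⟨K, hK, h⟩ := ih
    refine ⟨2 * K + m, by positivity, fun a ha ha1 => ?_⟩
    have e : (1 + a) ^ (m + 1) - 1 - ((m + 1 : ℕ) : ℝ) * a =
        ((1 + a) ^ m - 1 - m * a) * (1 + a) + m * a ^ 2 := by
      push_cast; ring
    rw [e]
    refine (abs_add_le _ _).trans ?_
    rw [abs_mul, abs_of_nonneg (by positivity : 0 ≤ 1 + a), abs_of_nonneg (by positivity :
      0 ≤ (m : ℝ) * a ^ 2)]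
    have := mul_le_mul (h a ha ha1) (by linarith : 1 + a ≤ 2) (by positivity) (by positivity)
    linarith

lemma IsProfile.exists_abs_radialJac_sub_le {h : ℝ → ℝ} {σ ρ H : ℝ} (hh : IsProfile h σ ρ H)
    {n : ℕ} (hn : 1 ≤ n) :
    ∃ K : ℝ, 0 ≤ K ∧ ∀ t : ℝ, 0 ≤ t → t * H ≤ 1 / 2 → ∀ x ∈ ball (0 : Euc n) 1,
      |radialJac h t x - 1 - t * (n * cutoff h ‖x‖ - h ‖x‖ * ‖x‖)| ≤ K * t ^ 2 := by
  obtain ⟨K1, hK1, h1⟩ := exists_abs_one_add_pow_sub_le n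
  obtain ⟨K2, hK2, h2⟩ := exists_abs_one_add_pow_sub_le (n - 1)
  have hH := hh.H_pos
  refine ⟨K1 * H ^ 2 + H * (n * H + K2 * H), by positivity, fun t ht htH x hx => ?_⟩
  rw [mem_ball_zero_iff] at hx
  have hη0 := hh.cutoff_nonneg ‖x‖
  have hη := hh.cutoff_le (norm_nonneg x)
  set η := cutoff h ‖x‖ with hηd
  have ha0 : 0 ≤ t * η := mul_nonneg ht hη0
  have ha : t * η ≤ t * H := mul_le_mul_of_nonneg_left hη ht
  have hτ0 : 0 ≤ h ‖x‖ * ‖x‖ := mul_nonneg (hh.nonneg _) (norm_nonneg _)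
  have hτ : h ‖x‖ * ‖x‖ ≤ H := by
    have := mul_le_mul (hh.le ‖x‖) hx.le (norm_nonneg _) hH.le
    linarith
  set k := h ‖x‖ * ‖x‖
  have j1 := h1 _ ha0 (by linarith)
  have j2 := h2 _ ha0 (by linarith)
  obtain ⟨m, rfl⟩ : ∃ m, n = m + 1 := ⟨n - 1, by omega⟩
  simp only [Nat.add_sub_cancel] at *
  have e : radialJac h t x - 1 - t * (((m + 1 : ℕ) : ℝ) * η - k) =
      ((1 + t * η) ^ (m + 1) - 1 - ((m + 1 : ℕ) : ℝ) * (t * η)) -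
        t * k * (((1 + t * η) ^ m - 1 - m * (t * η)) + m * (t * η)) := by
    simp only [radialJac, Nat.add_sub_cancel, ← hηd]
    ring
  rw [e]
  refine (abs_sub _ _).trans ?_
  have hsq : (t * η) ^ 2 ≤ (t * H) ^ 2 := pow_le_pow_left₀ ha0 ha 2
  have j3 : |((1 + t * η) ^ m - 1 - m * (t * η)) + m * (t * η)| ≤
      K2 * (t * H) + ((m + 1 : ℕ) : ℝ) * (t * H) := by
    refine (abs_add_le _ _).trans ?_
    rw [abs_of_nonneg (by positivity : 0 ≤ (m : ℝ) * (t * η))]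
    push_cast
    have : (t * H) ^ 2 ≤ t * H := by nlinarith [mul_nonneg ht hH.le]
    nlinarith [mul_le_mul_of_nonneg_left (hsq.trans this) hK2,
      mul_le_mul_of_nonneg_left ha (Nat.cast_nonneg (α := ℝ) m), mul_nonneg ht hH.le]
  rw [abs_mul, abs_of_nonneg (mul_nonneg ht hτ0)]
  have j4 := mul_le_mul (mul_le_mul_of_nonneg_left hτ ht) j3 (abs_nonneg _) (by positivity)
  have j5 := mul_le_mul_of_nonneg_left hsq hK1
  nlinarith

set_option maxHeartbeats 1000000 in
lemma variation_real_bound {N t H r η k a τ E E' w X Z S j M L A C K₂ Kx Kz κ Kr : ℝ}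
    (ht : 0 ≤ t) (htH : t * H ≤ 1 / 2) (hH : 0 < H) (hN : 0 ≤ N)
    (hr0 : 0 ≤ r) (hr1 : r ≤ 1) (hη0 : 0 ≤ η) (hη : η ≤ H) (hk0 : 0 ≤ k) (hk : k ≤ H)
    (ha : a = t * η) (hτ : τ = t * (k * r)) (hS : 0 ≤ S) (hM : 0 ≤ M) (hL : 0 ≤ L)
    (hE : |E| ≤ M * S) (hEE : |E' - E| ≤ M * (a * r) * S) (hw0 : 0 ≤ w) (hw : w ≤ L * S)
    (hX : |X| ≤ Kx * S) (hKx : 0 ≤ Kx) (hZ : Z ≤ Kz * S) (hKz : 0 ≤ Kz)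
    (hj : |j| ≤ K₂ * t ^ 2)
    (hXA : A - Kr * r * S ≤ X) (hSE : S ≤ κ * E) (hC : κ * (M + Kr) ≤ C) (hKr : 0 ≤ Kr)
    (hκ : 0 < κ) :
    (1 + a) ^ 2 * (E - w) - (1 + a) * τ * X + τ ^ 2 * Z + w -
        E' * (1 + t * (N * η - k * r) + j) ≤
      t * (-η * ((N - 2) * E + 2 * w) + C * (η * r) * E + k * r * ((1 + C * r) * E - A)) +
        (H ^ 2 * (M + L) + H ^ 2 * Kx + H ^ 2 * Kz + M * (N + 1) * H ^ 2 + 2 * M * K₂) *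
          t ^ 2 * S := by
  have hkr0 : 0 ≤ k * r := mul_nonneg hk0 hr0
  have hkr : k * r ≤ H := by nlinarith
  have ha0 : 0 ≤ a := ha ▸ mul_nonneg ht hη0
  have haH : a ≤ t * H := ha ▸ mul_le_mul_of_nonneg_left hη ht
  have hτ0 : 0 ≤ τ := hτ ▸ mul_nonneg ht hkr0
  have hτH : τ ≤ t * H := hτ ▸ mul_le_mul_of_nonneg_left hkr ht
  have htH0 : 0 ≤ t * H := mul_nonneg ht hH.le
  have hEnn : 0 ≤ E := by
    by_contra! hlt
    nlinarith [mul_neg_of_pos_of_neg hκ hlt]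
  have harS : 0 ≤ a * r := mul_nonneg ha0 hr0
  set e := E' - E with he
  have hE' : E' = E + e := by rw [he]; ring
  -- the five error terms
  have b1 : a ^ 2 * (E - w) ≤ H ^ 2 * (M + L) * t ^ 2 * S := by
    have h1 : E - w ≤ (M + L) * S := by nlinarith [le_abs_self E, mul_nonneg hL hS]
    have h2 : a ^ 2 ≤ (t * H) ^ 2 := pow_le_pow_left₀ ha0 haH 2
    calc a ^ 2 * (E - w) ≤ a ^ 2 * ((M + L) * S) := mul_le_mul_of_nonneg_left h1 (sq_nonneg a)
      _ ≤ (t * H) ^ 2 * ((M + L) * S) := mul_le_mul_of_nonneg_right h2 (by positivity)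
      _ = _ := by ring
  have b2 : -(a * τ * X) ≤ H ^ 2 * Kx * t ^ 2 * S := by
    have h1 : -X ≤ Kx * S := (neg_le_abs X).trans hX
    have h2 : a * τ ≤ (t * H) * (t * H) := mul_le_mul haH hτH hτ0 htH0
    calc -(a * τ * X) = a * τ * (-X) := by ring
      _ ≤ a * τ * (Kx * S) := mul_le_mul_of_nonneg_left h1 (mul_nonneg ha0 hτ0)
      _ ≤ (t * H) * (t * H) * (Kx * S) := mul_le_mul_of_nonneg_right h2 (by positivity)
      _ = _ := by ring
  have b3 : τ ^ 2 * Z ≤ H ^ 2 * Kz * t ^ 2 * S := by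
    have h2 : τ ^ 2 ≤ (t * H) ^ 2 := pow_le_pow_left₀ hτ0 hτH 2
    calc τ ^ 2 * Z ≤ τ ^ 2 * (Kz * S) := mul_le_mul_of_nonneg_left hZ (sq_nonneg τ)
      _ ≤ (t * H) ^ 2 * (Kz * S) := mul_le_mul_of_nonneg_right h2 (by positivity)
      _ = _ := by ring
  have har : a * r ≤ t * H := (mul_le_of_le_one_right ha0 hr1).trans haH
  have he1 : |e| ≤ M * (t * H) * S := hEE.trans (by gcongr)
  have b4 : -(e * (t * (N * η - k * r))) ≤ M * (N + 1) * H ^ 2 * t ^ 2 * S := by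
    have h1 : |t * (N * η - k * r)| ≤ t * ((N + 1) * H) := by
      rw [abs_mul, abs_of_nonneg ht]
      refine mul_le_mul_of_nonneg_left ?_ ht
      rw [abs_le]
      constructor <;> nlinarith [mul_nonneg hN hη0, mul_le_mul_of_nonneg_left hη hN]
    calc -(e * (t * (N * η - k * r))) ≤ |e * (t * (N * η - k * r))| := neg_le_abs _
      _ = |e| * |t * (N * η - k * r)| := abs_mul _ _
      _ ≤ (M * (t * H) * S) * (t * ((N + 1) * H)) :=
          mul_le_mul he1 h1 (abs_nonneg _) (by positivity)
      _ = _ := by ring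
  have b5 : -((E + e) * j) ≤ 2 * M * K₂ * t ^ 2 * S := by
    have h1 : |E + e| ≤ 2 * M * S := by
      have h2 : M * (t * H) * S ≤ M * S := by
        have := mul_nonneg hM hS
        nlinarith
      exact (abs_add_le _ _).trans (by linarith)
    calc -((E + e) * j) ≤ |(E + e) * j| := neg_le_abs _
      _ = |E + e| * |j| := abs_mul _ _
      _ ≤ (2 * M * S) * (K₂ * t ^ 2) := mul_le_mul h1 hj (abs_nonneg _) (by positivity)
      _ = _ := by ring
  -- the first-order terms
  have hC' : (M + Kr) * S ≤ C * E := by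
    calc (M + Kr) * S ≤ (M + Kr) * (κ * E) := mul_le_mul_of_nonneg_left hSE (by positivity)
      _ = κ * (M + Kr) * E := by ring
      _ ≤ C * E := mul_le_mul_of_nonneg_right hC hEnn
  have c1 : -e ≤ t * (C * (η * r) * E) := by
    calc -e ≤ |e| := neg_le_abs _
      _ ≤ M * (a * r) * S := hEE
      _ = (a * r) * (M * S) := by ring
      _ ≤ (a * r) * (C * E) :=
          mul_le_mul_of_nonneg_left (by nlinarith [mul_nonneg hKr hS]) harS
      _ = _ := by rw [ha]; ring
  have c2 : -(τ * X) ≤ t * (k * r * (C * r * E - A)) := by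
    have h1 : -X ≤ C * r * E - A := by
      have : Kr * r * S ≤ C * r * E := by
        have := mul_le_mul_of_nonneg_left (show Kr * S ≤ C * E by nlinarith [mul_nonneg hM hS]) hr0
        linarith
      linarith
    have := mul_le_mul_of_nonneg_left h1 hτ0
    calc -(τ * X) = τ * -X := by ring
      _ ≤ τ * (C * r * E - A) := this
      _ = _ := by rw [hτ]; ring
  have key : (1 + a) ^ 2 * (E - w) - (1 + a) * τ * X + τ ^ 2 * Z + w -
        E' * (1 + t * (N * η - k * r) + j) =
      t * (-η * ((N - 2) * E + 2 * w)) + t * (k * r * E) + -e + -(τ * X) + a ^ 2 * (E - w) +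
        -(a * τ * X) + τ ^ 2 * Z + -(e * (t * (N * η - k * r))) + -((E + e) * j) := by
    rw [hE', ha]; ring
  rw [key]
  linarith

/-- The constant in the first variation inequality. -/
def varConst (n : ℕ) (lam L β : ℝ) : ℝ :=
  (2 * n / (lam * β) + 1 / β) * (L ^ 2 + L + n ^ 2 * L ^ 3) + 1

lemma sum_norm_sq_le_sizeForm {n : ℕ} (P : Fin n → ℂ) {W : ℝ} (hW : 0 ≤ W) :
    (∑ i, ‖P i‖) ^ 2 ≤ sizeForm P W := by
  unfold sizeForm; linarith

lemma le_sizeForm {n : ℕ} (P : Fin n → ℂ) (W : ℝ) : W ≤ sizeForm P W := by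
  unfold sizeForm; nlinarith [sq_nonneg (∑ i, ‖P i‖)]

namespace GoodMetric

variable {n : ℕ} {g : Euc n → Matrix (Fin n) (Fin n) ℝ} {lam L β : ℝ}
  (hg : GoodMetric n g lam L β)
include hg

lemma norm_contr_sub_one_le {x : Euc n} (hx : x ∈ ball (0 : Euc n) 1) {y : Fin n → ℝ}
    (hy : ∀ i, |y i| ≤ 1) (P : Fin n → ℂ) :
    ‖contr 1 y P - contr (g x)⁻¹ y P‖ ≤ n * (L * ‖x‖) * ∑ i, ‖P i‖ := by
  rw [contr_sub]
  refine norm_contr_le (fun i j => ?_) hy P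
  have := hg.inv_lip 0 (by simp) x hx i j
  rwa [hg.inv_zero, zero_sub, norm_neg, ← Matrix.one_apply] at this

lemma variation_le_varForm (hlam : 0 < lam) (hL : 0 < L) (hβ : 0 < β) (hn : 1 ≤ n)
    {h : ℝ → ℝ} {σ ρ H : ℝ} (hh : IsProfile h σ ρ H) :
    ∃ K : ℝ, 0 ≤ K ∧ ∀ t : ℝ, 0 ≤ t → t * H ≤ 1 / 2 → ∀ x ∈ ball (0 : Euc n) 1,
      ∀ (P : Fin n → ℂ) (W : ℝ), 0 ≤ W →
      (quad (g x)⁻¹ (fun i => ((1 + t * cutoff h ‖x‖ : ℝ) : ℂ) * P i -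
        ((t * (h ‖x‖ * ‖x‖) * dir x i : ℝ) : ℂ) * contr 1 (dir x) P) / 2 + W) * sqrtDet g x -
        eForm g (radialMap h t x) P W * radialJac h t x ≤
      t * varForm g (varConst n lam L β) h x P W + K * t ^ 2 * sizeForm P W := by
  obtain ⟨K₂, hK₂, hJ⟩ := hh.exists_abs_radialJac_sub_le hn
  have hH := hh.H_pos
  refine ⟨H ^ 2 * (L ^ 2 + L + L) + H ^ 2 * (n * L ^ 2) + H ^ 2 * (n ^ 2 * L ^ 2) +
    (L ^ 2 + L) * (n + 1) * H ^ 2 + 2 * (L ^ 2 + L) * K₂, by positivity,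
    fun t ht htH x hx P W hW => ?_⟩
  have hS := sizeForm_nonneg P hW
  have hpS := sum_norm_sq_le_sizeForm P hW
  have hφ := hh.radialMap_mem_ball ht (by linarith : t * H < 1) hx
  have hd : ‖radialMap h t x - x‖ = t * cutoff h ‖x‖ * ‖x‖ := hh.norm_radialMap_sub ht x
  have hx1 : ‖x‖ ≤ 1 := (mem_ball_zero_iff.1 hx).le
  have hb0 : 0 ≤ sqrtDet g x := Real.sqrt_nonneg _
  have hbL := hg.det_le x hx
  set p := ∑ i, ‖P i‖ with hp
  have hp0 : 0 ≤ p := Finset.sum_nonneg fun i _ => norm_nonneg _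
  set R := contr (g x)⁻¹ (dir x) P with hR
  set Y := contr 1 (dir x) P with hY
  have hRn : ‖R‖ ≤ n * L * p := norm_contr_le (hg.inv_le x hx) (abs_dir_le x) P
  have hYn : ‖Y‖ ≤ p := by
    rw [hY, contr_one]
    refine (norm_sum_le _ _).trans (Finset.sum_le_sum fun i _ => ?_)
    rw [norm_mul, Complex.norm_real]
    exact mul_le_of_le_one_left (norm_nonneg _) (abs_dir_le x i)
  have hYR : ‖Y - R‖ ≤ n * (L * ‖x‖) * p := hg.norm_contr_sub_one_le hx (abs_dir_le x) P
  have hX : |sqrtDet g x * rdot R Y| ≤ n * L ^ 2 * sizeForm P W := by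
    rw [abs_mul, abs_of_nonneg hb0]
    calc sqrtDet g x * |rdot R Y| ≤ L * ((n * L * p) * p) := by
          refine mul_le_mul hbL ((abs_rdot_le _ _).trans ?_) (abs_nonneg _) hL.le
          exact mul_le_mul hRn hYn (norm_nonneg _) (by positivity)
      _ = n * L ^ 2 * p ^ 2 := by ring
      _ ≤ _ := by gcongr
  have hXA : sqrtDet g x * ‖R‖ ^ 2 - n ^ 2 * L ^ 3 * ‖x‖ * sizeForm P W ≤
      sqrtDet g x * rdot R Y := by
    have h1 : rdot R Y = ‖R‖ ^ 2 + rdot R (Y - R) := by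
      rw [← rdot_self]; simp only [rdot, Complex.sub_re, Complex.sub_im]; ring
    have h2 : -rdot R (Y - R) ≤ (n * L * p) * (n * (L * ‖x‖) * p) :=
      (neg_le_abs _).trans ((abs_rdot_le _ _).trans
        (mul_le_mul hRn hYR (norm_nonneg _) (by positivity)))
    have h3 : sqrtDet g x * -rdot R (Y - R) ≤ L * ((n * L * p) * (n * (L * ‖x‖) * p)) :=
      (mul_le_mul_of_nonneg_left h2 hb0).trans
        (mul_le_mul_of_nonneg_right hbL (by positivity))
    have h4 : L * ((n * L * p) * (n * (L * ‖x‖) * p)) ≤ n ^ 2 * L ^ 3 * ‖x‖ * sizeForm P W := by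
      calc _ = n ^ 2 * L ^ 3 * ‖x‖ * p ^ 2 := by ring
        _ ≤ _ := by gcongr
    rw [h1]
    linarith
  have hZ : sqrtDet g x / 2 * ((∑ i, ∑ j, (g x)⁻¹ i j * (dir x i * dir x j)) * ‖Y‖ ^ 2) ≤
      (n ^ 2 * L ^ 2) * sizeForm P W := by
    have h1 : (∑ i, ∑ j, (g x)⁻¹ i j * (dir x i * dir x j)) ≤ n ^ 2 * L := by
      calc _ ≤ ∑ i : Fin n, ∑ j : Fin n, L := by
            refine Finset.sum_le_sum fun i _ => Finset.sum_le_sum fun j _ => ?_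
            refine (le_abs_self _).trans ?_
            rw [abs_mul, abs_mul]
            calc _ ≤ L * (1 * 1) := mul_le_mul (hg.inv_le x hx i j)
                  (mul_le_mul (abs_dir_le x i) (abs_dir_le x j) (abs_nonneg _) zero_le_one)
                  (by positivity) hL.le
              _ = L := by ring
        _ = _ := by simp; ring
    have h2 : ‖Y‖ ^ 2 ≤ p ^ 2 := pow_le_pow_left₀ (norm_nonneg _) hYn 2
    calc _ ≤ L * (n ^ 2 * L * sizeForm P W) := by
          refine (mul_le_mul_of_nonneg_left (mul_le_mul_of_nonneg_right h1 (sq_nonneg _))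
            (by positivity)).trans ?_
          exact mul_le_mul (by linarith)
            (mul_le_mul_of_nonneg_left (h2.trans hpS) (by positivity)) (by positivity) hL.le
      _ = _ := by ring
  have hEE := hg.abs_eForm_sub_le hL hφ hx P hW
  rw [hd] at hEE
  have hw : W * sqrtDet g x ≤ L * sizeForm P W := by
    rw [mul_comm]
    exact mul_le_mul hbL (le_sizeForm P W) hW hL.le
  have main := variation_real_bound (N := n) (t := t) (H := H) (r := ‖x‖) (η := cutoff h ‖x‖)
    (k := h ‖x‖) (a := t * cutoff h ‖x‖) (τ := t * (h ‖x‖ * ‖x‖)) (E := eForm g x P W)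
    (E' := eForm g (radialMap h t x) P W) (w := W * sqrtDet g x)
    (X := sqrtDet g x * rdot R Y)
    (Z := sqrtDet g x / 2 * ((∑ i, ∑ j, (g x)⁻¹ i j * (dir x i * dir x j)) * ‖Y‖ ^ 2))
    (S := sizeForm P W) (j := radialJac h t x - 1 - t * (n * cutoff h ‖x‖ - h ‖x‖ * ‖x‖))
    (M := L ^ 2 + L) (L := L) (A := sqrtDet g x * ‖R‖ ^ 2) (C := varConst n lam L β)
    (K₂ := K₂) (Kx := n * L ^ 2) (Kz := n ^ 2 * L ^ 2) (κ := 2 * n / (lam * β) + 1 / β)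
    (Kr := n ^ 2 * L ^ 3) ht htH hH (Nat.cast_nonneg n) (norm_nonneg _) hx1
    (hh.cutoff_nonneg _) (hh.cutoff_le (norm_nonneg _)) (hh.nonneg _) (hh.le _) rfl rfl hS
    (by positivity) hL.le (hg.abs_eForm_le hL hx P hW) hEE (mul_nonneg hW hb0) hw hX
    (by positivity) hZ (by positivity) (hJ t ht htH x hx) hXA (hg.sizeForm_le hlam hβ hx P hW)
    (by unfold varConst; linarith) (by positivity) (by positivity)
  refine le_trans (le_of_eq ?_) (main.trans (le_of_eq ?_))
  · rw [quad_perturb (hg.symm x hx)]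
    simp only [eForm, ← hR]
    ring
  · rw [varForm, ← hR]

end GoodMetric

lemma exists_abs_sub_le_on_unit {f : ℝ → ℝ} (hf : Continuous f) {δ : ℝ} (hδ : 0 < δ) :
    ∃ τ : ℝ, 0 < τ ∧ ∀ r s : ℝ, r ∈ Set.Icc (0 : ℝ) 1 → s ∈ Set.Icc (0 : ℝ) 1 → |r - s| ≤ τ →
      |f r - f s| ≤ δ := by
  have h1 := (isCompact_Icc (a := (0 : ℝ)) (b := 1)).uniformContinuousOn_of_continuous
    hf.continuousOn
  obtain ⟨τ, hτ, h2⟩ := Metric.uniformContinuousOn_iff.1 h1 δ hδ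
  refine ⟨τ / 2, by positivity, fun r s hr hs hrs => ?_⟩
  exact (h2 r hr s hs (by rw [Real.dist_eq]; linarith)).le

lemma dir_radialMap {n : ℕ} {h : ℝ → ℝ} {σ ρ H : ℝ} (hh : IsProfile h σ ρ H) {t : ℝ} (ht : 0 ≤ t)
    (x : Euc n) : dir (radialMap h t x) = dir x := by
  have hc : 0 < 1 + t * cutoff h ‖x‖ := by
    have := mul_nonneg ht (hh.cutoff_nonneg ‖x‖); linarith
  funext i
  rw [dir, dir, hh.norm_radialMap ht]
  simp only [radialMap, PiLp.smul_apply, smul_eq_mul]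
  rw [mul_div_mul_left _ _ hc.ne']

lemma abs_three_products_le {a₁ a₂ a₃ q₁ q₂ q₃ b₁ b₂ b₃ p₁ p₂ p₃ ω A K e S : ℝ}
    (ha₁ : |a₁ - b₁| ≤ ω) (ha₂ : |a₂ - b₂| ≤ ω) (ha₃ : |a₃ - b₃| ≤ ω)
    (hb₁ : |b₁| ≤ A) (hb₂ : |b₂| ≤ A) (hb₃ : |b₃| ≤ A)
    (hq₁ : |q₁| ≤ K * S) (hq₂ : |q₂| ≤ K * S) (hq₃ : |q₃| ≤ K * S)
    (hp₁ : |q₁ - p₁| ≤ e * S) (hp₂ : |q₂ - p₂| ≤ e * S) (hp₃ : |q₃ - p₃| ≤ e * S)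
    (hω : 0 ≤ ω) (hA : 0 ≤ A) :
    |(a₁ * q₁ + a₂ * q₂ + a₃ * q₃) - (b₁ * p₁ + b₂ * p₂ + b₃ * p₃)| ≤
      3 * (ω * K + A * e) * S := by
  have key : ∀ {a b q p : ℝ}, |a - b| ≤ ω → |b| ≤ A → |q| ≤ K * S → |q - p| ≤ e * S →
      |a * q - b * p| ≤ ω * (K * S) + A * (e * S) := by
    intro a b q p h1 h2 h3 h4
    have : a * q - b * p = (a - b) * q + b * (q - p) := by ring
    rw [this]
    refine (abs_add_le _ _).trans ?_
    rw [abs_mul, abs_mul]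
    exact add_le_add (mul_le_mul h1 h3 (abs_nonneg _) hω) (mul_le_mul h2 h4 (abs_nonneg _) hA)
  have e1 : (a₁ * q₁ + a₂ * q₂ + a₃ * q₃) - (b₁ * p₁ + b₂ * p₂ + b₃ * p₃) =
      (a₁ * q₁ - b₁ * p₁) + (a₂ * q₂ - b₂ * p₂) + (a₃ * q₃ - b₃ * p₃) := by ring
  rw [e1]
  refine (abs_add_three _ _ _).trans ?_
  have := key ha₁ hb₁ hq₁ hp₁
  have := key ha₂ hb₂ hq₂ hp₂
  have := key ha₃ hb₃ hq₃ hp₃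
  linarith

lemma varForm_eq {n : ℕ} (g : Euc n → Matrix (Fin n) (Fin n) ℝ) (C : ℝ) (h : ℝ → ℝ) (x : Euc n)
    (P : Fin n → ℂ) (W : ℝ) :
    varForm g C h x P W =
      -cutoff h ‖x‖ * (((n : ℝ) - 2) * eForm g x P W + 2 * (W * sqrtDet g x)) +
      (C * (cutoff h ‖x‖ * ‖x‖) + C * (h ‖x‖ * ‖x‖ ^ 2)) * eForm g x P W +
      h ‖x‖ * ‖x‖ * (eForm g x P W - sqrtDet g x * ‖contr (g x)⁻¹ (dir x) P‖ ^ 2) := by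
  unfold varForm; ring

namespace GoodMetric

variable {n : ℕ} {g : Euc n → Matrix (Fin n) (Fin n) ℝ} {lam L β : ℝ}
  (hg : GoodMetric n g lam L β)
include hg

lemma det_mul_contr_le (hL : 0 < L) {x : Euc n} (hx : x ∈ ball (0 : Euc n) 1) {y : Fin n → ℝ}
    (hy : ∀ i, |y i| ≤ 1) (P : Fin n → ℂ) {W : ℝ} (hW : 0 ≤ W) :
    |sqrtDet g x * ‖contr (g x)⁻¹ y P‖ ^ 2| ≤ n ^ 2 * L ^ 3 * sizeForm P W := by
  have hb0 : 0 ≤ sqrtDet g x := Real.sqrt_nonneg _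
  rw [abs_of_nonneg (by positivity)]
  have h1 := pow_le_pow_left₀ (norm_nonneg _) (norm_contr_le (hg.inv_le x hx) hy P) 2
  calc _ ≤ L * (n * L * ∑ i, ‖P i‖) ^ 2 :=
        mul_le_mul (hg.det_le x hx) h1 (sq_nonneg _) hL.le
    _ = n ^ 2 * L ^ 3 * (∑ i, ‖P i‖) ^ 2 := by ring
    _ ≤ _ := mul_le_mul_of_nonneg_left (sum_norm_sq_le_sizeForm P hW) (by positivity)

lemma det_mul_contr_sub_le (hL : 0 < L) {x x' : Euc n} (hx : x ∈ ball (0 : Euc n) 1)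
    (hx' : x' ∈ ball (0 : Euc n) 1) {y : Fin n → ℝ}
    (hy : ∀ i, |y i| ≤ 1) (P : Fin n → ℂ) {W : ℝ} (hW : 0 ≤ W) :
    |sqrtDet g x * ‖contr (g x)⁻¹ y P‖ ^ 2 - sqrtDet g x' * ‖contr (g x')⁻¹ y P‖ ^ 2| ≤
      3 * (n ^ 2 * L ^ 3) * ‖x - x'‖ * sizeForm P W := by
  have hb0 : 0 ≤ sqrtDet g x' := Real.sqrt_nonneg _
  have hbL := hg.det_le x' hx'
  set d := ‖x - x'‖ with hd
  set p := ∑ i, ‖P i‖ with hp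
  have hp0 : 0 ≤ p := Finset.sum_nonneg fun i _ => norm_nonneg _
  have hR := norm_contr_le (hg.inv_le x hx) hy P
  have hR' := norm_contr_le (hg.inv_le x' hx') hy P
  have hRR : ‖contr (g x)⁻¹ y P - contr (g x')⁻¹ y P‖ ≤ n * (L * d) * p := by
    rw [contr_sub]
    exact norm_contr_le (fun i j => hg.inv_lip x hx x' hx' i j) hy P
  have hRd := (abs_norm_sub_norm_le _ _).trans hRR
  set R := ‖contr (g x)⁻¹ y P‖ with hRdef
  set R' := ‖contr (g x')⁻¹ y P‖ with hRdef'
  have hR0 : 0 ≤ R := norm_nonneg _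
  have hR0' : 0 ≤ R' := norm_nonneg _
  have e : sqrtDet g x * R ^ 2 - sqrtDet g x' * R' ^ 2 =
      (sqrtDet g x - sqrtDet g x') * R ^ 2 + sqrtDet g x' * ((R - R') * (R + R')) := by ring
  have h1 : |(sqrtDet g x - sqrtDet g x') * R ^ 2| ≤ L * d * (n * L * p) ^ 2 := by
    rw [abs_mul, abs_of_nonneg (sq_nonneg R)]
    exact mul_le_mul (hg.det_lip x hx x' hx') (pow_le_pow_left₀ hR0 hR 2) (sq_nonneg _)
      (mul_nonneg hL.le (norm_nonneg _))
  have h2 : |sqrtDet g x' * ((R - R') * (R + R'))| ≤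
      L * ((n * (L * d) * p) * (2 * (n * L * p))) := by
    rw [abs_mul, abs_mul, abs_of_nonneg hb0, abs_of_nonneg (add_nonneg hR0 hR0')]
    have hd0 : 0 ≤ d := norm_nonneg _
    exact mul_le_mul hbL (mul_le_mul hRd (by linarith) (by positivity) (by positivity))
      (by positivity) hL.le
  rw [e]
  refine (abs_add_le _ _).trans ((add_le_add h1 h2).trans ?_)
  calc _ = 3 * (n ^ 2 * L ^ 3) * d * p ^ 2 := by ring
    _ ≤ _ := mul_le_mul_of_nonneg_left (sum_norm_sq_le_sizeForm P hW)
        (mul_nonneg (by positivity) (norm_nonneg _))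

/-- Uniform continuity of the first variation form along the radial deformation. -/
lemma varForm_radialMap_sub_le (hL : 0 < L) (C : ℝ) {h : ℝ → ℝ} {σ ρ H : ℝ}
    (hh : IsProfile h σ ρ H) {δ : ℝ} (hδ : 0 < δ) :
    ∃ t₀ : ℝ, 0 < t₀ ∧ t₀ * H ≤ 1 / 2 ∧ ∀ t : ℝ, 0 ≤ t → t ≤ t₀ → ∀ x ∈ ball (0 : Euc n) 1,
      ∀ (P : Fin n → ℂ) (W : ℝ), 0 ≤ W →
      |varForm g C h x P W - varForm g C h (radialMap h t x) P W| ≤ δ * sizeForm P W := by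
  have hH := hh.H_pos
  have hcut := hh.continuous_cutoff
  have hcont := hh.cont
  set A : ℝ := H + |C| * H + |C| * H with hA
  have hA0 : 0 < A := by have := abs_nonneg C; positivity
  set K : ℝ := |(n : ℝ) - 2| * (L ^ 2 + L) + 2 * L + (L ^ 2 + L) + 3 * (n ^ 2 * L ^ 3) with hK
  have hK0 : 0 < K := by have := abs_nonneg ((n : ℝ) - 2); positivity
  set ω : ℝ := δ / (6 * K) with hω
  have hω0 : 0 < ω := by positivity
  obtain ⟨τ₁, hτ₁, c1⟩ := exists_abs_sub_le_on_unit (f := fun r => -cutoff h r) (by fun_prop) hω0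
  obtain ⟨τ₂, hτ₂, c2⟩ := exists_abs_sub_le_on_unit
    (f := fun r => C * (cutoff h r * r) + C * (h r * r ^ 2)) (by fun_prop) hω0
  obtain ⟨τ₃, hτ₃, c3⟩ := exists_abs_sub_le_on_unit (f := fun r => h r * r) (by fun_prop) hω0
  set τ := min (min (min τ₁ τ₂) τ₃) (min (1 / 2) (δ / (6 * A * K))) with hτ
  have hτ0 : 0 < τ := by
    simp only [hτ, lt_min_iff]
    exact ⟨⟨⟨hτ₁, hτ₂⟩, hτ₃⟩, by norm_num, by positivity⟩
  refine ⟨τ / H, by positivity, ?_, fun t ht htt x hx P W hW => ?_⟩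
  · rw [div_mul_cancel₀ _ hH.ne']
    exact (min_le_right _ _).trans (min_le_left _ _)
  have htH : t * H ≤ τ := by rwa [le_div_iff₀ hH] at htt
  have hτ' : τ ≤ 1 / 2 := (min_le_right _ _).trans (min_le_left _ _)
  have hφ := hh.radialMap_mem_ball ht (by linarith : t * H < 1) hx
  have hS := sizeForm_nonneg P hW
  set x' := radialMap h t x with hx'
  have hr := mem_ball_zero_iff.1 hx
  have hr' := mem_ball_zero_iff.1 hφ
  have hd : ‖x - x'‖ ≤ τ := by
    rw [norm_sub_rev, hh.norm_radialMap_sub ht]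
    have h1 := mul_le_mul_of_nonneg_left (hh.cutoff_le (norm_nonneg x)) ht
    have h2 := mul_nonneg ht (hh.cutoff_nonneg ‖x‖)
    exact (mul_le_of_le_one_right h2 hr.le).trans (h1.trans htH)
  have hrr : |‖x‖ - ‖x'‖| ≤ τ := (abs_norm_sub_norm_le _ _).trans hd
  have hm : ‖x‖ ∈ Set.Icc (0 : ℝ) 1 := ⟨norm_nonneg _, hr.le⟩
  have hm' : ‖x'‖ ∈ Set.Icc (0 : ℝ) 1 := ⟨norm_nonneg _, hr'.le⟩
  have d1 := c1 _ _ hm hm' (hrr.trans ((min_le_left _ _).trans ((min_le_left _ _).trans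
    (min_le_left _ _))))
  have d2 := c2 _ _ hm hm' (hrr.trans ((min_le_left _ _).trans ((min_le_left _ _).trans
    (min_le_right _ _))))
  have d3 := c3 _ _ hm hm' (hrr.trans ((min_le_left _ _).trans (min_le_right _ _)))
  have hη0 := hh.cutoff_nonneg ‖x'‖
  have hη := hh.cutoff_le (norm_nonneg x')
  have hk0 := hh.nonneg ‖x'‖
  have hk := hh.le ‖x'‖
  have f1 : |-cutoff h ‖x'‖| ≤ A := by
    rw [abs_neg, abs_of_nonneg hη0]
    have := mul_nonneg (abs_nonneg C) hH.le
    linarith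
  have f3 : |h ‖x'‖ * ‖x'‖| ≤ A := by
    rw [abs_of_nonneg (mul_nonneg hk0 (norm_nonneg _))]
    have := mul_nonneg (abs_nonneg C) hH.le
    exact (mul_le_of_le_one_right hk0 hr'.le).trans (by linarith)
  have f2 : |C * (cutoff h ‖x'‖ * ‖x'‖) + C * (h ‖x'‖ * ‖x'‖ ^ 2)| ≤ A := by
    refine (abs_add_le _ _).trans ?_
    rw [abs_mul C, abs_mul C, abs_of_nonneg (mul_nonneg hη0 (norm_nonneg _)),
      abs_of_nonneg (mul_nonneg hk0 (sq_nonneg _))]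
    have e1 := mul_le_mul_of_nonneg_left
      ((mul_le_of_le_one_right hη0 hr'.le).trans hη) (abs_nonneg C)
    have e2 := mul_le_mul_of_nonneg_left
      ((mul_le_of_le_one_right hk0 (pow_le_one₀ (norm_nonneg _) hr'.le : ‖x'‖ ^ 2 ≤ 1)).trans hk)
      (abs_nonneg C)
    linarith
  have E1 := hg.abs_eForm_le hL hx P hW
  have E2 := hg.abs_eForm_sub_le hL hx hφ P hW
  have R1 := hg.det_mul_contr_le hL hx (abs_dir_le x) P hW
  have R2 := hg.det_mul_contr_sub_le hL hx hφ (abs_dir_le x) P hW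
  have hb0 : 0 ≤ sqrtDet g x := Real.sqrt_nonneg _
  have W1 : |W * sqrtDet g x| ≤ L * sizeForm P W := by
    rw [abs_of_nonneg (mul_nonneg hW hb0), mul_comm]
    exact mul_le_mul (hg.det_le x hx) (le_sizeForm P W) hW hL.le
  have W2 : |W * sqrtDet g x - W * sqrtDet g x'| ≤ L * ‖x - x'‖ * sizeForm P W := by
    rw [← mul_sub, abs_mul, abs_of_nonneg hW, mul_comm]
    exact mul_le_mul (hg.det_lip x hx x' hφ) (le_sizeForm P W) hW
      (mul_nonneg hL.le (norm_nonneg _))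
  rw [varForm_eq, varForm_eq, hx', dir_radialMap hh ht, ← hx']
  have hn2 := abs_nonneg ((n : ℝ) - 2)
  have hdn : 0 ≤ ‖x - x'‖ := norm_nonneg _
  refine (abs_three_products_le (ω := ω) (A := A) (K := K) (e := K * ‖x - x'‖)
    (S := sizeForm P W) d1 d2 d3 f1 f2 f3 ?_ ?_ ?_ ?_ ?_ ?_ hω0.le hA0.le).trans ?_
  · refine (abs_add_le _ _).trans ?_
    rw [abs_mul, abs_mul 2, abs_two]
    have z1 := mul_le_mul_of_nonneg_left E1 hn2
    have z2 : 0 ≤ ((L ^ 2 + L) + 3 * (n ^ 2 * L ^ 3)) * sizeForm P W := by positivity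
    rw [hK]; linarith
  · have z2 : 0 ≤ (|(n : ℝ) - 2| * (L ^ 2 + L) + 2 * L + 3 * (n ^ 2 * L ^ 3)) * sizeForm P W := by
      positivity
    rw [hK]; linarith
  · refine (abs_sub _ _).trans ?_
    have z2 : 0 ≤ (|(n : ℝ) - 2| * (L ^ 2 + L) + 2 * L + 2 * (n ^ 2 * L ^ 3)) * sizeForm P W := by
      positivity
    rw [hK]; linarith
  · have e : ((n : ℝ) - 2) * eForm g x P W + 2 * (W * sqrtDet g x) -
        (((n : ℝ) - 2) * eForm g x' P W + 2 * (W * sqrtDet g x')) =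
        ((n : ℝ) - 2) * (eForm g x P W - eForm g x' P W) +
          2 * (W * sqrtDet g x - W * sqrtDet g x') := by ring
    rw [e]
    refine (abs_add_le _ _).trans ?_
    rw [abs_mul, abs_mul 2, abs_two]
    have z1 := mul_le_mul_of_nonneg_left E2 hn2
    have z2 : 0 ≤ ((L ^ 2 + L) + 3 * (n ^ 2 * L ^ 3)) * ‖x - x'‖ * sizeForm P W := by positivity
    rw [hK]; linarith
  · have z2 : 0 ≤ (|(n : ℝ) - 2| * (L ^ 2 + L) + 2 * L + 3 * (n ^ 2 * L ^ 3)) * ‖x - x'‖ *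
        sizeForm P W := by positivity
    rw [hK]; linarith
  · rw [sub_sub_sub_comm]
    refine (abs_sub _ _).trans ?_
    have z2 : 0 ≤ (|(n : ℝ) - 2| * (L ^ 2 + L) + 2 * L) * ‖x - x'‖ * sizeForm P W := by
      positivity
    rw [hK]; linarith
  · refine mul_le_mul_of_nonneg_right ?_ hS
    have hτA : τ ≤ δ / (6 * A * K) := (min_le_right _ _).trans (min_le_right _ _)
    have z1 : A * (K * ‖x - x'‖) ≤ δ / 6 := by
      calc A * (K * ‖x - x'‖) ≤ A * (K * (δ / (6 * A * K))) := by
            have := hd.trans hτA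
            gcongr
        _ = δ / 6 := by field_simp
    have z2 : ω * K = δ / 6 := by rw [hω]; field_simp
    linarith

lemma abs_varForm_le (hL : 0 < L) (C : ℝ) {H : ℝ} (hH : 0 < H) :
    ∃ K : ℝ, 0 ≤ K ∧ ∀ {h : ℝ → ℝ} {σ ρ : ℝ}, IsProfile h σ ρ H → ∀ x ∈ ball (0 : Euc n) 1,
      ∀ (P : Fin n → ℂ) (W : ℝ), 0 ≤ W → |varForm g C h x P W| ≤ K * sizeForm P W := by
  have hn2 := abs_nonneg ((n : ℝ) - 2)
  have hC := abs_nonneg C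
  refine ⟨H * (|(n : ℝ) - 2| * (L ^ 2 + L) + 2 * L) + |C| * H * (L ^ 2 + L) +
    H * ((1 + |C|) * (L ^ 2 + L) + n ^ 2 * L ^ 3), by positivity, fun {h σ ρ} hh x hx P W hW => ?_⟩
  have hr := mem_ball_zero_iff.1 hx
  have hS := sizeForm_nonneg P hW
  have hη0 := hh.cutoff_nonneg ‖x‖
  have hη := hh.cutoff_le (norm_nonneg x)
  have hk0 := hh.nonneg ‖x‖
  have hk := hh.le ‖x‖
  have E1 := hg.abs_eForm_le hL hx P hW
  have R1 := hg.det_mul_contr_le hL hx (abs_dir_le x) P hW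
  have hb0 : 0 ≤ sqrtDet g x := Real.sqrt_nonneg _
  have W1 : |W * sqrtDet g x| ≤ L * sizeForm P W := by
    rw [abs_of_nonneg (mul_nonneg hW hb0), mul_comm]
    exact mul_le_mul (hg.det_le x hx) (le_sizeForm P W) hW hL.le
  have a1 : |((n : ℝ) - 2) * eForm g x P W + 2 * (W * sqrtDet g x)| ≤
      (|(n : ℝ) - 2| * (L ^ 2 + L) + 2 * L) * sizeForm P W := by
    refine (abs_add_le _ _).trans ?_
    rw [abs_mul, abs_mul 2, abs_two]
    have z1 := mul_le_mul_of_nonneg_left E1 hn2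
    linarith
  have a2 : |(1 + C * ‖x‖) * eForm g x P W - sqrtDet g x * ‖contr (g x)⁻¹ (dir x) P‖ ^ 2| ≤
      ((1 + |C|) * (L ^ 2 + L) + n ^ 2 * L ^ 3) * sizeForm P W := by
    refine (abs_sub _ _).trans ?_
    have z1 : |1 + C * ‖x‖| ≤ 1 + |C| := by
      refine (abs_add_le _ _).trans ?_
      rw [abs_one, abs_mul, abs_norm]
      have := mul_le_of_le_one_right hC hr.le
      linarith
    rw [abs_mul]
    have := mul_le_mul z1 E1 (abs_nonneg _) (by positivity)
    linarith
  rw [varForm]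
  refine (abs_add_three _ _ _).trans ?_
  rw [abs_mul, abs_mul (C * (cutoff h ‖x‖ * ‖x‖)), abs_mul (h ‖x‖ * ‖x‖), abs_mul C, abs_neg,
    abs_of_nonneg hη0, abs_of_nonneg (mul_nonneg hη0 (norm_nonneg x)),
    abs_of_nonneg (mul_nonneg hk0 (norm_nonneg x))]
  have b1 := mul_le_mul hη a1 (abs_nonneg _) hH.le
  have b2 := mul_le_mul (mul_le_mul_of_nonneg_left
    ((mul_le_of_le_one_right hη0 hr.le).trans hη) hC) E1 (abs_nonneg _) (by positivity)
  have b3 := mul_le_mul ((mul_le_of_le_one_right hk0 hr.le).trans hk) a2 (abs_nonneg _) hH.le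
  linarith

/-- The energy of a radially deformed map, compared pointwise with the transported energy. -/
lemma variation_le_transported (hlam : 0 < lam) (hL : 0 < L) (hβ : 0 < β) (hn : 1 ≤ n)
    {h : ℝ → ℝ} {σ ρ H : ℝ} (hh : IsProfile h σ ρ H) {δ : ℝ} (hδ : 0 < δ) :
    ∃ t₀ : ℝ, 0 < t₀ ∧ t₀ * H ≤ 1 / 2 ∧ ∀ t : ℝ, 0 ≤ t → t ≤ t₀ → ∀ x ∈ ball (0 : Euc n) 1,
      ∀ (P : Fin n → ℂ) (W : ℝ), 0 ≤ W →
      (quad (g x)⁻¹ (fun i => ((1 + t * cutoff h ‖x‖ : ℝ) : ℂ) * P i -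
        ((t * (h ‖x‖ * ‖x‖) * dir x i : ℝ) : ℂ) * contr 1 (dir x) P) / 2 + W) * sqrtDet g x ≤
      (eForm g (radialMap h t x) P W +
        t * (varForm g (varConst n lam L β) h (radialMap h t x) P W + δ * sizeForm P W)) *
        radialJac h t x := by
  have hH := hh.H_pos
  obtain ⟨K, hK, h1⟩ := hg.variation_le_varForm hlam hL hβ hn hh
  obtain ⟨t₁, ht₁, htH₁, h2⟩ := hg.varForm_radialMap_sub_le hL (varConst n lam L β) hh
    (by positivity : 0 < δ / 4)
  obtain ⟨K₂, hK₂, hJ⟩ := hh.exists_abs_radialJac_sub_le hn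
  obtain ⟨Kv, hKv, hv⟩ := hg.abs_varForm_le hL (varConst n lam L β) hH
  set K' : ℝ := (n + 1) * H + K₂ / (2 * H) with hK'
  have hK'0 : 0 ≤ K' := by positivity
  set D : ℝ := K + Kv * K' + 1 with hD
  have hD0 : 0 < D := by positivity
  refine ⟨min t₁ (δ / (4 * D)), lt_min ht₁ (by positivity),
    (mul_le_mul_of_nonneg_right (min_le_left _ _) hH.le).trans htH₁,
    fun t ht htt x hx P W hW => ?_⟩
  have htt1 := htt.trans (min_le_left _ _)
  have htH : t * H ≤ 1 / 2 := (mul_le_mul_of_nonneg_right htt1 hH.le).trans htH₁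
  have htD : t * D ≤ δ / 4 := by
    have := htt.trans (min_le_right _ _)
    rw [le_div_iff₀ (by positivity)] at this
    linarith
  have hS := sizeForm_nonneg P hW
  have hφ := hh.radialMap_mem_ball ht (by linarith : t * H < 1) hx
  have i1 := h1 t ht htH x hx P W hW
  have i2 := h2 t ht htt1 x hx P W hW
  have i3 := hJ t ht htH x hx
  have i4 := hv hh _ hφ P W hW
  have i5 := hh.half_le_radialJac ht htH hx
  have hη0 := hh.cutoff_nonneg ‖x‖
  have hη := hh.cutoff_le (norm_nonneg x)
  have hr := mem_ball_zero_iff.1 hx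
  have hk0 := mul_nonneg (hh.nonneg ‖x‖) (norm_nonneg x)
  have hk : h ‖x‖ * ‖x‖ ≤ H := (mul_le_of_le_one_right (hh.nonneg _) hr.le).trans (hh.le _)
  set J := radialJac h t x
  set q := varForm g (varConst n lam L β) h x P W
  set q' := varForm g (varConst n lam L β) h (radialMap h t x) P W
  set S := sizeForm P W
  have hJ1 : |J - 1| ≤ K' * t := by
    have z1 : |t * (n * cutoff h ‖x‖ - h ‖x‖ * ‖x‖)| ≤ t * ((n + 1) * H) := by
      rw [abs_mul, abs_of_nonneg ht]
      refine mul_le_mul_of_nonneg_left ?_ ht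
      have hn0 := Nat.cast_nonneg (α := ℝ) n
      rw [abs_le]
      constructor <;> nlinarith [mul_nonneg hn0 hη0, mul_le_mul_of_nonneg_left hη hn0]
    have z2 : K₂ * t ^ 2 ≤ K₂ / (2 * H) * t := by
      have : t ≤ 1 / (2 * H) := by rw [le_div_iff₀ (by positivity)]; linarith
      calc K₂ * t ^ 2 = K₂ * t * t := by ring
        _ ≤ K₂ * (1 / (2 * H)) * t := by gcongr
        _ = _ := by ring
    have e : J - 1 = (J - 1 - t * (n * cutoff h ‖x‖ - h ‖x‖ * ‖x‖)) +
        t * (n * cutoff h ‖x‖ - h ‖x‖ * ‖x‖) := by ring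
    rw [e]
    refine (abs_add_le _ _).trans ?_
    rw [hK']; linarith
  have hq : q ≤ q' + δ / 4 * S := by linarith [le_abs_self (q - q')]
  have hqJ : q' * (1 - J) ≤ Kv * S * (K' * t) := by
    refine (le_abs_self _).trans ?_
    rw [abs_mul, abs_sub_comm 1 J]
    exact mul_le_mul i4 hJ1 (abs_nonneg _) (by positivity)
  have hmain : q + K * t * S ≤ (q' + δ * S) * J := by
    have z1 : t * D * S ≤ δ / 4 * S := mul_le_mul_of_nonneg_right htD hS
    have z2 : δ * S * (1 / 2) ≤ δ * S * J := mul_le_mul_of_nonneg_left i5 (by positivity)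
    have z3 : t * D * S = K * t * S + Kv * S * (K' * t) + t * S := by rw [hD]; ring
    have z4 := mul_nonneg ht hS
    linarith
  have := mul_le_mul_of_nonneg_left hmain ht
  calc _ ≤ eForm g (radialMap h t x) P W * J + (t * q + K * t ^ 2 * S) := by linarith
    _ = eForm g (radialMap h t x) P W * J + t * (q + K * t * S) := by ring
    _ ≤ _ := by linarith

end GoodMetric

section

open Filter Topology

/-- The Ginzburg–Landau potential density. -/
def pot {n : ℕ} (ε : ℝ) (u : Euc n → ℂ) (x : Euc n) : ℝ := (1 - ‖u x‖ ^ 2) ^ 2 / (4 * ε ^ 2)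

lemma pot_nonneg {n : ℕ} (ε : ℝ) (u : Euc n → ℂ) (x : Euc n) : 0 ≤ pot ε u x := by
  unfold pot; positivity

lemma eDen_mul_sqrtDet {n : ℕ} (g : Euc n → Matrix (Fin n) (Fin n) ℝ) (ε : ℝ) (u : Euc n → ℂ)
    (x : Euc n) : eDen g ε u x * sqrtDet g x = eForm g x (fun i => pd u i x) (pot ε u x) := rfl

lemma radD_eq_contr {n : ℕ} (g : Euc n → Matrix (Fin n) (Fin n) ℝ) (u : Euc n → ℂ) (x : Euc n) :
    radD g u x = contr (g x)⁻¹ (dir x) (fun i => pd u i x) := rfl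

lemma fderiv_apply_eq_sum {n : ℕ} (u : Euc n → ℂ) (x v : Euc n) :
    fderiv ℝ u x v = ∑ i, (v i : ℂ) * pd u i x := by
  conv_lhs => rw [← (EuclideanSpace.basisFun (Fin n) ℝ).sum_repr v, map_sum]
  refine Finset.sum_congr rfl fun i _ => ?_
  rw [map_smul, Complex.real_smul]
  simp [pd]

lemma norm_fderiv_le {n : ℕ} (u : Euc n → ℂ) (x : Euc n) :
    ‖fderiv ℝ u x‖ ≤ ∑ i, ‖pd u i x‖ := by
  refine ContinuousLinearMap.opNorm_le_bound _ (Finset.sum_nonneg fun i _ => norm_nonneg _)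
    fun v => ?_
  rw [fderiv_apply_eq_sum, Finset.sum_mul]
  refine (norm_sum_le _ _).trans (Finset.sum_le_sum fun i _ => ?_)
  rw [norm_mul, Complex.norm_real, mul_comm]
  exact mul_le_mul_of_nonneg_left (PiLp.norm_apply_le v i) (norm_nonneg _)

lemma measurable_pd {n : ℕ} (u : Euc n → ℂ) (i : Fin n) : Measurable (pd u i) :=
  measurable_fderiv_apply_const ℝ u _

lemma pd_comp_radialMap {n : ℕ} {h : ℝ → ℝ} {σ ρ H : ℝ} (hh : IsProfile h σ ρ H) {u : Euc n → ℂ}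
    (hu : DifferentiableOn ℝ u (ball 0 1)) {t : ℝ} (ht : 0 ≤ t) (htH : t * H < 1) {x : Euc n}
    (hx : x ∈ ball (0 : Euc n) 1) (i : Fin n) :
    HasFDerivAt (fun x => u (radialMap h t x)) ((fderiv ℝ u (radialMap h t x)).comp
      ((1 + t * cutoff h ‖x‖) • ContinuousLinearMap.id ℝ (Euc n) +
        (-(t * (h ‖x‖ / ‖x‖)) • innerSL ℝ x).smulRight x)) x ∧
    pd (fun x => u (radialMap h t x)) i x =
      ((1 + t * cutoff h ‖x‖ : ℝ) : ℂ) * pd u i (radialMap h t x) -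
        ((t * (h ‖x‖ * ‖x‖) * dir x i : ℝ) : ℂ) *
          contr 1 (dir x) (fun j => pd u j (radialMap h t x)) := by
  have hφ := hh.radialMap_mem_ball ht htH hx
  have h1 := ((hu.differentiableAt (isOpen_ball.mem_nhds hφ)).hasFDerivAt).comp x
    (hh.hasFDerivAt_radialMap t x)
  refine ⟨h1, ?_⟩
  have h2 : fderiv ℝ (fun x => u (radialMap h t x)) x = _ := h1.fderiv
  rw [pd, h2]
  simp only [ContinuousLinearMap.comp_apply, add_apply,
    smul_apply, ContinuousLinearMap.id_apply, map_add, map_smul,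
    ContinuousLinearMap.smulRight_apply, innerSL_apply_apply, EuclideanSpace.inner_single_right,
    Complex.real_smul]
  rw [fderiv_apply_eq_sum u _ x, contr_one, sub_eq_add_neg, ← neg_mul]
  congr 1
  have hs : ∑ j, (dir x j : ℂ) * pd u j (radialMap h t x) =
      (‖x‖ : ℂ)⁻¹ * ∑ j, (x j : ℂ) * pd u j (radialMap h t x) := by
    rw [Finset.mul_sum]
    refine Finset.sum_congr rfl fun j _ => ?_
    simp only [dir]
    push_cast
    ring
  rw [hs]
  by_cases hr : ‖x‖ = 0
  · simp [hr]
  · have hr' : (‖x‖ : ℂ) ≠ 0 := by exact_mod_cast hr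
    simp only [dir, conj_trivial, one_mul, smul_eq_mul]
    push_cast
    field_simp

namespace GoodMetric

variable {n : ℕ} {g : Euc n → Matrix (Fin n) (Fin n) ℝ} {lam L β : ℝ}
  (hg : GoodMetric n g lam L β)
include hg

lemma aemeasurable_inv (i j : Fin n) :
    AEMeasurable (fun x => (g x)⁻¹ i j) (volume.restrict (ball (0 : Euc n) 1)) := by
  refine ContinuousOn.aemeasurable (fun x hx => ?_) measurableSet_ball
  refine (LipschitzOnWith.of_dist_le_mul (K := L.toNNReal) fun x hx y hy => ?_).continuousOn x hx
  rw [Real.dist_eq, dist_eq_norm]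
  exact (hg.inv_lip x hx y hy i j).trans (mul_le_mul_of_nonneg_right (Real.le_coe_toNNReal L)
    (norm_nonneg _))

lemma aemeasurable_sqrtDet :
    AEMeasurable (sqrtDet g) (volume.restrict (ball (0 : Euc n) 1)) := by
  refine ContinuousOn.aemeasurable (fun x hx => ?_) measurableSet_ball
  refine (LipschitzOnWith.of_dist_le_mul (K := L.toNNReal) fun x hx y hy => ?_).continuousOn x hx
  rw [Real.dist_eq, dist_eq_norm]
  exact (hg.det_lip x hx y hy).trans (mul_le_mul_of_nonneg_right (Real.le_coe_toNNReal L)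
    (norm_nonneg _))

lemma aemeasurable_quad {P : Fin n → Euc n → ℂ}
    (hP : ∀ i, AEMeasurable (P i) (volume.restrict (ball (0 : Euc n) 1))) :
    AEMeasurable (fun x => quad (g x)⁻¹ (fun i => P i x))
      (volume.restrict (ball (0 : Euc n) 1)) := by
  unfold quad rdot
  have := hg.aemeasurable_inv
  refine Finset.aemeasurable_fun_sum _ fun i _ => Finset.aemeasurable_fun_sum _ fun j _ => ?_
  have h1 := hP i
  have h2 := hP j
  have h3 := this i j
  have r := fun k => Complex.measurable_re.comp_aemeasurable (hP k)
  have m := fun k => Complex.measurable_im.comp_aemeasurable (hP k)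
  exact h3.mul (((r i).mul (r j)).add ((m i).mul (m j)))

lemma aemeasurable_eForm {P : Fin n → Euc n → ℂ} {W : Euc n → ℝ}
    (hP : ∀ i, AEMeasurable (P i) (volume.restrict (ball (0 : Euc n) 1)))
    (hW : AEMeasurable W (volume.restrict (ball (0 : Euc n) 1))) :
    AEMeasurable (fun x => eForm g x (fun i => P i x) (W x))
      (volume.restrict (ball (0 : Euc n) 1)) :=
  (((hg.aemeasurable_quad hP).div_const 2).add hW).mul hg.aemeasurable_sqrtDet

lemma aemeasurable_normSq_contr {P : Fin n → Euc n → ℂ}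
    (hP : ∀ i, AEMeasurable (P i) (volume.restrict (ball (0 : Euc n) 1))) :
    AEMeasurable (fun x => ‖contr (g x)⁻¹ (dir x) (fun i => P i x)‖ ^ 2)
      (volume.restrict (ball (0 : Euc n) 1)) := by
  refine (AEMeasurable.norm ?_).pow_const 2
  unfold contr dir
  refine Finset.aemeasurable_fun_sum _ fun i _ => Finset.aemeasurable_fun_sum _ fun j _ => ?_
  have h3 := hg.aemeasurable_inv i j
  have h4 : AEMeasurable (fun x : Euc n => x i / ‖x‖) (volume.restrict (ball (0 : Euc n) 1)) := by
    fun_prop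
  exact (Complex.measurable_ofReal.comp_aemeasurable (h3.mul h4)).mul (hP j)

lemma aemeasurable_varForm (C : ℝ) {h : ℝ → ℝ} {σ ρ H : ℝ} (hh : IsProfile h σ ρ H)
    {P : Fin n → Euc n → ℂ} {W : Euc n → ℝ}
    (hP : ∀ i, AEMeasurable (P i) (volume.restrict (ball (0 : Euc n) 1)))
    (hW : AEMeasurable W (volume.restrict (ball (0 : Euc n) 1))) :
    AEMeasurable (fun x => varForm g C h x (fun i => P i x) (W x))
      (volume.restrict (ball (0 : Euc n) 1)) := by
  have hE := hg.aemeasurable_eForm hP hW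
  have hc := hg.aemeasurable_normSq_contr hP
  have hb := hg.aemeasurable_sqrtDet
  have c1 := hh.cont
  have c2 := hh.continuous_cutoff
  have m1 : AEMeasurable (fun x : Euc n => h ‖x‖) (volume.restrict (ball (0 : Euc n) 1)) :=
    Continuous.aemeasurable (by fun_prop)
  have m2 : AEMeasurable (fun x : Euc n => cutoff h ‖x‖) (volume.restrict (ball (0 : Euc n) 1)) :=
    Continuous.aemeasurable (by fun_prop)
  have m3 : AEMeasurable (fun x : Euc n => ‖x‖) (volume.restrict (ball (0 : Euc n) 1)) :=
    Continuous.aemeasurable (by fun_prop)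
  exact (((m2.neg).mul ((hE.const_mul _).add ((hW.mul hb).const_mul 2))).add
    (((m2.mul m3).const_mul C).mul hE)).add
    ((m1.mul m3).mul ((((m3.const_mul C).const_add 1).mul hE).sub (hb.mul hc)))

lemma integrableOn_sizeForm (hlam : 0 < lam) (hβ : 0 < β)
    {P : Fin n → Euc n → ℂ} {W : Euc n → ℝ}
    (hP : ∀ i, AEMeasurable (P i) (volume.restrict (ball (0 : Euc n) 1)))
    (hW : AEMeasurable W (volume.restrict (ball (0 : Euc n) 1)))
    (hW0 : ∀ x, 0 ≤ W x)
    (hi : IntegrableOn (fun x => eForm g x (fun i => P i x) (W x)) (ball (0 : Euc n) 1)) :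
    IntegrableOn (fun x => sizeForm (fun i => P i x) (W x)) (ball (0 : Euc n) 1) := by
  refine (hi.const_mul (2 * n / (lam * β) + 1 / β)).mono' ?_ ?_
  · unfold sizeForm
    exact (((Finset.aemeasurable_fun_sum _ fun i _ => (hP i).norm).pow_const 2).add
      hW).aestronglyMeasurable
  · filter_upwards [ae_restrict_mem measurableSet_ball] with x hx
    rw [Real.norm_eq_abs, abs_of_nonneg (sizeForm_nonneg _ (hW0 x))]
    exact hg.sizeForm_le hlam hβ hx _ (hW0 x)

end GoodMetric

lemma memLp_of_integrableOn_sizeForm {n : ℕ} {P : Fin n → Euc n → ℂ} {W : Euc n → ℝ}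
    (hP : ∀ i, AEMeasurable (P i) (volume.restrict (ball (0 : Euc n) 1)))
    (hW0 : ∀ x, 0 ≤ W x)
    (hi : IntegrableOn (fun x => sizeForm (fun i => P i x) (W x)) (ball (0 : Euc n) 1)) (i : Fin n) :
    MemLp (P i) 2 (volume.restrict (ball (0 : Euc n) 1)) := by
  rw [memLp_two_iff_integrable_sq_norm (hP i).aestronglyMeasurable]
  refine hi.mono' ((hP i).norm.pow_const 2).aestronglyMeasurable (Eventually.of_forall fun x => ?_)
  rw [Real.norm_eq_abs, abs_of_nonneg (by positivity)]
  refine le_trans ?_ (sum_norm_sq_le_sizeForm _ (hW0 x))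
  exact pow_le_pow_left₀ (norm_nonneg _) (Finset.single_le_sum (f := fun i => ‖P i x‖)
    (fun j _ => norm_nonneg _) (Finset.mem_univ i)) 2

lemma lintegral_fderiv_lt_top {n : ℕ} {u : Euc n → ℂ} {W : Euc n → ℝ}
    (hW0 : ∀ x, 0 ≤ W x)
    (hi : IntegrableOn (fun x => sizeForm (fun i => pd u i x) (W x)) (ball (0 : Euc n) 1)) :
    ∫⁻ x in ball (0 : Euc n) 1, ‖fderiv ℝ u x‖ₑ ^ 2 < ⊤ := by
  refine lt_of_le_of_lt (lintegral_mono fun x => ?_) hi.lintegral_lt_top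
  rw [← ofReal_norm, ← ENNReal.ofReal_pow (norm_nonneg _)]
  refine ENNReal.ofReal_le_ofReal (le_trans ?_ (sum_norm_sq_le_sizeForm _ (hW0 x)))
  exact pow_le_pow_left₀ (norm_nonneg _) (norm_fderiv_le u x) 2

lemma potential_tangent_le {ε : ℝ} (hε : 0 < ε) (a b : ℂ) (ha : ‖a‖ ≤ 1) :
    -((1 - ‖a‖ ^ 2) / ε ^ 2 * rdot a (b - a)) ≤
      (1 - ‖b‖ ^ 2) ^ 2 / (4 * ε ^ 2) - (1 - ‖a‖ ^ 2) ^ 2 / (4 * ε ^ 2) +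
        1 / (2 * ε ^ 2) * ‖b - a‖ ^ 2 := by
  have h1 : ‖b‖ ^ 2 = ‖a‖ ^ 2 + 2 * rdot a (b - a) + ‖b - a‖ ^ 2 := by
    rw [← rdot_self, ← rdot_self, ← rdot_self]
    simp only [rdot, Complex.sub_re, Complex.sub_im]
    ring
  have ha' : ‖a‖ ^ 2 ≤ 1 := pow_le_one₀ (norm_nonneg _) ha
  have h2 : -((1 - ‖a‖ ^ 2) / ε ^ 2 * rdot a (b - a)) =
      (-(4 * (1 - ‖a‖ ^ 2) * rdot a (b - a))) / (4 * ε ^ 2) := by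
    field_simp
  have h3 : (1 - ‖b‖ ^ 2) ^ 2 / (4 * ε ^ 2) - (1 - ‖a‖ ^ 2) ^ 2 / (4 * ε ^ 2) +
        1 / (2 * ε ^ 2) * ‖b - a‖ ^ 2 =
      ((1 - ‖b‖ ^ 2) ^ 2 - (1 - ‖a‖ ^ 2) ^ 2 + 2 * ‖b - a‖ ^ 2) / (4 * ε ^ 2) := by
    field_simp
    ring
  rw [h2, h3]
  refine div_le_div_of_nonneg_right ?_ (by positivity)
  rw [h1]
  nlinarith [sq_nonneg (2 * rdot a (b - a) + ‖b - a‖ ^ 2),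
    mul_nonneg (sq_nonneg ‖a‖) (sq_nonneg ‖b - a‖)]

namespace GoodMetric

variable {n : ℕ} {g : Euc n → Matrix (Fin n) (Fin n) ℝ} {lam L β : ℝ}
  (hg : GoodMetric n g lam L β)
include hg

lemma quad_nonneg (hlam : 0 < lam) {x : Euc n} (hx : x ∈ ball (0 : Euc n) 1) (P : Fin n → ℂ) :
    0 ≤ quad (g x)⁻¹ P :=
  le_trans (mul_nonneg hlam.le (Finset.sum_nonneg fun i _ => by positivity))
    (hg.sum_norm_sq_le_quad hx P)

lemma eForm_nonneg (hlam : 0 < lam) {x : Euc n} (hx : x ∈ ball (0 : Euc n) 1) (P : Fin n → ℂ)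
    {W : ℝ} (hW : 0 ≤ W) : 0 ≤ eForm g x P W := by
  have := hg.quad_nonneg hlam hx P
  have : 0 ≤ sqrtDet g x := Real.sqrt_nonneg _
  unfold eForm
  positivity

lemma quad_tangent_le (hlam : 0 < lam) {x : Euc n} (hx : x ∈ ball (0 : Euc n) 1)
    (P Q : Fin n → ℂ) :
    2 * ∑ i, ∑ j, (g x)⁻¹ i j * rdot (P i) (Q j - P j) ≤ quad (g x)⁻¹ Q - quad (g x)⁻¹ P := by
  have h0 := hg.quad_nonneg hlam hx (fun i => Q i - P i)
  have h1 : ∑ i, ∑ j, (g x)⁻¹ i j * rdot (P i) (Q j - P j) =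
      ∑ i, ∑ j, (g x)⁻¹ i j * rdot (P j) (Q i - P i) := by
    rw [Finset.sum_comm]
    exact Finset.sum_congr rfl fun i _ => Finset.sum_congr rfl fun j _ => by
      rw [hg.symm x hx]
  have h2 : quad (g x)⁻¹ Q = quad (g x)⁻¹ P + quad (g x)⁻¹ (fun i => Q i - P i) +
      ∑ i, ∑ j, (g x)⁻¹ i j * rdot (P i) (Q j - P j) +
      ∑ i, ∑ j, (g x)⁻¹ i j * rdot (P j) (Q i - P i) := by
    simp only [quad, ← Finset.sum_add_distrib]
    refine Finset.sum_congr rfl fun i _ => Finset.sum_congr rfl fun j _ => ?_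
    simp only [rdot, Complex.sub_re, Complex.sub_im]
    ring
  linarith

/-- The weak Ginzburg–Landau equation tested with a differentiable compactly supported function
whose derivative is square integrable. -/
lemma weak_eq (hL : 0 < L) (hlam : 0 < lam) (hβ : 0 < β) {ε : ℝ} (hε : 0 < ε) {u : Euc n → ℂ}
    (hu : IsGLSol n g ε u) {ζ : Euc n → ℂ} (hζ : Differentiable ℝ ζ) {R : ℝ} (hR : R < 1)
    (hsupp : ∀ x, R < ‖x‖ → ζ x = 0) (hζ' : ∀ j, MemLp (fun x => pd ζ j x) 2 volume) :
    IntegrableOn (fun x => ((∑ i, ∑ j, (g x)⁻¹ i j * rdot (pd u i x) (pd ζ j x))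
        - (1 - ‖u x‖ ^ 2) / ε ^ 2 * rdot (u x) (ζ x)) * sqrtDet g x) (ball (0 : Euc n) 1) ∧
    ∫ x in ball (0 : Euc n) 1, ((∑ i, ∑ j, (g x)⁻¹ i j * rdot (pd u i x) (pd ζ j x))
        - (1 - ‖u x‖ ^ 2) / ε ^ 2 * rdot (u x) (ζ x)) * sqrtDet g x = 0 := by
  obtain ⟨hud, hu1, hui, huw⟩ := hu
  have huc : AEMeasurable u (volume.restrict (ball (0 : Euc n) 1)) :=
    hud.continuousOn.aemeasurable measurableSet_ball
  have hb := hg.aemeasurable_sqrtDet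
  have hb0 : ∀ x, |sqrtDet g x| = sqrtDet g x := fun x => abs_of_nonneg (Real.sqrt_nonneg _)
  have : IsFiniteMeasure (volume.restrict (ball (0 : Euc n) 1)) :=
    ⟨by simpa using measure_ball_lt_top⟩
  have hP : ∀ i, AEMeasurable (pd u i) (volume.restrict (ball (0 : Euc n) 1)) :=
    fun i => (measurable_pd u i).aemeasurable
  have hW : AEMeasurable (pot ε u) (volume.restrict (ball (0 : Euc n) 1)) :=
    ((((huc.norm).pow_const 2).const_sub 1).pow_const 2).div_const _
  have hS := hg.integrableOn_sizeForm hlam hβ hP hW (pot_nonneg ε u) hui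
  have hPL := memLp_of_integrableOn_sizeForm hP (pot_nonneg ε u) hS
  set A : Fin n → Euc n → ℂ := fun j => (ball (0 : Euc n) 1).indicator
    fun x => ∑ i, ((g x)⁻¹ i j * sqrtDet g x) • pd u i x with hAdef
  set f : Euc n → ℂ := (ball (0 : Euc n) 1).indicator
    fun x => ((1 - ‖u x‖ ^ 2) / ε ^ 2 * sqrtDet g x) • u x with hfdef
  have hA : ∀ j, MemLp (A j) 2 volume := by
    intro j
    rw [hAdef, memLp_indicator_iff_restrict measurableSet_ball]
    refine memLp_finsetSum _ fun i _ => ?_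
    refine (hPL i).of_le_mul (c := L * L)
      (((hg.aemeasurable_inv i j).mul hb).smul (hP i)).aestronglyMeasurable ?_
    filter_upwards [ae_restrict_mem measurableSet_ball] with x hx
    rw [norm_smul, Real.norm_eq_abs, abs_mul, hb0]
    refine mul_le_mul_of_nonneg_right ?_ (norm_nonneg _)
    exact mul_le_mul (hg.inv_le x hx i j) (hg.det_le x hx) (Real.sqrt_nonneg _) hL.le
  have hf : MemLp f 2 volume := by
    rw [hfdef, memLp_indicator_iff_restrict measurableSet_ball]
    refine MemLp.of_bound (((((huc.norm.pow_const 2).const_sub 1).div_const _).mul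
      hb).smul huc).aestronglyMeasurable (1 / ε ^ 2 * L) ?_
    filter_upwards [ae_restrict_mem measurableSet_ball] with x hx
    have h1 := hu1 x hx
    have h2 : ‖u x‖ ^ 2 ≤ 1 := pow_le_one₀ (norm_nonneg _) h1
    have h3 : 0 ≤ (1 - ‖u x‖ ^ 2) / ε ^ 2 := div_nonneg (by linarith) (by positivity)
    rw [norm_smul, Real.norm_eq_abs, abs_mul, hb0,
      abs_of_nonneg h3]
    have h4 : (1 - ‖u x‖ ^ 2) / ε ^ 2 ≤ 1 / ε ^ 2 :=
      div_le_div_of_nonneg_right (by nlinarith [norm_nonneg (u x)]) (by positivity)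
    have h5 : (1 - ‖u x‖ ^ 2) / ε ^ 2 * sqrtDet g x ≤ 1 / ε ^ 2 * L :=
      mul_le_mul h4 (hg.det_le x hx) (Real.sqrt_nonneg _) (by positivity)
    calc _ ≤ (1 / ε ^ 2 * L) * 1 := mul_le_mul h5 h1 (norm_nonneg _) (by positivity)
      _ = _ := mul_one _
  have hpt : ∀ ζ : Euc n → ℂ, (fun x => (∑ j, inner ℝ (A j x) (pd ζ j x)) - inner ℝ (f x) (ζ x)) =
      (ball (0 : Euc n) 1).indicator fun x =>
      ((∑ i, ∑ j, (g x)⁻¹ i j * rdot (pd u i x) (pd ζ j x))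
        - (1 - ‖u x‖ ^ 2) / ε ^ 2 * rdot (u x) (ζ x)) * sqrtDet g x := by
    intro ζ
    funext x
    by_cases hx : x ∈ ball (0 : Euc n) 1
    · simp only [hAdef, hfdef, Set.indicator_of_mem hx, sum_inner, real_inner_smul_left,
        ← rdot_eq_inner]
      rw [Finset.sum_comm, sub_mul, Finset.sum_mul]
      congr 1
      · refine Finset.sum_congr rfl fun i _ => ?_
        rw [Finset.sum_mul]
        exact Finset.sum_congr rfl fun j _ => by ring
      · ring
    · simp [hAdef, hfdef, Set.indicator_of_notMem hx]
  have hζL : MemLp ζ 2 volume := by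
    refine hζ.continuous.memLp_of_hasCompactSupport ?_
    refine HasCompactSupport.of_support_subset_isCompact (isCompact_closedBall (0 : Euc n) R) ?_
    intro x hx
    rw [mem_closedBall_zero_iff]
    by_contra! h
    exact hx (hsupp x h)
  have hInteg : Integrable fun x => (∑ j, inner ℝ (A j x) (pd ζ j x)) - inner ℝ (f x) (ζ x) :=
    (integrable_finsetSum _ fun j _ => integrable_inner_of_memLp (hA j) (hζ' j)).sub
      (integrable_inner_of_memLp hf hζL)
  have hmain := weak_eq_of_differentiable hA hf (fun ζ h1 h2 => by
    rw [hpt ζ, integral_indicator measurableSet_ball]; exact huw ζ h1 h2) hζ hR hsupp hζ'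
  rw [hpt ζ] at hInteg hmain
  rw [integral_indicator measurableSet_ball] at hmain
  exact ⟨(integrable_indicator_iff measurableSet_ball).1 hInteg, hmain⟩

end GoodMetric

/-- The difference of `u` and its radial deformation, extended by zero. -/
def radialDiff {n : ℕ} (h : ℝ → ℝ) (t : ℝ) (u : Euc n → ℂ) : Euc n → ℂ :=
  (ball (0 : Euc n) 1).indicator fun x => u (radialMap h t x) - u x

namespace IsProfile

variable {h : ℝ → ℝ} {σ ρ H : ℝ} (hh : IsProfile h σ ρ H) {n : ℕ} {u : Euc n → ℂ} {t : ℝ}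
include hh

lemma radialDiff_eq_zero {x : Euc n} (hx : ρ ≤ ‖x‖) : radialDiff h t u x = 0 := by
  unfold radialDiff
  by_cases hxb : x ∈ ball (0 : Euc n) 1
  · rw [Set.indicator_of_mem hxb, hh.radialMap_eq_self hx, sub_self]
  · rw [Set.indicator_of_notMem hxb]

lemma hasFDerivAt_radialDiff (hu : DifferentiableOn ℝ u (ball 0 1)) (ht : 0 ≤ t)
    (htH : t * H < 1) (x : Euc n) :
    HasFDerivAt (radialDiff h t u) ((ball (0 : Euc n) 1).indicator
      (fun x => fderiv ℝ (fun x => u (radialMap h t x)) x - fderiv ℝ u x) x) x := by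
  by_cases hxb : x ∈ ball (0 : Euc n) 1
  · rw [Set.indicator_of_mem hxb]
    have h1 : HasFDerivAt (fun x => u (radialMap h t x)) _ x :=
      hh.hasFDerivAt_radialMap t x |> fun h1 => HasFDerivAt.comp x
        (hu.differentiableAt (isOpen_ball.mem_nhds
          (hh.radialMap_mem_ball ht htH hxb))).hasFDerivAt h1
    have h2 := h1.differentiableAt.hasFDerivAt.sub
      (hu.differentiableAt (isOpen_ball.mem_nhds hxb)).hasFDerivAt
    refine h2.congr_of_eventuallyEq ?_
    filter_upwards [isOpen_ball.mem_nhds hxb] with y hy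
    exact Set.indicator_of_mem hy _
  · rw [Set.indicator_of_notMem hxb]
    refine (hasFDerivAt_const (0 : ℂ) x).congr_of_eventuallyEq ?_
    have hx : ρ < ‖x‖ := by
      rw [mem_ball_zero_iff, not_lt] at hxb
      exact hh.ρ_lt.trans_le hxb
    filter_upwards [(isOpen_lt continuous_const continuous_norm).mem_nhds hx] with y hy
    exact hh.radialDiff_eq_zero (le_of_lt hy)

lemma pd_radialDiff (hu : DifferentiableOn ℝ u (ball 0 1)) (ht : 0 ≤ t) (htH : t * H < 1)
    (j : Fin n) :
    (fun x => pd (radialDiff h t u) j x) = (ball (0 : Euc n) 1).indicator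
      (fun x => pd (fun x => u (radialMap h t x)) j x - pd u j x) := by
  funext x
  rw [pd, (hh.hasFDerivAt_radialDiff hu ht htH x).fderiv]
  by_cases hxb : x ∈ ball (0 : Euc n) 1
  · simp [Set.indicator_of_mem hxb, pd]
  · simp [Set.indicator_of_notMem hxb]

lemma integral_radialDiff_le (hn : 1 ≤ n) (hu : DifferentiableOn ℝ u (ball 0 1)) (ht : 0 ≤ t)
    (htH : t * H ≤ 1 / 2) (hfin : ∫⁻ x in ball (0 : Euc n) 1, ‖fderiv ℝ u x‖ₑ ^ 2 < ⊤) :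
    IntegrableOn (fun x => ‖radialDiff h t u x‖ ^ 2) (ball (0 : Euc n) 1) ∧
    ∫ x in ball (0 : Euc n) 1, ‖radialDiff h t u x‖ ^ 2 ≤
      2 * H ^ 2 * t ^ 2 * (∫⁻ x in ball (0 : Euc n) 1, ‖fderiv ℝ u x‖ₑ ^ 2).toReal := by
  have h1 := hh.lintegral_enorm_sub_sq_le hn hu ht htH
  have hd : Differentiable ℝ (radialDiff h t u) :=
    fun x => (hh.hasFDerivAt_radialDiff hu ht (by linarith) x).differentiableAt
  have hm : AEStronglyMeasurable (fun x => ‖radialDiff h t u x‖ ^ 2)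
      (volume.restrict (ball (0 : Euc n) 1)) :=
    (hd.continuous.norm.pow 2).aestronglyMeasurable
  have h2 : ∫⁻ x in ball (0 : Euc n) 1, ENNReal.ofReal (‖radialDiff h t u x‖ ^ 2) =
      ∫⁻ x in ball (0 : Euc n) 1, ‖u (radialMap h t x) - u x‖ₑ ^ 2 := by
    refine setLIntegral_congr_fun measurableSet_ball fun x hx => ?_
    rw [ENNReal.ofReal_pow (norm_nonneg _), ofReal_norm, radialDiff, Set.indicator_of_mem hx]
  have h3 : ENNReal.ofReal (2 * H ^ 2 * t ^ 2) *
      ∫⁻ x in ball (0 : Euc n) 1, ‖fderiv ℝ u x‖ₑ ^ 2 < ⊤ :=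
    ENNReal.mul_lt_top (by simp) hfin
  have h0 : 0 ≤ᵐ[volume.restrict (ball (0 : Euc n) 1)] fun x => ‖radialDiff h t u x‖ ^ 2 :=
    Eventually.of_forall fun x => by positivity
  refine ⟨⟨hm, ?_⟩, ?_⟩
  · rw [hasFiniteIntegral_iff_ofReal h0, h2]
    exact h1.trans_lt h3
  · rw [integral_eq_lintegral_of_nonneg_ae h0 hm, h2]
    refine (ENNReal.toReal_mono h3.ne h1).trans_eq ?_
    rw [ENNReal.toReal_mul, ENNReal.toReal_ofReal (by positivity)]

end IsProfile

namespace GoodMetric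

variable {n : ℕ} {g : Euc n → Matrix (Fin n) (Fin n) ℝ} {lam L β : ℝ}
  (hg : GoodMetric n g lam L β)
include hg

lemma integrableOn_sizeForm_sol (hlam : 0 < lam) (hβ : 0 < β) {ε : ℝ} {u : Euc n → ℂ}
    (hu : IsGLSol n g ε u) :
    AEMeasurable (pot ε u) (volume.restrict (ball (0 : Euc n) 1)) ∧
    IntegrableOn (fun x => sizeForm (fun i => pd u i x) (pot ε u x)) (ball (0 : Euc n) 1) := by
  have huc : AEMeasurable u (volume.restrict (ball (0 : Euc n) 1)) :=
    hu.1.continuousOn.aemeasurable measurableSet_ball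
  have hW : AEMeasurable (pot ε u) (volume.restrict (ball (0 : Euc n) 1)) :=
    ((((huc.norm).pow_const 2).const_sub 1).pow_const 2).div_const _
  exact ⟨hW, hg.integrableOn_sizeForm hlam hβ (fun i => (measurable_pd u i).aemeasurable) hW
    (pot_nonneg ε u) hu.2.2.1⟩

lemma integrableOn_varForm (hlam : 0 < lam) (hL : 0 < L) (hβ : 0 < β) {ε : ℝ} {u : Euc n → ℂ}
    (hu : IsGLSol n g ε u) {h : ℝ → ℝ} {σ ρ H : ℝ} (hh : IsProfile h σ ρ H) (C : ℝ) :
    IntegrableOn (fun x => varForm g C h x (fun i => pd u i x) (pot ε u x))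
      (ball (0 : Euc n) 1) := by
  obtain ⟨hW, hS⟩ := hg.integrableOn_sizeForm_sol hlam hβ hu
  obtain ⟨K, hK, h1⟩ := hg.abs_varForm_le hL C hh.H_pos
  refine (hS.const_mul K).mono' (hg.aemeasurable_varForm C hh
    (fun i => (measurable_pd u i).aemeasurable) hW).aestronglyMeasurable ?_
  filter_upwards [ae_restrict_mem measurableSet_ball] with x hx
  exact h1 hh x hx _ _ (pot_nonneg ε u x)

/-- Inner variation inequality with an error term. -/
lemma variation_quotient_nonneg (hlam : 0 < lam) (hL : 0 < L) (hβ : 0 < β) (hn : 1 ≤ n) {ε : ℝ}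
    (hε : 0 < ε) {u : Euc n → ℂ} (hu : IsGLSol n g ε u) {h : ℝ → ℝ} {σ ρ H : ℝ}
    (hh : IsProfile h σ ρ H) {δ : ℝ} (hδ : 0 < δ) :
    ∃ t₀ K : ℝ, 0 < t₀ ∧ ∀ t : ℝ, 0 < t → t ≤ t₀ →
      0 ≤ (∫ x in ball (0 : Euc n) 1,
        varForm g (varConst n lam L β) h x (fun i => pd u i x) (pot ε u x)) +
        δ * (∫ x in ball (0 : Euc n) 1, sizeForm (fun i => pd u i x) (pot ε u x)) + K * t := by
  obtain ⟨hW, hS⟩ := hg.integrableOn_sizeForm_sol hlam hβ hu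
  have hV := hg.integrableOn_varForm hlam hL hβ hu hh (varConst n lam L β)
  have hfin := lintegral_fderiv_lt_top (pot_nonneg ε u) hS
  have hud := hu.1
  have hP : ∀ i, AEMeasurable (pd u i) (volume.restrict (ball (0 : Euc n) 1)) :=
    fun i => (measurable_pd u i).aemeasurable
  obtain ⟨t₀, ht₀, htH₀, key⟩ := hg.variation_le_transported hlam hL hβ hn hh hδ
  set M := (∫⁻ x in ball (0 : Euc n) 1, ‖fderiv ℝ u x‖ₑ ^ 2).toReal
  refine ⟨t₀, L * (1 / (2 * ε ^ 2)) * (2 * H ^ 2 * M), ht₀, fun t ht htt => ?_⟩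
  have hH := hh.H_pos
  have htH : t * H ≤ 1 / 2 := (mul_le_mul_of_nonneg_right htt hH.le).trans htH₀
  have htH1 : t * H < 1 := by linarith
  set G : Euc n → ℝ := fun x => eForm g x (fun i => pd u i x) (pot ε u x) +
    t * (varForm g (varConst n lam L β) h x (fun i => pd u i x) (pot ε u x) +
      δ * sizeForm (fun i => pd u i x) (pot ε u x)) with hG
  have hE : IntegrableOn (fun x => eForm g x (fun i => pd u i x) (pot ε u x))
    (ball (0 : Euc n) 1) := hu.2.2.1
  have hGi : IntegrableOn G (ball (0 : Euc n) 1) := hE.add ((hV.add (hS.const_mul δ)).const_mul t)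
  have hGc := hh.integrableOn_comp_radialMap hn ht.le htH hGi
  set v : Euc n → ℂ := fun x => u (radialMap h t x) with hv
  have hvG : ∀ x ∈ ball (0 : Euc n) 1,
      (quad (g x)⁻¹ (fun i => pd v i x) / 2 + pot ε v x) * sqrtDet g x ≤
        G (radialMap h t x) * radialJac h t x := by
    intro x hx
    have := key t ht.le htt x hx (fun i => pd u i (radialMap h t x)) (pot ε u (radialMap h t x))
      (pot_nonneg _ _ _)
    rw [funext fun i => (pd_comp_radialMap hh hud ht.le htH1 hx i).2]
    exact this
  have hvL : ∀ i, MemLp (pd v i) 2 (volume.restrict (ball (0 : Euc n) 1)) := by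
    intro i
    have hm := (measurable_pd v i).aestronglyMeasurable (μ := volume.restrict (ball (0 : Euc n) 1))
    rw [memLp_two_iff_integrable_sq_norm hm]
    refine (hGc.const_mul (2 / (lam * β))).mono' (hm.norm.pow 2) ?_
    filter_upwards [ae_restrict_mem measurableSet_ball] with x hx
    rw [Real.norm_eq_abs, abs_of_nonneg (by positivity)]
    have h1 := hvG x hx
    have h2 := hg.sum_norm_sq_le_quad hx fun i => pd v i x
    have h3 : ‖pd v i x‖ ^ 2 ≤ ∑ i, ‖pd v i x‖ ^ 2 :=
      Finset.single_le_sum (f := fun i => ‖pd v i x‖ ^ 2) (fun j _ => by positivity)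
        (Finset.mem_univ i)
    have h4 := hg.le_det x hx
    have h5 := pot_nonneg ε v x
    have h6 : lam * ‖pd v i x‖ ^ 2 ≤ quad (g x)⁻¹ (fun i => pd v i x) :=
      (mul_le_mul_of_nonneg_left h3 hlam.le).trans h2
    have h7 : (lam * ‖pd v i x‖ ^ 2 / 2) * β ≤ G (radialMap h t x) * radialJac h t x := by
      refine le_trans (mul_le_mul ?_ h4 hβ.le ?_) h1
      · linarith
      · have : 0 ≤ lam * ‖pd v i x‖ ^ 2 := by positivity
        linarith
    rw [div_mul_eq_mul_div, le_div_iff₀ (by positivity)]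
    linarith
  have hPL := memLp_of_integrableOn_sizeForm hP (pot_nonneg ε u) hS
  have hζ' : ∀ j, MemLp (fun x => pd (radialDiff h t u) j x) 2 volume := by
    intro j
    rw [hh.pd_radialDiff hud ht.le htH1 j, memLp_indicator_iff_restrict measurableSet_ball]
    exact (hvL j).sub (hPL j)
  obtain ⟨hwi, hw0⟩ := hg.weak_eq hL hlam hβ hε hu
    (fun x => (hh.hasFDerivAt_radialDiff hud ht.le htH1 x).differentiableAt) hh.ρ_lt
    (fun x hx => hh.radialDiff_eq_zero hx.le) hζ'
  obtain ⟨hdi, hdle⟩ := hh.integral_radialDiff_le hn hud ht.le htH hfin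
  have hcmp : ∀ x ∈ ball (0 : Euc n) 1,
      ((∑ i, ∑ j, (g x)⁻¹ i j * rdot (pd u i x) (pd (radialDiff h t u) j x))
        - (1 - ‖u x‖ ^ 2) / ε ^ 2 * rdot (u x) (radialDiff h t u x)) * sqrtDet g x ≤
      G (radialMap h t x) * radialJac h t x - eForm g x (fun i => pd u i x) (pot ε u x) +
        L * (1 / (2 * ε ^ 2)) * ‖radialDiff h t u x‖ ^ 2 := by
    intro x hx
    have e1 : ∀ j, pd (radialDiff h t u) j x = pd v j x - pd u j x := fun j => by
      have := congrFun (hh.pd_radialDiff hud ht.le htH1 j) x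
      rwa [Set.indicator_of_mem hx] at this
    have e2 : radialDiff h t u x = v x - u x := Set.indicator_of_mem hx _
    simp only [e1, e2]
    have h1 := hg.quad_tangent_le hlam hx (fun i => pd u i x) (fun i => pd v i x)
    have h2 := potential_tangent_le hε (u x) (v x) (hu.2.1 x hx)
    have h3 := hvG x hx
    have hb0 : 0 ≤ sqrtDet g x := Real.sqrt_nonneg _
    have hbL := hg.det_le x hx
    have h4 := mul_le_mul_of_nonneg_right hbL
      (by positivity : 0 ≤ 1 / (2 * ε ^ 2) * ‖v x - u x‖ ^ 2)
    have h5 : ((∑ i, ∑ j, (g x)⁻¹ i j * rdot (pd u i x) (pd v j x - pd u j x))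
        - (1 - ‖u x‖ ^ 2) / ε ^ 2 * rdot (u x) (v x - u x)) ≤
        (quad (g x)⁻¹ (fun i => pd v i x) - quad (g x)⁻¹ (fun i => pd u i x)) / 2 +
          (pot ε v x - pot ε u x + 1 / (2 * ε ^ 2) * ‖v x - u x‖ ^ 2) := by
      unfold pot
      linarith
    have h6 := mul_le_mul_of_nonneg_right h5 hb0
    unfold eForm
    linarith
  have hGE : IntegrableOn (fun x => G (radialMap h t x) * radialJac h t x -
      eForm g x (fun i => pd u i x) (pot ε u x)) (ball (0 : Euc n) 1) := hGc.sub hE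
  have hVS : IntegrableOn (fun x => varForm g (varConst n lam L β) h x (fun i => pd u i x)
      (pot ε u x) + δ * sizeForm (fun i => pd u i x) (pot ε u x)) (ball (0 : Euc n) 1) :=
    hV.add (hS.const_mul δ)
  have hrhs := hGE.add (hdi.const_mul (L * (1 / (2 * ε ^ 2))))
  have hmono := setIntegral_mono_on hwi hrhs measurableSet_ball hcmp
  rw [hw0] at hmono
  simp only [Pi.add_apply] at hmono
  rw [integral_add hGE (hdi.const_mul _), integral_sub hGc hE,
    integral_const_mul, hh.integral_comp_radialMap hn ht.le htH, hG,
    integral_add hE (hVS.const_mul t), integral_const_mul,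
    integral_add hV (hS.const_mul δ), integral_const_mul] at hmono
  have h8 := mul_le_mul_of_nonneg_left hdle (by positivity : 0 ≤ L * (1 / (2 * ε ^ 2)))
  refine nonneg_of_mul_nonneg_right ?_ ht
  linarith

/-- The inner variation inequality. -/
lemma integral_varForm_nonneg (hlam : 0 < lam) (hL : 0 < L) (hβ : 0 < β) (hn : 1 ≤ n) {ε : ℝ}
    (hε : 0 < ε) {u : Euc n → ℂ} (hu : IsGLSol n g ε u) {h : ℝ → ℝ} {σ ρ H : ℝ}
    (hh : IsProfile h σ ρ H) :
    0 ≤ ∫ x in ball (0 : Euc n) 1,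
        varForm g (varConst n lam L β) h x (fun i => pd u i x) (pot ε u x) := by
  set V := ∫ x in ball (0 : Euc n) 1,
        varForm g (varConst n lam L β) h x (fun i => pd u i x) (pot ε u x)
  set S := ∫ x in ball (0 : Euc n) 1, sizeForm (fun i => pd u i x) (pot ε u x)
  have h1 : ∀ δ : ℝ, 0 < δ → 0 ≤ V + δ * S := by
    intro δ hδ
    obtain ⟨t₀, K, ht₀, h2⟩ := hg.variation_quotient_nonneg hlam hL hβ hn hε hu hh hδ
    have h3 : Tendsto (fun t : ℝ => V + δ * S + K * t) (𝓝[>] 0) (𝓝 (V + δ * S + K * 0)) :=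
      Tendsto.mono_left (Continuous.tendsto (by fun_prop) 0) nhdsWithin_le_nhds
    rw [mul_zero, add_zero] at h3
    refine ge_of_tendsto h3 ?_
    filter_upwards [Ioc_mem_nhdsGT ht₀] with t ht using h2 t ht.1 ht.2
  have h3 : Tendsto (fun δ : ℝ => V + δ * S) (𝓝[>] 0) (𝓝 (V + 0 * S)) :=
    Tendsto.mono_left (Continuous.tendsto (by fun_prop) 0) nhdsWithin_le_nhds
  rw [zero_mul, add_zero] at h3
  refine ge_of_tendsto h3 ?_
  filter_upwards [self_mem_nhdsWithin] with δ hδ using h1 δ hδ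

end GoodMetric

namespace GoodMetric

variable {n : ℕ} {g : Euc n → Matrix (Fin n) (Fin n) ℝ} {lam L β : ℝ}
  (hg : GoodMetric n g lam L β)
include hg

lemma integral_varForm_nonneg_of_tendsto (hlam : 0 < lam) (hL : 0 < L) (hβ : 0 < β) (hn : 1 ≤ n)
    {ε : ℝ} (hε : 0 < ε) {u : Euc n → ℂ} (hu : IsGLSol n g ε u) {hk : ℕ → ℝ → ℝ} {h : ℝ → ℝ}
    {σ ρ H : ℝ} (hh : ∀ᶠ k in atTop, IsProfile (hk k) σ ρ H)
    (hlim : ∀ s, Tendsto (fun k => hk k s) atTop (𝓝 (h s))) :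
    IntegrableOn (fun x => varForm g (varConst n lam L β) h x (fun i => pd u i x) (pot ε u x))
      (ball (0 : Euc n) 1) ∧
    0 ≤ ∫ x in ball (0 : Euc n) 1,
      varForm g (varConst n lam L β) h x (fun i => pd u i x) (pot ε u x) := by
  obtain ⟨hW, hS⟩ := hg.integrableOn_sizeForm_sol hlam hβ hu
  obtain ⟨k₀, hk₀⟩ := hh.exists
  obtain ⟨K, hK, hb⟩ := hg.abs_varForm_le hL (varConst n lam L β) hk₀.H_pos
  have hcut : ∀ r, Tendsto (fun k => cutoff (hk k) r) atTop (𝓝 (cutoff h r)) := by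
    intro r
    refine intervalIntegral.tendsto_integral_filter_of_dominated_convergence (fun _ => H) ?_ ?_
      (by simp) ?_
    · filter_upwards [hh] with k hk using hk.cont.aestronglyMeasurable
    · filter_upwards [hh] with k hk
      exact Eventually.of_forall fun s _ => by
        rw [Real.norm_eq_abs, abs_of_nonneg (hk.nonneg s)]; exact hk.le s
    · exact Eventually.of_forall fun s _ => hlim s
  have hpt : ∀ x : Euc n, Tendsto (fun k => varForm g (varConst n lam L β) (hk k) x
      (fun i => pd u i x) (pot ε u x)) atTop (𝓝 (varForm g (varConst n lam L β) h x
      (fun i => pd u i x) (pot ε u x))) := by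
    intro x
    have c := hcut ‖x‖
    have l := hlim ‖x‖
    unfold varForm
    exact ((c.neg.mul_const _).add (((c.mul_const _).const_mul _).mul_const _)).add
      ((l.mul_const _).mul_const _)
  have hmeas : ∀ᶠ k in atTop, AEStronglyMeasurable (fun x => varForm g (varConst n lam L β) (hk k) x
      (fun i => pd u i x) (pot ε u x)) (volume.restrict (ball (0 : Euc n) 1)) := by
    filter_upwards [hh] with k hk
    exact (hg.aemeasurable_varForm _ hk (fun i => (measurable_pd u i).aemeasurable)
      hW).aestronglyMeasurable
  have hdom : ∀ᶠ k in atTop, ∀ᵐ x ∂(volume.restrict (ball (0 : Euc n) 1)),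
      ‖varForm g (varConst n lam L β) (hk k) x (fun i => pd u i x) (pot ε u x)‖ ≤
      K * sizeForm (fun i => pd u i x) (pot ε u x) := by
    filter_upwards [hh] with k hk
    filter_upwards [ae_restrict_mem measurableSet_ball] with x hx
    exact hb hk x hx _ _ (pot_nonneg ε u x)
  have hSK := hS.const_mul K
  refine ⟨?_, ?_⟩
  · obtain ⟨N, hN⟩ := (hmeas.and hdom).exists_forall_of_atTop
    refine hSK.mono' (aestronglyMeasurable_of_tendsto_ae atTop
      (f := fun k x => varForm g (varConst n lam L β) (hk (k + N)) x (fun i => pd u i x) (pot ε u x))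
      (fun k => (hN (k + N) (by omega)).1)
      (Eventually.of_forall fun x => (hpt x).comp (tendsto_add_atTop_nat N))) ?_
    have : ∀ᵐ x ∂(volume.restrict (ball (0 : Euc n) 1)), ∀ k : ℕ,
        ‖varForm g (varConst n lam L β) (hk (k + N)) x (fun i => pd u i x) (pot ε u x)‖ ≤
        K * sizeForm (fun i => pd u i x) (pot ε u x) :=
      ae_all_iff.2 fun k => (hN (k + N) (by omega)).2
    filter_upwards [this] with x hx
    exact le_of_tendsto ((hpt x).comp (tendsto_add_atTop_nat N)).norm
      (Eventually.of_forall fun k => hx k)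
  · refine ge_of_tendsto (tendsto_integral_filter_of_dominated_convergence _ hmeas hdom hSK
      (Eventually.of_forall hpt)) ?_
    filter_upwards [hh] with k hk
    exact hg.integral_varForm_nonneg hlam hL hβ hn hε hu hk

end GoodMetric

/-- Continuous approximation of the indicator function of `[σ, ρ)`. -/
def plateau (σ ρ : ℝ) (k : ℕ) (s : ℝ) : ℝ :=
  max 0 (min 1 (k * (s - σ) + 1)) * max 0 (min 1 (k * (ρ - s)))

lemma plateau_nonneg (σ ρ : ℝ) (k : ℕ) (s : ℝ) : 0 ≤ plateau σ ρ k s := by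
  unfold plateau; positivity

lemma plateau_le_one (σ ρ : ℝ) (k : ℕ) (s : ℝ) : plateau σ ρ k s ≤ 1 :=
  mul_le_one₀ (max_le zero_le_one (min_le_left _ _)) (le_max_left _ _)
    (max_le zero_le_one (min_le_left _ _))

lemma continuous_plateau (σ ρ : ℝ) (k : ℕ) : Continuous (plateau σ ρ k) := by
  unfold plateau; fun_prop

lemma plateau_eq_zero_right {σ ρ : ℝ} (k : ℕ) {s : ℝ} (hs : ρ ≤ s) : plateau σ ρ k s = 0 := by
  have : (k : ℝ) * (ρ - s) ≤ 0 := mul_nonpos_of_nonneg_of_nonpos k.cast_nonneg (by linarith)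
  unfold plateau
  rw [max_eq_left ((min_le_right _ _).trans this), mul_zero]

lemma plateau_eq_zero_left {σ ρ : ℝ} {k : ℕ} {s : ℝ} (hs : k * (s - σ) + 1 ≤ 0) :
    plateau σ ρ k s = 0 := by
  unfold plateau
  rw [max_eq_left ((min_le_right _ _).trans hs), zero_mul]

lemma tendsto_plateau (σ ρ s : ℝ) :
    Tendsto (fun k => plateau σ ρ k s) atTop (𝓝 ((Set.Ico σ ρ).indicator 1 s)) := by
  have hcast : Tendsto (fun k : ℕ => (k : ℝ)) atTop atTop := tendsto_natCast_atTop_atTop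
  by_cases h1 : s < σ
  · rw [Set.indicator_of_notMem (fun h => absurd h.1 (not_le.2 h1))]
    refine tendsto_const_nhds.congr' ?_
    filter_upwards [hcast.eventually_ge_atTop (1 / (σ - s))] with k hk
    rw [div_le_iff₀ (by linarith)] at hk
    exact (plateau_eq_zero_left (by linarith)).symm
  by_cases h2 : ρ ≤ s
  · rw [Set.indicator_of_notMem (fun h => absurd h.2 (not_lt.2 h2))]
    exact tendsto_const_nhds.congr fun k => (plateau_eq_zero_right k h2).symm
  push Not at h1 h2
  have hs : s ∈ Set.Ico σ ρ := ⟨h1, h2⟩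
  rw [Set.indicator_of_mem hs, Pi.one_apply]
  refine tendsto_const_nhds.congr' ?_
  filter_upwards [hcast.eventually_ge_atTop (1 / (ρ - s))] with k hk
  rw [div_le_iff₀ (by linarith)] at hk
  have : 0 ≤ (k : ℝ) * (s - σ) := mul_nonneg k.cast_nonneg (by linarith)
  unfold plateau
  rw [min_eq_left (by linarith), min_eq_left hk]
  simp

namespace GoodMetric

variable {n : ℕ} {g : Euc n → Matrix (Fin n) (Fin n) ℝ} {lam L β : ℝ}
  (hg : GoodMetric n g lam L β)
include hg

/-- The inner variation inequality for a profile truncated to `[σ, ρ)`. -/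
lemma integral_varForm_indicator_nonneg (hlam : 0 < lam) (hL : 0 < L) (hβ : 0 < β) (hn : 1 ≤ n)
    {ε : ℝ} (hε : 0 < ε) {u : Euc n → ℂ} (hu : IsGLSol n g ε u) {f : ℝ → ℝ} (hf : Continuous f)
    (hf0 : ∀ s, 0 ≤ f s) {σ ρ : ℝ} (hσ : 0 < σ) (hσρ : σ < ρ) (hρ : ρ < 1) :
    IntegrableOn (fun x => varForm g (varConst n lam L β) ((Set.Ico σ ρ).indicator f) x
      (fun i => pd u i x) (pot ε u x)) (ball (0 : Euc n) 1) ∧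
    0 ≤ ∫ x in ball (0 : Euc n) 1, varForm g (varConst n lam L β) ((Set.Ico σ ρ).indicator f) x
      (fun i => pd u i x) (pot ε u x) := by
  obtain ⟨M, hM⟩ := isCompact_Icc.exists_bound_of_continuousOn (s := Set.Icc (0 : ℝ) 1)
    hf.continuousOn
  have hM0 : 0 ≤ M := (norm_nonneg _).trans (hM 0 (by simp))
  refine hg.integral_varForm_nonneg_of_tendsto hlam hL hβ hn hε hu (σ := σ / 2) (ρ := ρ)
    (H := M + 1) (hk := fun k s => plateau σ ρ k s * f s) ?_ fun s => ?_
  · have hcast : Tendsto (fun k : ℕ => (k : ℝ)) atTop atTop := tendsto_natCast_atTop_atTop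
    filter_upwards [hcast.eventually_ge_atTop (1 / (σ / 2))] with k hk
    rw [div_le_iff₀ (by linarith)] at hk
    have hz : ∀ s, s ≤ σ / 2 → plateau σ ρ k s = 0 := fun s hs => by
      refine plateau_eq_zero_left ?_
      have := mul_le_mul_of_nonneg_left (by linarith : s - σ ≤ -(σ / 2)) (k.cast_nonneg (α := ℝ))
      linarith
    refine ⟨(continuous_plateau σ ρ k).mul hf, fun s => mul_nonneg (plateau_nonneg _ _ _ _) (hf0 s),
      fun s => ?_, fun s hs => ?_, fun s hs => ?_, by linarith, by linarith, hρ, by linarith⟩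
    · by_cases h0 : s ≤ σ / 2
      · simp only [hz s h0]; linarith
      by_cases h1 : ρ ≤ s
      · simp only [plateau_eq_zero_right k h1]; linarith
      push Not at h0 h1
      have h2 := hM s ⟨by linarith, by linarith⟩
      rw [Real.norm_eq_abs, abs_of_nonneg (hf0 s)] at h2
      calc plateau σ ρ k s * f s ≤ 1 * f s :=
            mul_le_mul_of_nonneg_right (plateau_le_one _ _ _ _) (hf0 s)
        _ ≤ M + 1 := by linarith
    · simp only [hz s hs, zero_mul]
    · simp only [plateau_eq_zero_right k hs, zero_mul]
  · have := (tendsto_plateau σ ρ s).mul_const (f s)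
    convert this using 2
    by_cases hs : s ∈ Set.Ico σ ρ
    · simp [Set.indicator_of_mem hs]
    · simp [Set.indicator_of_notMem hs]

end GoodMetric

/-- Integration of `s ↦ k s ∫_{B_s} F` as a weighted integral over the unit ball. -/
lemma integral_mul_integral_ball {n : ℕ} {F : Euc n → ℝ} (hF : IntegrableOn F (ball (0 : Euc n) 1))
    {k : ℝ → ℝ} {σ ρ : ℝ} (hσρ : σ ≤ ρ) (hρ : ρ < 1) (hk : IntegrableOn k (Set.Ioc σ ρ)) :
    IntegrableOn (fun x => (∫ s in Set.Ioc (max σ ‖x‖) ρ, k s) * F x) (ball (0 : Euc n) 1) ∧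
    ∫ s in σ..ρ, k s * ∫ x in ball (0 : Euc n) s, F x =
      ∫ x in ball (0 : Euc n) 1, (∫ s in Set.Ioc (max σ ‖x‖) ρ, k s) * F x := by
  set T : Set (ℝ × Euc n) := {p | ‖p.2‖ < p.1} with hT
  have hTm : MeasurableSet T := measurableSet_lt measurable_snd.norm measurable_fst
  have hprod : Integrable (T.indicator fun p : ℝ × Euc n => k p.1 * F p.2)
      ((volume.restrict (Set.Ioc σ ρ)).prod (volume.restrict (ball (0 : Euc n) 1))) :=
    (Integrable.mul_prod hk hF).indicator hTm
  have hinner : ∀ x : Euc n, ∫ s in Set.Ioc σ ρ, T.indicator (fun p : ℝ × Euc n => k p.1 * F p.2)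
      (s, x) = (∫ s in Set.Ioc (max σ ‖x‖) ρ, k s) * F x := by
    intro x
    have h1 : (fun s => T.indicator (fun p : ℝ × Euc n => k p.1 * F p.2) (s, x)) =
        (Set.Ioi ‖x‖).indicator fun s => k s * F x := by
      funext s
      by_cases hs : ‖x‖ < s
      · rw [Set.indicator_of_mem (show (s, x) ∈ T from hs),
          Set.indicator_of_mem (Set.mem_Ioi.2 hs)]
      · rw [Set.indicator_of_notMem (show (s, x) ∉ T from hs),
          Set.indicator_of_notMem (by simpa using hs)]
    rw [h1, setIntegral_indicator measurableSet_Ioi, integral_mul_const, Set.Ioc_inter_Ioi]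
  refine ⟨?_, ?_⟩
  · have := hprod.integral_prod_right
    simp only [hinner] at this
    exact this
  · rw [intervalIntegral.integral_of_le hσρ]
    have h2 : ∀ s ∈ Set.Ioc σ ρ, k s * ∫ x in ball (0 : Euc n) s, F x =
        ∫ x in ball (0 : Euc n) 1,
          T.indicator (fun p : ℝ × Euc n => k p.1 * F p.2) (s, x) := by
      intro s hs
      have h3 : (fun x => T.indicator (fun p : ℝ × Euc n => k p.1 * F p.2) (s, x)) =
          (ball (0 : Euc n) s).indicator fun x => k s * F x := by
        funext x
        by_cases hx : ‖x‖ < s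
        · rw [Set.indicator_of_mem (show (s, x) ∈ T from hx),
            Set.indicator_of_mem (mem_ball_zero_iff.2 hx)]
        · rw [Set.indicator_of_notMem (show (s, x) ∉ T from hx),
            Set.indicator_of_notMem (by simpa using hx)]
      rw [h3, setIntegral_indicator measurableSet_ball, integral_const_mul,
        Set.inter_eq_right.2 (ball_subset_ball (hs.2.trans hρ.le))]
    rw [setIntegral_congr_fun measurableSet_Ioc h2]
    rw [integral_integral_swap (f := fun s x => T.indicator
      (fun p : ℝ × Euc n => k p.1 * F p.2) (s, x)) hprod]
    simp only [hinner]

lemma cutoff_indicator {f : ℝ → ℝ} {σ ρ r : ℝ} (hρ : ρ ≤ 1) (hr : r ≤ 1) :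
    cutoff ((Set.Ico σ ρ).indicator f) r = ∫ s in Set.Ioc (max σ r) ρ, f s := by
  have h1 : ∫ s in Set.Ioc r 1, (Set.Ico σ ρ).indicator f s =
      ∫ s in Set.Ioc r 1, (Set.Ioc σ ρ).indicator f s :=
    integral_congr_ae (ae_restrict_of_ae (indicator_ae_eq_of_ae_eq_set Ico_ae_eq_Ioc))
  rw [cutoff, intervalIntegral.integral_of_le hr, h1, setIntegral_indicator measurableSet_Ioc,
    Set.Ioc_inter_Ioc, min_eq_right hρ, max_comm]

/-- The weight `e^{χ s} s^{1 - n}`. -/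
def weight (n : ℕ) (χ s : ℝ) : ℝ := Real.exp (χ * s) * s ^ ((1 : ℝ) - n)

lemma weight_nonneg (n : ℕ) (χ : ℝ) {s : ℝ} (hs : 0 ≤ s) : 0 ≤ weight n χ s :=
  mul_nonneg (Real.exp_pos _).le (Real.rpow_nonneg hs _)

lemma mul_weight (n : ℕ) (χ : ℝ) {s : ℝ} (hs : 0 < s) :
    s * weight n χ s = Real.exp (χ * s) * s ^ ((2 : ℝ) - n) := by
  have : (2 : ℝ) - n = 1 + (1 - n) := by ring
  rw [weight, this, Real.rpow_add hs, Real.rpow_one]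
  ring

lemma continuousOn_weight (n : ℕ) (χ : ℝ) {σ ρ : ℝ} (hσ : 0 < σ) :
    ContinuousOn (weight n χ) (Set.Icc σ ρ) := by
  intro s hs
  have : s ≠ 0 := (hσ.trans_le hs.1).ne'
  exact ((by fun_prop : ContinuousAt (fun s => Real.exp (χ * s)) s).mul
    (Real.continuousAt_rpow_const _ _ (Or.inl this))).continuousWithinAt

lemma hasDerivAt_mul_weight (n : ℕ) (χ : ℝ) {s : ℝ} (hs : 0 < s) :
    HasDerivAt (fun s => s * weight n χ s) ((χ * s - (n - 2)) * weight n χ s) s := by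
  have h1 : HasDerivAt (fun s : ℝ => Real.exp (χ * s)) (Real.exp (χ * s) * (χ * 1)) s :=
    ((hasDerivAt_id s).const_mul χ).exp
  have h2 := (h1.mul (Real.hasDerivAt_rpow_const (p := (1 : ℝ) - n) (Or.inl hs.ne')))
  have h3 := (hasDerivAt_id s).mul h2
  refine h3.congr_deriv ?_
  have : s ^ ((1 : ℝ) - n) = s * s ^ ((1 : ℝ) - n - 1) := by
    rw [Real.rpow_sub_one hs.ne']
    field_simp
  simp only [weight, id, Pi.mul_apply]
  rw [this]
  ring

/-- The regularised profile. -/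
def profile (n : ℕ) (χ C σ s : ℝ) : ℝ := weight n χ (max s (σ / 2)) / (1 + C * max s (σ / 2))

lemma continuous_profile (n : ℕ) (χ : ℝ) {C σ : ℝ} (hC : 0 < C) (hσ : 0 < σ) :
    Continuous (profile n χ C σ) := by
  have hpos : ∀ s, 0 < max s (σ / 2) := fun s => lt_max_of_lt_right (by linarith)
  have hm : Continuous fun s : ℝ => max s (σ / 2) := by fun_prop
  unfold profile weight
  refine Continuous.div (Continuous.mul (by fun_prop)
    (hm.rpow_const fun s => Or.inl (hpos s).ne')) (by fun_prop) fun s => ?_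
  have := hpos s
  positivity

lemma profile_nonneg (n : ℕ) (χ : ℝ) {C σ : ℝ} (hC : 0 < C) (hσ : 0 < σ) (s : ℝ) :
    0 ≤ profile n χ C σ s := by
  have hpos : 0 < max s (σ / 2) := lt_max_of_lt_right (by linarith)
  exact div_nonneg (weight_nonneg n χ hpos.le) (by positivity)

lemma profile_eq (n : ℕ) (χ C : ℝ) {σ s : ℝ} (hσ : 0 < σ) (hs : σ ≤ s) :
    profile n χ C σ s = weight n χ s / (1 + C * s) := by
  rw [profile, max_eq_left (by linarith)]

lemma integral_weight_le {n : ℕ} {χ C σ ρ m : ℝ} (hC : 0 < C) (hσ : 0 < σ) (hm : σ ≤ m) :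
    1 / (1 + C * ρ) * ∫ s in Set.Ioc m ρ, weight n χ s ≤ ∫ s in Set.Ioc m ρ, profile n χ C σ s := by
  rw [← integral_const_mul]
  have hm0 := hσ.trans_le hm
  refine setIntegral_mono_on ?_ ?_ measurableSet_Ioc fun s hs => ?_
  · exact (((continuousOn_weight n χ hm0).integrableOn_Icc).mono_set
      Set.Ioc_subset_Icc_self).const_mul _
  · exact (continuous_profile n χ hC hσ).continuousOn.integrableOn_Icc.mono_set
      Set.Ioc_subset_Icc_self
  · have hs0 : 0 < s := hm0.trans hs.1
    rw [profile_eq n χ C hσ (hm.trans hs.1.le), div_mul_eq_mul_div, one_mul]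
    have := weight_nonneg n χ hs0.le
    have := mul_le_mul_of_nonneg_left hs.2 hC.le
    have := mul_pos hC hs0
    gcongr

lemma mul_integral_profile_le {n : ℕ} (hn : 1 ≤ n) {χ C σ ρ m r : ℝ} (hC : 0 < C) (hσ : 0 < σ)
    (hm : σ ≤ m) (hmρ : m ≤ ρ) (hrm : r ≤ m) (hχ : C * (n - 1) ≤ χ) :
    (C * r - (n - 2)) * ∫ s in Set.Ioc m ρ, profile n χ C σ s ≤
      ρ * weight n χ ρ - m * weight n χ m := by
  have hm0 := hσ.trans_le hm
  have hc : ContinuousOn (fun s => (χ * s - (n - 2)) * weight n χ s) (Set.Icc m ρ) :=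
    ContinuousOn.mul (by fun_prop) (continuousOn_weight n χ hm0)
  rw [← intervalIntegral.integral_eq_sub_of_hasDerivAt (a := m) (b := ρ)
    (f := fun s => s * weight n χ s) (f' := fun s => (χ * s - (n - 2)) * weight n χ s)
    (fun s hs => hasDerivAt_mul_weight n χ (by
      rw [Set.uIcc_of_le hmρ] at hs; exact hm0.trans_le hs.1))
    (by rw [← Set.uIcc_of_le hmρ] at hc; exact hc.intervalIntegrable),
    intervalIntegral.integral_of_le hmρ, ← integral_const_mul]
  refine setIntegral_mono_on ?_ ?_ measurableSet_Ioc fun s hs => ?_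
  · exact ((continuous_profile n χ hC hσ).continuousOn.integrableOn_Icc.mono_set
      Set.Ioc_subset_Icc_self).const_mul _
  · exact hc.integrableOn_Icc.mono_set Set.Ioc_subset_Icc_self
  · have hs0 : 0 < s := hm0.trans hs.1
    have hw := weight_nonneg n χ hs0.le
    have hCs := mul_pos hC hs0
    rw [profile_eq n χ C hσ (hm.trans hs.1.le), ← mul_div_assoc, div_le_iff₀ (by linarith)]
    have hn1 : (1 : ℝ) ≤ n := by exact_mod_cast hn
    have h1 : C * r ≤ C * s := mul_le_mul_of_nonneg_left (hrm.trans hs.1.le) hC.le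
    have h2 : C * (n - 1) * s ≤ χ * s := mul_le_mul_of_nonneg_right hχ hs0.le
    have h3 : 0 ≤ C * s * (χ * s) := mul_nonneg hCs.le (le_trans (by
      have := mul_nonneg hC.le (by linarith : (0 : ℝ) ≤ n - 1)
      positivity) h2)
    have h4 : C * r - (n - 2) ≤ (χ * s - (n - 2)) * (1 + C * s) := by
      nlinarith
    have h5 := mul_le_mul_of_nonneg_right h4 hw
    linarith

lemma varForm_indicator_le {n : ℕ} (hn : 1 ≤ n) {g : Euc n → Matrix (Fin n) (Fin n) ℝ}
    {χ C σ ρ : ℝ} (hC : 0 < C) (hσ : 0 < σ) (hσρ : σ < ρ) (hρ : ρ < 1) (hχ : C * (n - 1) ≤ χ)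
    {x : Euc n} (hx : x ∈ ball (0 : Euc n) 1) (P : Fin n → ℂ) {W : ℝ} (hW : 0 ≤ W)
    (hE : 0 ≤ eForm g x P W) :
    varForm g C ((Set.Ico σ ρ).indicator (profile n χ C σ)) x P W ≤
      ρ * weight n χ ρ * (ball (0 : Euc n) ρ).indicator (fun x => eForm g x P W) x -
      σ * weight n χ σ * (ball (0 : Euc n) σ).indicator (fun x => eForm g x P W) x -
      1 / (1 + C * ρ) * ((∫ s in Set.Ioc (max σ ‖x‖) ρ, weight n χ s) * (2 * W * sqrtDet g x) +
        (ball (0 : Euc n) ρ \ ball (0 : Euc n) σ).indicator (fun x => ‖x‖ * weight n χ ‖x‖ *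
          (sqrtDet g x * ‖contr (g x)⁻¹ (dir x) P‖ ^ 2)) x) := by
  have hx1 := mem_ball_zero_iff.1 hx
  have hb0 : 0 ≤ sqrtDet g x := Real.sqrt_nonneg _
  have hρ0 := hσ.trans hσρ
  rw [varForm, cutoff_indicator hρ.le hx1.le]
  have hI := integral_weight_le (n := n) (χ := χ) (ρ := ρ) (m := max σ ‖x‖) hC hσ (le_max_left _ _)
  have hIW := mul_le_mul_of_nonneg_right hI (by positivity : 0 ≤ 2 * W * sqrtDet g x)
  by_cases h1 : ρ ≤ ‖x‖
  · have hn1 : x ∉ ball (0 : Euc n) ρ := by simpa using h1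
    have hn2 : x ∉ ball (0 : Euc n) σ := by simpa using hσρ.le.trans h1
    rw [Set.indicator_of_notMem (fun h => absurd h.2 (not_lt.2 h1)),
      Set.indicator_of_notMem hn1, Set.indicator_of_notMem hn2,
      Set.indicator_of_notMem (fun h => hn1 h.1), Set.Ioc_eq_empty (by simp [h1])]
    simp
  push Not at h1
  have hm1 : x ∈ ball (0 : Euc n) ρ := by simpa using h1
  have hD := mul_integral_profile_le (n := n) hn (ρ := ρ) (m := max σ ‖x‖) (r := ‖x‖) hC hσ
    (le_max_left _ _) (max_le hσρ.le h1.le) (le_max_right _ _) hχ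
  have hDE := mul_le_mul_of_nonneg_right hD hE
  rw [Set.indicator_of_mem hm1]
  by_cases h2 : ‖x‖ < σ
  · have hm2 : x ∈ ball (0 : Euc n) σ := by simpa using h2
    rw [Set.indicator_of_notMem (fun h => absurd h.1 (not_le.2 h2)), Set.indicator_of_mem hm2,
      Set.indicator_of_notMem (fun h => h.2 hm2)]
    rw [max_eq_left h2.le] at hIW hDE ⊢
    linarith
  · push Not at h2
    have hn2 : x ∉ ball (0 : Euc n) σ := by simpa using h2
    have hms : ‖x‖ ∈ Set.Ico σ ρ := ⟨h2, h1⟩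
    have hm3 : x ∈ ball (0 : Euc n) ρ \ ball (0 : Euc n) σ := ⟨hm1, hn2⟩
    rw [Set.indicator_of_mem hms, Set.indicator_of_notMem hn2, Set.indicator_of_mem hm3,
      profile_eq n χ C hσ h2]
    rw [max_eq_right h2] at hIW hDE ⊢
    have hr0 : 0 < ‖x‖ := hσ.trans_le h2
    have hCr := mul_pos hC hr0
    have hCr' := mul_le_mul_of_nonneg_left h1.le hC.le
    have hw := weight_nonneg n χ hr0.le
    have e1 : weight n χ ‖x‖ / (1 + C * ‖x‖) * ‖x‖ * ((1 + C * ‖x‖) * eForm g x P W -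
        sqrtDet g x * ‖contr (g x)⁻¹ (dir x) P‖ ^ 2) =
        ‖x‖ * weight n χ ‖x‖ * eForm g x P W - 1 / (1 + C * ‖x‖) * (‖x‖ * weight n χ ‖x‖ *
          (sqrtDet g x * ‖contr (g x)⁻¹ (dir x) P‖ ^ 2)) := by
      field_simp
    have e2 : 1 / (1 + C * ρ) * (‖x‖ * weight n χ ‖x‖ *
          (sqrtDet g x * ‖contr (g x)⁻¹ (dir x) P‖ ^ 2)) ≤ 1 / (1 + C * ‖x‖) *
          (‖x‖ * weight n χ ‖x‖ * (sqrtDet g x * ‖contr (g x)⁻¹ (dir x) P‖ ^ 2)) := by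
      refine mul_le_mul_of_nonneg_right ?_ (by positivity)
      exact one_div_le_one_div_of_le (by linarith) (by linarith)
    rw [e1]
    linarith

lemma varConst_pos {n : ℕ} {lam L β : ℝ} (hlam : 0 < lam) (hL : 0 < L) (hβ : 0 < β) :
    0 < varConst n lam L β := by
  unfold varConst; positivity

namespace GoodMetric

variable {n : ℕ} {g : Euc n → Matrix (Fin n) (Fin n) ℝ} {lam L β : ℝ}
  (hg : GoodMetric n g lam L β)
include hg

lemma monotonicity_of_lt (hlam : 0 < lam) (hL : 0 < L) (hβ : 0 < β) (hn : 1 ≤ n)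
    {ε : ℝ} (hε : 0 < ε) {u : Euc n → ℂ} (hu : IsGLSol n g ε u) {χ : ℝ}
    (hχ : varConst n lam L β * (n - 1) ≤ χ) {σ ρ : ℝ} (hσ : 0 < σ) (hσρ : σ < ρ) (hρ : ρ < 1) :
    (1 / (1 + varConst n lam L β * ρ)) *
      ((∫ s in σ..ρ, Real.exp (χ * s) * s ^ ((1 : ℝ) - n) *
          ∫ x in ball (0 : Euc n) s, (1 - ‖u x‖ ^ 2) ^ 2 / (2 * ε ^ 2) * sqrtDet g x)
        + ∫ x in ball (0 : Euc n) ρ \ ball (0 : Euc n) σ,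
            Real.exp (χ * ‖x‖) * ‖x‖ ^ ((2 : ℝ) - n) * ‖radD g u x‖ ^ 2 * sqrtDet g x)
    ≤ Real.exp (χ * ρ) * ρ ^ ((2 : ℝ) - n) *
        (∫ x in ball (0 : Euc n) ρ, eDen g ε u x * sqrtDet g x)
      - Real.exp (χ * σ) * σ ^ ((2 : ℝ) - n) *
        (∫ x in ball (0 : Euc n) σ, eDen g ε u x * sqrtDet g x) := by
  set C := varConst n lam L β with hCdef
  have hC : 0 < C := varConst_pos hlam hL hβ
  have hρ0 := hσ.trans hσρ
  obtain ⟨hW, hS⟩ := hg.integrableOn_sizeForm_sol hlam hβ hu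
  set P : Euc n → Fin n → ℂ := fun x i => pd u i x with hP
  obtain ⟨hVi, hV0⟩ := hg.integral_varForm_indicator_nonneg hlam hL hβ hn hε hu
    (continuous_profile n χ hC hσ) (profile_nonneg n χ hC hσ) hσ hσρ hρ
  have hEi : IntegrableOn (fun x => eForm g x (P x) (pot ε u x)) (ball (0 : Euc n) 1) := hu.2.2.1
  have hb := hg.aemeasurable_sqrtDet
  have hWb : IntegrableOn (fun x => 2 * pot ε u x * sqrtDet g x) (ball (0 : Euc n) 1) := by
    refine (hS.const_mul (2 * L)).mono' ((hW.const_mul 2).mul hb).aestronglyMeasurable ?_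
    filter_upwards [ae_restrict_mem measurableSet_ball] with x hx
    have h0 := pot_nonneg ε u x
    have hb0 : 0 ≤ sqrtDet g x := Real.sqrt_nonneg _
    rw [Real.norm_eq_abs, abs_of_nonneg (by positivity)]
    have := mul_le_mul (hg.det_le x hx) (le_sizeForm (P x) (pot ε u x)) h0 hL.le
    linarith
  obtain ⟨hFi, hFeq⟩ := integral_mul_integral_ball hWb hσρ.le hρ
    ((continuousOn_weight n χ (ρ := ρ) hσ).integrableOn_Icc.mono_set Set.Ioc_subset_Icc_self)
  set shell := ball (0 : Euc n) ρ \ ball (0 : Euc n) σ with hshell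
  have hsm : MeasurableSet shell := measurableSet_ball.diff measurableSet_ball
  have hsub : shell ⊆ ball (0 : Euc n) 1 := fun x hx => ball_subset_ball hρ.le hx.1
  set R : Euc n → ℝ := fun x => ‖x‖ * weight n χ ‖x‖ *
    (sqrtDet g x * ‖contr (g x)⁻¹ (dir x) (P x)‖ ^ 2) with hR
  have hRi : IntegrableOn (shell.indicator R) (ball (0 : Euc n) 1) := by
    obtain ⟨M, hM⟩ := isCompact_Icc.exists_bound_of_continuousOn
      (continuousOn_weight n χ (ρ := ρ) hσ)
    have hM0 : 0 ≤ M := (norm_nonneg _).trans (hM σ ⟨le_rfl, hσρ.le⟩)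
    have hRm : AEMeasurable R (volume.restrict (ball (0 : Euc n) 1)) := by
      refine AEMeasurable.mul (Measurable.aemeasurable ?_) (hb.mul (hg.aemeasurable_normSq_contr
        (P := fun i => pd u i) fun i => (measurable_pd u i).aemeasurable))
      unfold weight
      fun_prop
    refine (hS.const_mul (M * (n ^ 2 * L ^ 3))).mono' (hRm.indicator hsm).aestronglyMeasurable ?_
    filter_upwards [ae_restrict_mem measurableSet_ball] with x hx
    have hs0 := sizeForm_nonneg (P x) (pot_nonneg ε u x)
    have hx1 := mem_ball_zero_iff.1 hx
    by_cases hxs : x ∈ shell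
    · rw [Set.indicator_of_mem hxs]
      have h1 : ‖x‖ < ρ := by simpa using hxs.1
      have h2 : σ ≤ ‖x‖ := by simpa using hxs.2
      have h3 := hM ‖x‖ ⟨h2, h1.le⟩
      have h4 := hg.det_mul_contr_le hL hx (abs_dir_le x) (P x) (pot_nonneg ε u x)
      rw [hR]
      simp only [norm_mul ‖x‖, norm_norm, norm_mul (‖x‖ * _)]
      have h5 : ‖x‖ * ‖weight n χ ‖x‖‖ ≤ M := by
        calc _ ≤ 1 * M := mul_le_mul hx1.le h3 (norm_nonneg _) zero_le_one
          _ = M := one_mul M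
      rw [mul_assoc M]
      exact mul_le_mul h5 h4 (norm_nonneg _) hM0
    · rw [Set.indicator_of_notMem hxs, norm_zero]
      positivity
  have hmono : ∫ x in ball (0 : Euc n) 1,
      varForm g C ((Set.Ico σ ρ).indicator (profile n χ C σ)) x (P x) (pot ε u x) ≤
      ∫ x in ball (0 : Euc n) 1, (ρ * weight n χ ρ * (ball (0 : Euc n) ρ).indicator
          (fun x => eForm g x (P x) (pot ε u x)) x -
        σ * weight n χ σ * (ball (0 : Euc n) σ).indicator
          (fun x => eForm g x (P x) (pot ε u x)) x -
        1 / (1 + C * ρ) * ((∫ s in Set.Ioc (max σ ‖x‖) ρ, weight n χ s) *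
          (2 * pot ε u x * sqrtDet g x) + shell.indicator R x)) := by
    refine setIntegral_mono_on hVi ?_ measurableSet_ball fun x hx => ?_
    · exact (((hEi.indicator measurableSet_ball).const_mul _).sub
        ((hEi.indicator measurableSet_ball).const_mul _)).sub ((hFi.add hRi).const_mul _)
    · exact varForm_indicator_le hn hC hσ hσρ hρ hχ hx (P x) (pot_nonneg ε u x)
        (hg.eForm_nonneg hlam hx _ (pot_nonneg ε u x))
  have hi1 : IntegrableOn (fun x => ρ * weight n χ ρ * (ball (0 : Euc n) ρ).indicator
      (fun x => eForm g x (P x) (pot ε u x)) x) (ball (0 : Euc n) 1) :=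
    (hEi.indicator measurableSet_ball).const_mul _
  have hi2 : IntegrableOn (fun x => σ * weight n χ σ * (ball (0 : Euc n) σ).indicator
      (fun x => eForm g x (P x) (pot ε u x)) x) (ball (0 : Euc n) 1) :=
    (hEi.indicator measurableSet_ball).const_mul _
  have hi12 : IntegrableOn (fun x => ρ * weight n χ ρ * (ball (0 : Euc n) ρ).indicator
      (fun x => eForm g x (P x) (pot ε u x)) x - σ * weight n χ σ * (ball (0 : Euc n) σ).indicator
      (fun x => eForm g x (P x) (pot ε u x)) x) (ball (0 : Euc n) 1) := hi1.sub hi2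
  have hi3 : IntegrableOn (fun x => (∫ s in Set.Ioc (max σ ‖x‖) ρ, weight n χ s) *
          (2 * pot ε u x * sqrtDet g x) + shell.indicator R x) (ball (0 : Euc n) 1) := hFi.add hRi
  rw [integral_sub hi12 (hi3.const_mul _), integral_sub hi1 hi2, integral_const_mul,
    integral_const_mul, integral_const_mul, integral_add hFi hRi, ← hFeq,
    setIntegral_indicator measurableSet_ball, setIntegral_indicator measurableSet_ball,
    setIntegral_indicator hsm, Set.inter_eq_right.2 (ball_subset_ball hρ.le),
    Set.inter_eq_right.2 (ball_subset_ball (hσρ.le.trans hρ.le)), Set.inter_eq_right.2 hsub,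
    mul_weight n χ hρ0, mul_weight n χ hσ] at hmono
  have hA : ∫ s in σ..ρ, Real.exp (χ * s) * s ^ ((1 : ℝ) - n) *
      ∫ x in ball (0 : Euc n) s, (1 - ‖u x‖ ^ 2) ^ 2 / (2 * ε ^ 2) * sqrtDet g x =
      ∫ s in σ..ρ, weight n χ s * ∫ x in ball (0 : Euc n) s, 2 * pot ε u x * sqrtDet g x := by
    have : ∀ x, (1 - ‖u x‖ ^ 2) ^ 2 / (2 * ε ^ 2) = 2 * pot ε u x := fun x => by
      unfold pot; field_simp; ring
    simp only [this, weight]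
  have hB : ∫ x in shell, Real.exp (χ * ‖x‖) * ‖x‖ ^ ((2 : ℝ) - n) * ‖radD g u x‖ ^ 2 *
      sqrtDet g x = ∫ x in shell, R x := by
    refine setIntegral_congr_fun hsm fun x hx => ?_
    have h2 : 0 < ‖x‖ := hσ.trans_le (by simpa using hx.2)
    simp only [hR, mul_weight n χ h2, radD_eq_contr]
    ring
  rw [hA, hB]
  have hV := hV0.trans hmono
  simp only [eDen_mul_sqrtDet]
  linarith

end GoodMetric

end

/-- monotonicity formula for the Ginzburg–Landau energy. -/
theorem stmt2 (n : ℕ) (hn : 3 ≤ n) (lam Lam : ℝ) (hlam : 0 < lam) (hLam : 0 < Lam) :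
    ∃ χ C : ℝ, 0 < χ ∧ 0 < C ∧
      ∀ (g : Euc n → Matrix (Fin n) (Fin n) ℝ) (ε : ℝ) (u : Euc n → ℂ),
        0 < ε → MemM n lam Lam g → IsGLSol n g ε u →
        MonotoneOn (fun ρ : ℝ => Real.exp (χ * ρ) * ρ ^ ((2 : ℝ) - n) *
            ∫ x in ball (0 : Euc n) ρ, eDen g ε u x * sqrtDet g x) (Set.Ioo (0 : ℝ) 1) ∧
        ∀ σ ρ : ℝ, 0 < σ → σ ≤ ρ → ρ < 1 →
          (1 / (1 + C * ρ)) *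
            ((∫ s in σ..ρ, Real.exp (χ * s) * s ^ ((1 : ℝ) - n) *
                ∫ x in ball (0 : Euc n) s,
                  (1 - ‖u x‖ ^ 2) ^ 2 / (2 * ε ^ 2) * sqrtDet g x)
              + ∫ x in ball (0 : Euc n) ρ \ ball (0 : Euc n) σ,
                  Real.exp (χ * ‖x‖) * ‖x‖ ^ ((2 : ℝ) - n) * ‖radD g u x‖ ^ 2 * sqrtDet g x)
          ≤ Real.exp (χ * ρ) * ρ ^ ((2 : ℝ) - n) *
              (∫ x in ball (0 : Euc n) ρ, eDen g ε u x * sqrtDet g x)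
            - Real.exp (χ * σ) * σ ^ ((2 : ℝ) - n) *
              (∫ x in ball (0 : Euc n) σ, eDen g ε u x * sqrtDet g x) := by
  obtain ⟨L, β, hL, hβ, hGM⟩ := exists_goodMetric n lam Lam hlam
  have hC : 0 < varConst n lam L β := varConst_pos hlam hL hβ
  have hn' : (3 : ℝ) ≤ n := by exact_mod_cast hn
  refine ⟨varConst n lam L β * (n - 1), varConst n lam L β, mul_pos hC (by linarith), hC,
    fun g ε u hε hg hu => ?_⟩
  set χ := varConst n lam L β * (n - 1) with hχ
  have key : ∀ σ ρ : ℝ, 0 < σ → σ < ρ → ρ < 1 → _ := fun σ ρ hσ hσρ hρ =>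
    (hGM g hg).monotonicity_of_lt hlam hL hβ (by omega) hε hu (χ := χ) le_rfl hσ hσρ hρ
  refine ⟨fun σ hσ ρ hρ hσρ => ?_, fun σ ρ hσ hσρ hρ => ?_⟩
  · rcases hσρ.eq_or_lt with rfl | hlt
    · exact le_rfl
    refine sub_nonneg.1 (le_trans ?_ (key σ ρ hσ.1 hlt hρ.2))
    have hρ0 := hρ.1
    refine mul_nonneg (by positivity) (add_nonneg ?_ ?_)
    · refine intervalIntegral.integral_nonneg hσρ fun s hs => ?_
      have hs0 : 0 < s := hσ.1.trans_le hs.1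
      exact mul_nonneg (by positivity) (integral_nonneg fun x =>
        mul_nonneg (by positivity) (Real.sqrt_nonneg _))
    · exact integral_nonneg fun x => mul_nonneg (by positivity) (Real.sqrt_nonneg _)
  · rcases hσρ.eq_or_lt with rfl | hlt
    · simp
    · exact key σ ρ hσ hlt hρ
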